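/- Let T > 0 and let (𝓜, u) be a complete conformal Ricci flow spacetime in the ambient space ℂ × (0,T). Then for every (z,t) ∈ 𝓜 the scalar curvature of g(t) = u(·,t)|dz|² at z satisfies R_{g(t)}(z) := −(Δ log u)(z,t)/u(z,t) ≥ −1/(t − h(z,t)), where h is the hindsight function; equivalently, (Δ log u)(z,t) ≤ u(z,t)/(t − h(z,t)). In particular, if the spacetime is initially determined then (Δ log u)(z,t) ≤ u(z,t)/t for every (z,t) ∈ 𝓜. -/

import Mathlib

open Set MeasureTheory Filter Metric

/-- The Euclidean Laplacian of `f : ℂ → ℝ` at `z`, i.e. `∂²f/∂x² + ∂²f/∂y²`. -/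
noncomputable def lap (f : ℂ → ℝ) (z : ℂ) : ℝ :=
  iteratedFDeriv ℝ 2 f z ![1, 1] + iteratedFDeriv ℝ 2 f z ![Complex.I, Complex.I]

/-- The time-timeSlice of a spacetime `M ⊆ ℂ × ℝ` at time `t`. -/
def timeSlice (M : Set (ℂ × ℝ)) (t : ℝ) : Set ℂ := {z | (z, t) ∈ M}

/-- The conformal distance on `Ω` induced by a conformal factor `v`: the infimum of
`v`-lengths of `C¹` paths in `Ω` joining `x` to `y`. -/
noncomputable def confDist (v : ℂ → ℝ) (Ω : Set ℂ) (x y : ℂ) : ℝ :=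
  sInf {L : ℝ | ∃ γ : ℝ → ℂ, ContDiffOn ℝ 1 γ (Icc 0 1) ∧
    (∀ s ∈ Icc (0:ℝ) 1, γ s ∈ Ω) ∧ γ 0 = x ∧ γ 1 = y ∧
    L = ∫ s in (0:ℝ)..1, Real.sqrt (v (γ s)) * ‖derivWithin γ (Icc 0 1) s‖}

/-- The conformal ball of centre `p` and radius `ρ` in `Ω` for the metric `v|dz|²`. -/
def confBall (v : ℂ → ℝ) (Ω : Set ℂ) (p : ℂ) (ρ : ℝ) : Set ℂ :=
  {z ∈ connectedComponentIn Ω p | confDist v Ω p z < ρ}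

/-- The conformal metric `v|dz|²` is complete on `Ω`: every connected component of `Ω` is a
complete metric space with respect to the induced distance `confDist v Ω`. -/
def ConfComplete (v : ℂ → ℝ) (Ω : Set ℂ) : Prop :=
  ∀ x₀ ∈ Ω, ∀ x : ℕ → ℂ, (∀ n, x n ∈ connectedComponentIn Ω x₀) →
    (∀ ε : ℝ, 0 < ε → ∃ N : ℕ, ∀ m ≥ N, ∀ n ≥ N, confDist v Ω (x m) (x n) < ε) →
    ∃ l ∈ connectedComponentIn Ω x₀,
      Tendsto (fun n => confDist v Ω (x n) l) atTop (nhds 0)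

/-- A conformal Ricci flow spacetime in the ambient space `ℂ × (0,T)`:
`M` is a connected open subset of `ℂ × (0,T)` with non-empty time-slices, and `u` is a smooth
positive conformal factor on `M` solving the logarithmic fast diffusion equation
`∂u/∂t = Δ log u`. -/
structure ConfRFS (T : ℝ) (M : Set (ℂ × ℝ)) (u : ℂ → ℝ → ℝ) : Prop where
  sub : M ⊆ {p : ℂ × ℝ | p.2 ∈ Ioo 0 T}
  opn : IsOpen M
  conn : IsConnected M
  nonempty : ∀ t ∈ Ioo (0:ℝ) T, (timeSlice M t).Nonempty
  pos : ∀ p ∈ M, 0 < u p.1 p.2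
  smooth : ContDiffOn ℝ (⊤ : ℕ∞) (fun p : ℂ × ℝ => u p.1 p.2) M
  lfde : ∀ p ∈ M, deriv (u p.1) p.2 = lap (fun z => Real.log (u z p.2)) p.1

/-- A conformal Ricci flow spacetime is complete if the metric `u(·,t)|dz|²` is complete on the
timeSlice `M_t` for every `t ∈ (0,T)`. -/
def ConfRFSComplete (T : ℝ) (M : Set (ℂ × ℝ)) (u : ℂ → ℝ → ℝ) : Prop :=
  ∀ t ∈ Ioo (0:ℝ) T, ConfComplete (fun z => u z t) (timeSlice M t)

/-- There is a time-preserving path in `M` from time `s` to the point `(z,t)`. -/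
def TimePreservingFrom (M : Set (ℂ × ℝ)) (s : ℝ) (z : ℂ) (t : ℝ) : Prop :=
  ∃ γ : ℝ → ℂ, ContinuousOn γ (Icc s t) ∧ (∀ r ∈ Icc s t, (γ r, r) ∈ M) ∧ γ t = z

/-- The hindsight function of a spacetime `M`. -/
noncomputable def hindsight (M : Set (ℂ × ℝ)) (z : ℂ) (t : ℝ) : ℝ :=
  sInf {s : ℝ | 0 < s ∧ s ≤ t ∧ TimePreservingFrom M s z t}

/-- A spacetime is initially determined if its hindsight function vanishes identically. -/
def InitiallyDetermined (M : Set (ℂ × ℝ)) : Prop :=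
  ∀ p ∈ M, hindsight M p.1 p.2 = 0

/-- A spacetime in `ℂ × (0,T)` is expanding if worldlines persist until the final time. -/
def Expanding (T : ℝ) (M : Set (ℂ × ℝ)) : Prop :=
  ∀ (z : ℂ) (t t' : ℝ), (z, t) ∈ M → t ≤ t' → t' < T → (z, t') ∈ M

/-- An expanding spacetime is continuous if each timeSlice is the interior of the intersection of
all later slices. -/
def ContinuousSpacetime (T : ℝ) (M : Set (ℂ × ℝ)) : Prop :=
  ∀ s ∈ Ioo (0:ℝ) T, timeSlice M s = interior (⋂ t ∈ Ioo s T, timeSlice M t)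

/-- The vanishing time of the point `(z,t)`: the supremum of the connected component containing
`t` of the set of times at which `z` belongs to the spacetime. -/
noncomputable def vanishTime (M : Set (ℂ × ℝ)) (z : ℂ) (t : ℝ) : ℝ :=
  sSup (connectedComponentIn {r : ℝ | (z, r) ∈ M} t)

set_option maxSynthPendingDepth 3 in
/-- Second-order Taylor expansion with a cubic error, uniform over a compact set. -/
theorem exists_taylor_two_bound {E : Type*} [NormedAddCommGroup E] [NormedSpace ℝ E]
    [ProperSpace E] {M K : Set E} (hM : IsOpen M) {g : E → ℝ}
    (hg : ContDiffOn ℝ (⊤ : ℕ∞) g M) (hK : IsCompact K) (hKM : K ⊆ M) :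
    ∃ C : ℝ, 0 ≤ C ∧ ∃ δ : ℝ, 0 < δ ∧ ∀ q ∈ K, ∀ h : E, ‖h‖ ≤ δ → q + h ∈ M ∧
      |g (q + h) - g q - fderiv ℝ g q h - (1 / 2) * fderiv ℝ (fderiv ℝ g) q h h|
        ≤ C * ‖h‖ ^ 3 := by
  obtain ⟨δ, hδ, hδM⟩ := hK.exists_cthickening_subset_open hM hKM
  have h1 : ContDiffOn ℝ (⊤ : ℕ∞) (fderiv ℝ g) M := hg.fderiv_of_isOpen hM (by simp)
  have h2 : ContDiffOn ℝ (⊤ : ℕ∞) (fderiv ℝ (fderiv ℝ g)) M := h1.fderiv_of_isOpen hM (by simp)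
  have h3 : ContDiffOn ℝ (⊤ : ℕ∞) (fderiv ℝ (fderiv ℝ (fderiv ℝ g))) M :=
    h2.fderiv_of_isOpen hM (by simp)
  have d0 : ∀ x ∈ M, DifferentiableAt ℝ g x := fun x hx =>
    (hg.contDiffAt (hM.mem_nhds hx)).differentiableAt (by simp)
  have d1 : ∀ x ∈ M, DifferentiableAt ℝ (fderiv ℝ g) x := fun x hx =>
    (h1.contDiffAt (hM.mem_nhds hx)).differentiableAt (by simp)
  have d2 : ∀ x ∈ M, DifferentiableAt ℝ (fderiv ℝ (fderiv ℝ g)) x := fun x hx =>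
    (h2.contDiffAt (hM.mem_nhds hx)).differentiableAt (by simp)
  have hK' : IsCompact (cthickening δ K) := hK.cthickening
  obtain ⟨C, hC⟩ := hK'.exists_bound_of_continuousOn (h3.continuousOn.mono hδM)
  refine ⟨max C 0, le_max_right _ _, δ, hδ, fun q hq h hh => ?_⟩
  have hball : closedBall q δ ⊆ M := (closedBall_subset_cthickening hq δ).trans hδM
  have hsmall : closedBall q ‖h‖ ⊆ closedBall q δ := closedBall_subset_closedBall hh
  have hqh : q + h ∈ closedBall q ‖h‖ := by simp
  have hqq : ∀ r : ℝ, 0 ≤ r → q ∈ closedBall q r := fun r hr => mem_closedBall_self hr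
  refine ⟨hball (hsmall hqh), ?_⟩
  have s1 : ∀ x ∈ closedBall q δ,
      ‖fderiv ℝ (fderiv ℝ g) x - fderiv ℝ (fderiv ℝ g) q‖ ≤ max C 0 * ‖x - q‖ := fun x hx =>
    (convex_closedBall q δ).norm_image_sub_le_of_norm_fderiv_le
      (fun y hy => d2 y (hball hy))
      (fun y hy => (hC y (closedBall_subset_cthickening hq δ hy)).trans (le_max_left _ _))
      (hqq δ hδ.le) hx
  have s2 : ∀ x ∈ closedBall q ‖h‖,
      ‖fderiv ℝ g x - fderiv ℝ g q - fderiv ℝ (fderiv ℝ g) q (x - q)‖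
        ≤ max C 0 * ‖h‖ * ‖h‖ := by
    intro x hx
    have hd : ∀ y ∈ closedBall q ‖h‖, HasFDerivWithinAt
        (fun y => fderiv ℝ g y - fderiv ℝ (fderiv ℝ g) q y)
        (fderiv ℝ (fderiv ℝ g) y - fderiv ℝ (fderiv ℝ g) q) (closedBall q ‖h‖) y := fun y hy =>
      ((d1 y (hball (hsmall hy))).hasFDerivAt.sub
        (fderiv ℝ (fderiv ℝ g) q).hasFDerivAt).hasFDerivWithinAt
    have := (convex_closedBall q ‖h‖).norm_image_sub_le_of_norm_hasFDerivWithin_le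
      (C := max C 0 * ‖h‖) hd
      (fun y hy => (s1 y (hsmall hy)).trans (by
        gcongr; simpa [dist_eq_norm] using hy)) (hqq _ (norm_nonneg h)) hx
    have hx' : ‖x - q‖ ≤ ‖h‖ := by simpa [dist_eq_norm] using hx
    calc _ = ‖fderiv ℝ g x - fderiv ℝ (fderiv ℝ g) q x -
          (fderiv ℝ g q - fderiv ℝ (fderiv ℝ g) q q)‖ := by
            rw [map_sub]; congr 1; abel
      _ ≤ _ := this.trans (by gcongr)
  have hsymm : ∀ v w, fderiv ℝ (fderiv ℝ g) q v w = fderiv ℝ (fderiv ℝ g) q w v := by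
    have := (hg.contDiffAt (hM.mem_nhds (hKM hq))).isSymmSndFDerivAt
      (by
      rw [minSmoothness_of_isRCLikeNormedField]; exact ENat.LEInfty.out)
    exact fun v w => this v w
  have hd : ∀ y ∈ closedBall q ‖h‖, HasFDerivWithinAt
      (fun y => g y - fderiv ℝ g q y - (1 / 2) * fderiv ℝ (fderiv ℝ g) q (y - q) (y - q))
      (fderiv ℝ g y - fderiv ℝ g q - fderiv ℝ (fderiv ℝ g) q (y - q)) (closedBall q ‖h‖) y := by
    intro y hy
    have e1 : HasFDerivAt (fun y : E => y - q) (ContinuousLinearMap.id ℝ E) y :=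
      (hasFDerivAt_id y).sub_const q
    have e2 := ((fderiv ℝ (fderiv ℝ g) q).hasFDerivAt.comp y e1).clm_apply e1
    have e3 := (((d0 y (hball (hsmall hy))).hasFDerivAt.sub
      (fderiv ℝ g q).hasFDerivAt).sub (e2.const_mul (1 / 2 : ℝ)))
    refine (e3.congr_fderiv ?_).hasFDerivWithinAt
    ext k
    simp
    rw [hsymm k y, hsymm k q]
    ring
  have := (convex_closedBall q ‖h‖).norm_image_sub_le_of_norm_hasFDerivWithin_le
    hd s2 (hqq _ (norm_nonneg h)) hqh
  simp only [add_sub_cancel_left, sub_self, map_zero, mul_zero, sub_zero, map_add,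
    Real.norm_eq_abs] at this
  calc _ = |g (q + h) - (fderiv ℝ g q q + fderiv ℝ g q h)
      - 1 / 2 * fderiv ℝ (fderiv ℝ g) q h h - (g q - fderiv ℝ g q q)| := by congr 1; ring
    _ ≤ _ := this
    _ = _ := by ring

/-- The time derivative of a function on spacetime. -/
noncomputable def timeDeriv (g : ℂ × ℝ → ℝ) (q : ℂ × ℝ) : ℝ := fderiv ℝ g q (0, 1)

/-- The complex number `κ` with `Re (κ h)` the spatial differential of `g` applied to `h`. -/
noncomputable def spatialGrad (g : ℂ × ℝ → ℝ) (q : ℂ × ℝ) : ℂ :=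
  ⟨fderiv ℝ g q (1, 0), -fderiv ℝ g q (Complex.I, 0)⟩

/-- The spatial Hessian of `g` as a quadratic form. -/
noncomputable def spatialHess (g : ℂ × ℝ → ℝ) (q : ℂ × ℝ) (h : ℂ) : ℝ :=
  fderiv ℝ (fderiv ℝ g) q (h, 0) (h, 0)

/-- The spatial Laplacian of a function on spacetime. -/
noncomputable def spatialLap (g : ℂ × ℝ → ℝ) (q : ℂ × ℝ) : ℝ :=
  spatialHess g q 1 + spatialHess g q Complex.I

theorem fderiv_eq_spatialGrad (g : ℂ × ℝ → ℝ) (q : ℂ × ℝ) (h : ℂ) (τ : ℝ) :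
    fderiv ℝ g q (h, τ) = (spatialGrad g q * h).re + τ * timeDeriv g q := by
  have : ((h, τ) : ℂ × ℝ) = h.re • ((1 : ℂ), (0 : ℝ)) + h.im • (Complex.I, (0 : ℝ))
      + τ • ((0 : ℂ), (1 : ℝ)) := by
    ext <;> simp
  rw [this, map_add, map_add, map_smul, map_smul, map_smul]
  simp [spatialGrad, timeDeriv]
  ring

theorem isSymm_fderiv_fderiv {M : Set (ℂ × ℝ)} (hM : IsOpen M) {g : ℂ × ℝ → ℝ}
    (hg : ContDiffOn ℝ (⊤ : ℕ∞) g M) {q : ℂ × ℝ} (hq : q ∈ M) (v w : ℂ × ℝ) :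
    fderiv ℝ (fderiv ℝ g) q v w = fderiv ℝ (fderiv ℝ g) q w v :=
  (hg.contDiffAt (hM.mem_nhds hq)).isSymmSndFDerivAt (by
      rw [minSmoothness_of_isRCLikeNormedField]; exact ENat.LEInfty.out) v w

theorem spatialHess_add_spatialHess_I_mul {M : Set (ℂ × ℝ)} (hM : IsOpen M) {g : ℂ × ℝ → ℝ}
    (hg : ContDiffOn ℝ (⊤ : ℕ∞) g M) {q : ℂ × ℝ} (hq : q ∈ M) (k : ℂ) :
    spatialHess g q k + spatialHess g q (Complex.I * k) = ‖k‖ ^ 2 * spatialLap g q := by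
  have e1 : ((k, 0) : ℂ × ℝ) = k.re • ((1 : ℂ), (0 : ℝ)) + k.im • (Complex.I, (0 : ℝ)) := by
    ext <;> simp
  have e2 : ((Complex.I * k, 0) : ℂ × ℝ)
      = (-k.im) • ((1 : ℂ), (0 : ℝ)) + k.re • (Complex.I, (0 : ℝ)) := by
    ext
    · apply Complex.ext <;> simp
    · simp
  have hs := isSymm_fderiv_fderiv hM hg hq (1, 0) (Complex.I, 0)
  have hk : ‖k‖ ^ 2 = k.re ^ 2 + k.im ^ 2 := by
    rw [Complex.sq_norm, Complex.normSq_apply]; ring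
  simp only [spatialLap, spatialHess]
  rw [e1, e2, hk]
  simp only [map_add, map_smul, add_apply, smul_apply,
    smul_eq_mul]
  rw [hs]
  ring

theorem spatialHess_neg (g : ℂ × ℝ → ℝ) (q : ℂ × ℝ) (h : ℂ) :
    spatialHess g q (-h) = spatialHess g q h := by
  have : ((-h, 0) : ℂ × ℝ) = -(h, 0) := by ext <;> simp
  rw [spatialHess, this, map_neg, map_neg, neg_apply, neg_neg, spatialHess]

theorem spatialHess_smul (g : ℂ × ℝ → ℝ) (q : ℂ × ℝ) (r : ℝ) (h : ℂ) :
    spatialHess g q (r * h) = r ^ 2 * spatialHess g q h := by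
  have : (((r : ℂ) * h, 0) : ℂ × ℝ) = r • (h, 0) := by ext <;> simp
  rw [spatialHess, this, map_smul, map_smul, smul_apply, smul_eq_mul, smul_eq_mul, spatialHess]
  ring

set_option maxSynthPendingDepth 3 in
/-- Parabolic Taylor expansion, uniform over a compact set of spacetime. -/
theorem exists_parabolic_taylor_bound {M K : Set (ℂ × ℝ)} (hM : IsOpen M) {g : ℂ × ℝ → ℝ}
    (hg : ContDiffOn ℝ (⊤ : ℕ∞) g M) (hK : IsCompact K) (hKM : K ⊆ M) {R : ℝ} (hR : 1 ≤ R) :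
    ∃ C : ℝ, 0 ≤ C ∧ ∃ δ₀ : ℝ, 0 < δ₀ ∧ δ₀ ≤ 1 ∧ ∀ z t, (z, t) ∈ K → ∀ δ, 0 ≤ δ → δ ≤ δ₀ →
      ∀ (h : ℂ) (τ : ℝ), ‖h‖ ≤ R * δ → 0 ≤ τ → τ ≤ δ ^ 2 → (z + h, t - τ) ∈ M ∧
      |g (z + h, t - τ) - g (z, t) - (spatialGrad g (z, t) * h).re
        - (1 / 2) * spatialHess g (z, t) h + τ * timeDeriv g (z, t)| ≤ C * δ ^ 3 := by
  obtain ⟨C, hC, δ, hδ, H⟩ := exists_taylor_two_bound hM hg hK hKM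
  have h1 : ContDiffOn ℝ (⊤ : ℕ∞) (fderiv ℝ g) M := hg.fderiv_of_isOpen hM (by simp)
  have h2 : ContDiffOn ℝ (⊤ : ℕ∞) (fderiv ℝ (fderiv ℝ g)) M := h1.fderiv_of_isOpen hM (by simp)
  obtain ⟨B, hB⟩ := hK.exists_bound_of_continuousOn
    (f := fderiv ℝ (fderiv ℝ g)) (h2.continuousOn.mono hKM)
  refine ⟨C * R ^ 3 + 2 * |B| * R, by positivity, min 1 (δ / R), by positivity, min_le_left _ _,
    fun z t hzt d hd hd1 h τ hh hτ0 hτ => ?_⟩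
  have hd' : R * d ≤ δ := by
    have := hd1.trans (min_le_right _ _)
    rw [le_div_iff₀ (by positivity)] at this
    linarith
  have hd2 : d ≤ 1 := hd1.trans (min_le_left _ _)
  have hτd : τ ≤ R * d := by nlinarith
  have hn : ‖((h, -τ) : ℂ × ℝ)‖ ≤ R * d := by
    rw [Prod.norm_def]
    exact max_le hh (by simpa [abs_of_nonneg hτ0] using hτd)
  obtain ⟨m, e⟩ := H (z, t) hzt (h, -τ) (hn.trans hd')
  have hadd : ((z, t) : ℂ × ℝ) + (h, -τ) = (z + h, t - τ) := by ext <;> simp [sub_eq_add_neg]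
  rw [hadd] at m e
  refine ⟨m, ?_⟩
  rw [fderiv_eq_spatialGrad] at e
  have hs := isSymm_fderiv_fderiv hM hg (hKM hzt) (h, 0) (0, 1)
  have hsplit : fderiv ℝ (fderiv ℝ g) (z, t) (h, -τ) (h, -τ) = spatialHess g (z, t) h
      - 2 * τ * fderiv ℝ (fderiv ℝ g) (z, t) (0, 1) (h, 0)
      + τ ^ 2 * fderiv ℝ (fderiv ℝ g) (z, t) (0, 1) (0, 1) := by
    have : ((h, -τ) : ℂ × ℝ) = (h, (0 : ℝ)) + (-τ) • ((0 : ℂ), (1 : ℝ)) := by ext <;> simp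
    rw [this]
    simp only [map_add, map_smul, add_apply, smul_apply,
      smul_eq_mul, hs, spatialHess]
    ring
  have hBn : ‖fderiv ℝ (fderiv ℝ g) (z, t)‖ ≤ |B| := (hB _ hzt).trans (le_abs_self B)
  have n1 : ‖((0 : ℂ), (1 : ℝ))‖ ≤ 1 := by simp
  have n2 : ‖(h, (0 : ℝ))‖ ≤ R * d := by simpa using hh
  have b1 : |fderiv ℝ (fderiv ℝ g) (z, t) (0, 1) (h, 0)| ≤ |B| * 1 * (R * d) :=
    (ContinuousLinearMap.le_opNorm₂ (fderiv ℝ (fderiv ℝ g) (z, t)) (0, 1) (h, 0)).trans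
      (by gcongr)
  have b2 : |fderiv ℝ (fderiv ℝ g) (z, t) (0, 1) (0, 1)| ≤ |B| * 1 * 1 :=
    (ContinuousLinearMap.le_opNorm₂ (fderiv ℝ (fderiv ℝ g) (z, t)) (0, 1) (0, 1)).trans
      (by gcongr)
  rw [hsplit] at e
  have c1 : |τ * fderiv ℝ (fderiv ℝ g) (z, t) (0, 1) (h, 0)| ≤ d ^ 2 * (|B| * (R * d)) := by
    rw [abs_mul, abs_of_nonneg hτ0]
    gcongr; linarith
  have c2 : |τ ^ 2 * fderiv ℝ (fderiv ℝ g) (z, t) (0, 1) (0, 1)| ≤ d ^ 3 * |B| := by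
    rw [abs_mul, abs_of_nonneg (sq_nonneg τ)]
    have : τ ^ 2 ≤ d ^ 3 := by
      calc τ ^ 2 ≤ (d ^ 2) ^ 2 := by gcongr
        _ = d ^ 3 * d := by ring
        _ ≤ d ^ 3 * 1 := by gcongr
        _ = d ^ 3 := by ring
    exact mul_le_mul this (by linarith) (abs_nonneg _) (by positivity)
  have c3 : C * ‖((h, -τ) : ℂ × ℝ)‖ ^ 3 ≤ C * R ^ 3 * d ^ 3 := by
    calc _ ≤ C * (R * d) ^ 3 := by gcongr
      _ = _ := by ring
  have c4 : d ^ 3 * |B| ≤ d ^ 3 * |B| * R := le_mul_of_one_le_right (by positivity) hR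
  rw [abs_le] at e c1 c2 ⊢
  constructor <;> nlinarith

theorem fderiv_fderiv_apply {M : Set (ℂ × ℝ)} (hM : IsOpen M) {g : ℂ × ℝ → ℝ}
    (hg : ContDiffOn ℝ (⊤ : ℕ∞) g M) {q : ℂ × ℝ} (hq : q ∈ M) (v w : ℂ × ℝ) :
    fderiv ℝ (fun p => fderiv ℝ g p w) q v = fderiv ℝ (fderiv ℝ g) q v w := by
  have h1 : ContDiffOn ℝ (⊤ : ℕ∞) (fderiv ℝ g) M := hg.fderiv_of_isOpen hM (by simp)
  have d1 : DifferentiableAt ℝ (fderiv ℝ g) q :=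
    (h1.contDiffAt (hM.mem_nhds hq)).differentiableAt (by simp)
  rw [fderiv_clm_apply d1 (by fun_prop)]
  simp

theorem contDiffOn_fderiv_apply {M : Set (ℂ × ℝ)} (hM : IsOpen M) {g : ℂ × ℝ → ℝ}
    (hg : ContDiffOn ℝ (⊤ : ℕ∞) g M) (w : ℂ × ℝ) :
    ContDiffOn ℝ (⊤ : ℕ∞) (fun p => fderiv ℝ g p w) M := by
  have h1 : ContDiffOn ℝ (⊤ : ℕ∞) (fderiv ℝ g) M := hg.fderiv_of_isOpen hM (by simp)
  exact h1.clm_apply contDiffOn_const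

theorem fderiv_apply_comm {M : Set (ℂ × ℝ)} (hM : IsOpen M) {g : ℂ × ℝ → ℝ}
    (hg : ContDiffOn ℝ (⊤ : ℕ∞) g M) {q : ℂ × ℝ} (hq : q ∈ M) (v w : ℂ × ℝ) :
    fderiv ℝ (fun p => fderiv ℝ g p w) q v = fderiv ℝ (fun p => fderiv ℝ g p v) q w := by
  rw [fderiv_fderiv_apply hM hg hq, fderiv_fderiv_apply hM hg hq, isSymm_fderiv_fderiv hM hg hq]

theorem fderiv_congr_of_isOpen {M : Set (ℂ × ℝ)} (hM : IsOpen M) {f g : ℂ × ℝ → ℝ}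
    (h : EqOn f g M) {q : ℂ × ℝ} (hq : q ∈ M) : fderiv ℝ f q = fderiv ℝ g q :=
  (h.eventuallyEq_of_mem (hM.mem_nhds hq)).fderiv_eq

theorem fderiv_third_comm {M : Set (ℂ × ℝ)} (hM : IsOpen M) {g : ℂ × ℝ → ℝ}
    (hg : ContDiffOn ℝ (⊤ : ℕ∞) g M) {q : ℂ × ℝ} (hq : q ∈ M) (e v : ℂ × ℝ) :
    fderiv ℝ (fun p => fderiv ℝ (fderiv ℝ g) p e e) q v
      = fderiv ℝ (fderiv ℝ (fun p => fderiv ℝ g p v)) q e e := by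
  have a1 : EqOn (fun p => fderiv ℝ (fderiv ℝ g) p e e)
      (fun p => fderiv ℝ (fun p => fderiv ℝ g p e) p e) M :=
    fun p hp => (fderiv_fderiv_apply hM hg hp e e).symm
  have a2 : EqOn (fun p => fderiv ℝ (fun p => fderiv ℝ g p e) p v)
      (fun p => fderiv ℝ (fun p => fderiv ℝ g p v) p e) M :=
    fun p hp => fderiv_apply_comm hM hg hp v e
  rw [fderiv_congr_of_isOpen hM a1 hq,
    fderiv_apply_comm hM (contDiffOn_fderiv_apply hM hg e) hq, fderiv_congr_of_isOpen hM a2 hq,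
    fderiv_fderiv_apply hM (contDiffOn_fderiv_apply hM hg v) hq]

theorem fderiv_spatialLap {M : Set (ℂ × ℝ)} (hM : IsOpen M) {g : ℂ × ℝ → ℝ}
    (hg : ContDiffOn ℝ (⊤ : ℕ∞) g M) {q : ℂ × ℝ} (hq : q ∈ M) :
    timeDeriv (spatialLap g) q = spatialLap (timeDeriv g) q := by
  have hd : ∀ e : ℂ × ℝ, DifferentiableAt ℝ (fun p => fderiv ℝ (fderiv ℝ g) p e e) q := by
    intro e
    have h1 : ContDiffOn ℝ (⊤ : ℕ∞) (fderiv ℝ g) M := hg.fderiv_of_isOpen hM (by simp)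
    have h2 : ContDiffOn ℝ (⊤ : ℕ∞) (fderiv ℝ (fderiv ℝ g)) M :=
      h1.fderiv_of_isOpen hM (by simp)
    exact (((h2.clm_apply contDiffOn_const).clm_apply contDiffOn_const).contDiffAt
      (hM.mem_nhds hq)).differentiableAt (by simp)
  have : spatialLap g = (fun p => fderiv ℝ (fderiv ℝ g) p (1, 0) (1, 0))
      + fun p => fderiv ℝ (fderiv ℝ g) p (Complex.I, 0) (Complex.I, 0) := rfl
  rw [timeDeriv, this, fderiv_add (hd _) (hd _), add_apply,
    fderiv_third_comm hM hg hq, fderiv_third_comm hM hg hq]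
  rfl

theorem lap_eq_spatialLap {M : Set (ℂ × ℝ)} (hM : IsOpen M) {g : ℂ × ℝ → ℝ}
    (hg : ContDiffOn ℝ (⊤ : ℕ∞) g M) {z : ℂ} {t : ℝ} (hq : (z, t) ∈ M) :
    lap (fun z => g (z, t)) z = spatialLap g (z, t) := by
  have h1 : ContDiffOn ℝ (⊤ : ℕ∞) (fderiv ℝ g) M := hg.fderiv_of_isOpen hM (by simp)
  have hi : ∀ x : ℂ, HasFDerivAt (fun z : ℂ => (z, t)) (ContinuousLinearMap.inl ℝ ℂ ℝ) x :=
    fun x => hasFDerivAt_prodMk_left x t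
  have hopen : IsOpen {x : ℂ | (x, t) ∈ M} := hM.preimage (by fun_prop)
  have e1 : ∀ x, (x, t) ∈ M → HasFDerivAt (fun z => g (z, t))
      ((fderiv ℝ g (x, t)).comp (ContinuousLinearMap.inl ℝ ℂ ℝ)) x := fun x hx =>
    ((hg.contDiffAt (hM.mem_nhds hx)).differentiableAt (by simp)).hasFDerivAt.comp x (hi x)
  have e2 : ∀ k : ℂ, fderiv ℝ (fderiv ℝ (fun z => g (z, t))) z k k
      = fderiv ℝ (fderiv ℝ g) (z, t) (k, 0) (k, 0) := by
    intro k
    have c1 : fderiv ℝ (fun z => g (z, t)) =ᶠ[nhds z]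
        fun x => (fderiv ℝ g (x, t)).comp (ContinuousLinearMap.inl ℝ ℂ ℝ) :=
      Filter.eventually_of_mem (hopen.mem_nhds hq) fun x hx => (e1 x hx).fderiv
    have c2 : HasFDerivAt (fun x => fderiv ℝ g (x, t))
        ((fderiv ℝ (fderiv ℝ g) (z, t)).comp (ContinuousLinearMap.inl ℝ ℂ ℝ)) z :=
      ((h1.contDiffAt (hM.mem_nhds hq)).differentiableAt (by simp)).hasFDerivAt.comp z (hi z)
    rw [c1.fderiv_eq, (c2.clm_comp (hasFDerivAt_const _ _)).fderiv]
    simp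
  rw [lap, iteratedFDeriv_two_apply, iteratedFDeriv_two_apply, spatialLap, spatialHess,
    spatialHess]
  simp [e2]

/-- The logarithm of the conformal factor as a function on spacetime. -/
noncomputable def logFactor (u : ℂ → ℝ → ℝ) (q : ℂ × ℝ) : ℝ := Real.log (u q.1 q.2)

namespace ConfRFS

variable {T : ℝ} {M : Set (ℂ × ℝ)} {u : ℂ → ℝ → ℝ}

theorem contDiffOn_logFactor (h : ConfRFS T M u) : ContDiffOn ℝ (⊤ : ℕ∞) (logFactor u) M :=
  h.smooth.log fun p hp => (h.pos p hp).ne'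

theorem contDiffOn_timeDeriv (h : ConfRFS T M u) :
    ContDiffOn ℝ (⊤ : ℕ∞) (timeDeriv (logFactor u)) M :=
  contDiffOn_fderiv_apply h.opn h.contDiffOn_logFactor _

theorem exp_logFactor (h : ConfRFS T M u) {q : ℂ × ℝ} (hq : q ∈ M) :
    Real.exp (logFactor u q) = u q.1 q.2 := Real.exp_log (h.pos q hq)

theorem lap_log_eq (h : ConfRFS T M u) {q : ℂ × ℝ} (hq : q ∈ M) :
    lap (fun z => Real.log (u z q.2)) q.1 = spatialLap (logFactor u) q :=
  lap_eq_spatialLap h.opn h.contDiffOn_logFactor hq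

theorem exp_mul_timeDeriv (h : ConfRFS T M u) {q : ℂ × ℝ} (hq : q ∈ M) :
    Real.exp (logFactor u q) * timeDeriv (logFactor u) q = spatialLap (logFactor u) q := by
  rw [h.exp_logFactor hq, ← h.lap_log_eq hq, ← h.lfde q hq]
  have hd : HasFDerivAt (fun p : ℂ × ℝ => u p.1 p.2)
      (fderiv ℝ (fun p : ℂ × ℝ => u p.1 p.2) q) q :=
    ((h.smooth.contDiffAt (h.opn.mem_nhds hq)).differentiableAt (by simp)).hasFDerivAt
  have e1 : HasDerivAt (fun s : ℝ => ((q.1, s) : ℂ × ℝ)) (0, 1) q.2 :=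
    (hasDerivAt_const _ _).prodMk (hasDerivAt_id _)
  have e2 : HasDerivAt (u q.1) (fderiv ℝ (fun p : ℂ × ℝ => u p.1 p.2) q (0, 1)) q.2 :=
    HasFDerivAt.comp_hasDerivAt (f := fun s : ℝ => ((q.1, s) : ℂ × ℝ)) q.2 hd e1
  have hne := (h.pos q hq).ne'
  have e3 : fderiv ℝ (logFactor u) q = _ := (hd.log hne).fderiv
  rw [e2.deriv, timeDeriv, e3, smul_apply, smul_eq_mul, mul_inv_cancel_left₀ hne]

/-- The evolution equation `∂ₜN = Δ_g N - N²` of `N = ∂ₜ log u`, i.e. of minus the scalar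
curvature. -/
theorem exp_mul_timeDeriv_timeDeriv (h : ConfRFS T M u) {q : ℂ × ℝ} (hq : q ∈ M) :
    Real.exp (logFactor u q) * (timeDeriv (timeDeriv (logFactor u)) q
      + timeDeriv (logFactor u) q ^ 2) = spatialLap (timeDeriv (logFactor u)) q := by
  rw [← fderiv_spatialLap h.opn h.contDiffOn_logFactor hq]
  have a : EqOn (spatialLap (logFactor u))
      (fun p => Real.exp (logFactor u p) * timeDeriv (logFactor u) p) M :=
    fun p hp => (h.exp_mul_timeDeriv hp).symm
  have d1 := ((h.contDiffOn_logFactor.contDiffAt (h.opn.mem_nhds hq)).differentiableAt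
    (by simp)).hasFDerivAt
  have d2 := ((h.contDiffOn_timeDeriv.contDiffAt (h.opn.mem_nhds hq)).differentiableAt
    (by simp)).hasFDerivAt
  have e : fderiv ℝ _ q = _ := (d1.exp.mul d2).fderiv
  have hf : fderiv ℝ (spatialLap (logFactor u)) q = _ :=
    (fderiv_congr_of_isOpen h.opn a hq).trans e
  have ht : timeDeriv (spatialLap (logFactor u)) q
      = fderiv ℝ (spatialLap (logFactor u)) q (0, 1) := rfl
  rw [ht, hf]
  simp only [add_apply, smul_apply, smul_eq_mul]
  change _ = Real.exp (logFactor u q) * timeDeriv (timeDeriv (logFactor u)) q +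
    timeDeriv (logFactor u) q * (Real.exp (logFactor u q) * timeDeriv (logFactor u) q)
  ring

end ConfRFS

theorem abs_norm_one_add_sub_le {ρ : ℝ} (hρ : ρ ≤ 1 / 2) {Y : ℂ} (hY : ‖Y‖ ≤ ρ) :
    |‖1 + Y‖ - (1 + Y.re + Y.im ^ 2 / 2)| ≤ ρ ^ 3 := by
  have h1 : |Y.re| ≤ ρ := (Complex.abs_re_le_norm Y).trans hY
  have h2 : |Y.im| ≤ ρ := (Complex.abs_im_le_norm Y).trans hY
  set n := ‖1 + Y‖
  have hn : n ^ 2 = (1 + Y.re) ^ 2 + Y.im ^ 2 := by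
    rw [Complex.sq_norm, Complex.normSq_apply]; simp; ring
  have hn0 : 1 + Y.re ≤ n := by
    have := Complex.re_le_norm (1 + Y)
    simpa using this
  have h3 : |n - 1| ≤ ρ := by
    have := abs_norm_sub_norm_le (1 + Y) 1
    simp only [norm_one, add_sub_cancel_left] at this
    exact this.trans hY
  have hρ0 : 0 ≤ ρ := (norm_nonneg Y).trans hY
  rw [abs_le] at h1 h3
  have h5 : Y.im ^ 2 ≤ ρ ^ 2 := by rw [← sq_abs]; gcongr
  have h6 : 1 ≤ n + (1 + Y.re) := by linarith
  have h7 : n - (1 + Y.re + Y.im ^ 2 / 2)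
      = Y.im ^ 2 * ((1 - n - Y.re) / (2 * (n + (1 + Y.re)))) := by
    field_simp
    linear_combination 2 * hn
  have h8 : |(1 - n - Y.re) / (2 * (n + (1 + Y.re)))| ≤ ρ := by
    rw [abs_div, div_le_iff₀ (by positivity), abs_of_nonneg (by positivity : 0 ≤ 2 * (n + (1 + Y.re)))]
    rw [abs_le]
    constructor <;> nlinarith
  rw [h7, abs_mul, abs_of_nonneg (sq_nonneg _)]
  calc _ ≤ ρ ^ 2 * ρ := by gcongr
    _ = _ := by ring

theorem abs_exp_mul_norm_one_add_sub_le {ρ : ℝ} (hρ : ρ ≤ 1 / 2) {X : ℝ} {Y : ℂ} (hX : |X| ≤ ρ)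
    (hY : ‖Y‖ ≤ ρ) :
    |Real.exp X * ‖1 + Y‖ - (1 + X + Y.re + X ^ 2 / 2 + Y.im ^ 2 / 2 + X * Y.re)|
      ≤ 6 * ρ ^ 3 := by
  have hρ0 : 0 ≤ ρ := (norm_nonneg Y).trans hY
  have h1 : |Y.re| ≤ ρ := (Complex.abs_re_le_norm Y).trans hY
  have h2 : |Y.im| ≤ ρ := (Complex.abs_im_le_norm Y).trans hY
  have e1 : |Real.exp X - (1 + X + X ^ 2 / 2)| ≤ ρ ^ 3 := by
    have := Real.exp_bound (x := X) (by linarith) (n := 3) (by norm_num)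
    simp only [Finset.sum_range_succ, Nat.factorial] at this
    norm_num at this
    calc _ ≤ _ := this
      _ ≤ |X| ^ 3 := by
        have : 0 ≤ |X| ^ 3 := by positivity
        linarith
      _ ≤ _ := by gcongr
  have e2 := abs_norm_one_add_sub_le hρ hY
  have hn : |‖1 + Y‖| ≤ 2 := by
    rw [abs_of_nonneg (norm_nonneg _)]
    have := norm_add_le (1 : ℂ) Y
    simp only [norm_one] at this
    linarith
  have hq : |1 + X + X ^ 2 / 2| ≤ 2 := by
    have h3 : X ^ 2 ≤ 1 / 4 := by rw [← sq_abs]; nlinarith [abs_nonneg X]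
    rw [abs_le] at hX ⊢
    constructor <;> nlinarith [sq_nonneg X]
  have key : Real.exp X * ‖1 + Y‖ - (1 + X + Y.re + X ^ 2 / 2 + Y.im ^ 2 / 2 + X * Y.re)
      = (Real.exp X - (1 + X + X ^ 2 / 2)) * ‖1 + Y‖
        + (1 + X + X ^ 2 / 2) * (‖1 + Y‖ - (1 + Y.re + Y.im ^ 2 / 2))
        + X * Y.im ^ 2 / 2 + X ^ 2 * Y.re / 2 + X ^ 2 * Y.im ^ 2 / 4 := by ring
  have t1 : |(Real.exp X - (1 + X + X ^ 2 / 2)) * ‖1 + Y‖| ≤ ρ ^ 3 * 2 := by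
    rw [abs_mul]; gcongr
  have t2 : |(1 + X + X ^ 2 / 2) * (‖1 + Y‖ - (1 + Y.re + Y.im ^ 2 / 2))| ≤ 2 * ρ ^ 3 := by
    rw [abs_mul]; gcongr
  have t3 : |X * Y.im ^ 2 / 2| ≤ ρ * ρ ^ 2 / 2 := by
    rw [abs_div, abs_mul, abs_pow, abs_two]; gcongr
  have t4 : |X ^ 2 * Y.re / 2| ≤ ρ ^ 2 * ρ / 2 := by
    rw [abs_div, abs_mul, abs_pow, abs_two]; gcongr
  have t5 : |X ^ 2 * Y.im ^ 2 / 4| ≤ ρ ^ 2 * ρ ^ 2 / 4 := by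
    rw [abs_div, abs_mul, abs_pow, abs_pow, abs_of_pos (by norm_num : (0:ℝ) < 4)]; gcongr
  have t6 : ρ ^ 2 * ρ ^ 2 / 4 ≤ ρ ^ 3 := by
    have : ρ ^ 3 * ρ ≤ ρ ^ 3 * 1 := by gcongr; linarith
    nlinarith [pow_nonneg hρ0 3]
  rw [key]
  refine (abs_add_le _ _).trans ?_
  refine (add_le_add_left (abs_add_le _ _) _).trans ?_
  refine (add_le_add_left (add_le_add_left (abs_add_le _ _) _) _).trans ?_
  refine (add_le_add_left (add_le_add_left (add_le_add_left (abs_add_le _ _) _) _) _).trans ?_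
  nlinarith

/-- The four unit directions `1, -1, i, -i`. -/
noncomputable def crossDir : Fin 4 → ℂ := ![1, -1, Complex.I, -Complex.I]

theorem norm_crossDir (i : Fin 4) : ‖crossDir i‖ = 1 := by
  fin_cases i <;> simp [crossDir]

/-- Expansion of the ratio of length elements of a curve and of its perturbation in each of the
four directions `crossDir`. -/
theorem exists_length_ratio_bound {R : ℝ} (hR : 1 ≤ R) :
    ∃ C : ℝ, 0 ≤ C ∧ ∃ δ₀ : ℝ, 0 < δ₀ ∧ δ₀ ≤ 1 ∧ ∀ δ, 0 ≤ δ → δ ≤ δ₀ →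
      ∀ (a b : ℂ) (x : Fin 4 → ℝ), ‖a‖ ≤ R → ‖b‖ ≤ R → (∀ i, |x i| ≤ R * δ ^ 2) →
      (∀ i, |Real.exp (δ * (crossDir i * b).re + x i) * ‖1 + δ * crossDir i * (a - b)‖ - 1
        - δ * (crossDir i * a).re| ≤ C * δ ^ 2) ∧
      |∑ i, Real.exp (δ * (crossDir i * b).re + x i) * ‖1 + δ * crossDir i * (a - b)‖ - 4
        - ∑ i, x i - δ ^ 2 * ‖a‖ ^ 2| ≤ C * δ ^ 3 := by
  refine ⟨400 * R ^ 3, by positivity, 1 / (4 * R), by positivity, ?_, fun δ h0 h1 a b x ha hb hx => ?_⟩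
  · rw [div_le_one (by positivity)]; linarith
  have hδR : R * δ ≤ 1 / 4 := by
    rw [le_div_iff₀ (by positivity)] at h1; linarith
  have hδ1 : δ ≤ 1 := by nlinarith
  have hxd : ∀ i, |x i| ≤ R * δ := fun i => (hx i).trans (by nlinarith)
  have hp : ∀ i, |δ * (crossDir i * b).re| ≤ R * δ := fun i => by
    rw [abs_mul, abs_of_nonneg h0, mul_comm]
    gcongr
    refine (Complex.abs_re_le_norm _).trans ?_
    rw [norm_mul, norm_crossDir, one_mul]; exact hb
  have hX : ∀ i, |δ * (crossDir i * b).re + x i| ≤ 2 * (R * δ) := fun i =>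
    (abs_add_le _ _).trans (by linarith [hp i, hxd i])
  have hY : ∀ i, ‖δ * crossDir i * (a - b)‖ ≤ 2 * (R * δ) := fun i => by
    rw [norm_mul, norm_mul, norm_crossDir, Complex.norm_real, Real.norm_eq_abs, abs_of_nonneg h0]
    have := norm_sub_le a b
    nlinarith
  have hm := fun i => abs_exp_mul_norm_one_add_sub_le (by linarith) (hX i) (hY i)
  have hYr : ∀ i, |(δ * crossDir i * (a - b)).re| ≤ 2 * (R * δ) := fun i =>
    (Complex.abs_re_le_norm _).trans (hY i)
  have hYi : ∀ i, |(δ * crossDir i * (a - b)).im| ≤ 2 * (R * δ) := fun i =>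
    (Complex.abs_im_le_norm _).trans (hY i)
  have hre : ∀ i, (δ * crossDir i * (a - b)).re
      = δ * (crossDir i * a).re - δ * (crossDir i * b).re := fun i => by
    simp [mul_assoc, mul_sub, Complex.mul_re]
  have hR3 : R ^ 2 ≤ R ^ 3 := by nlinarith [sq_nonneg R]
  set r := R * δ with hr
  have hr0 : 0 ≤ r := by positivity
  have hr2 : r ^ 2 ≤ R ^ 3 * δ ^ 2 := by rw [hr, mul_pow]; gcongr
  have hr3 : r ^ 3 = R ^ 3 * δ ^ 3 := by rw [hr, mul_pow]
  have hxr : ∀ i, |x i| ≤ r ^ 2 := fun i => (hx i).trans (by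
    rw [hr, mul_pow]; gcongr; nlinarith)
  constructor
  · intro i
    have e := hm i
    have := hxr i
    have q1 : |(δ * (crossDir i * b).re + x i) ^ 2| ≤ (2 * r) ^ 2 := by
      rw [abs_pow]; gcongr; exact hX i
    have q2 : |(δ * crossDir i * (a - b)).im ^ 2| ≤ (2 * r) ^ 2 := by
      rw [abs_pow]; gcongr; exact hYi i
    have q3 : |(δ * (crossDir i * b).re + x i) * (δ * crossDir i * (a - b)).re|
        ≤ (2 * r) * (2 * r) := by
      rw [abs_mul]; gcongr
      · exact hX i
      · exact hYr i
    have q4 : (2 * r) ^ 3 ≤ 4 * r ^ 2 := by nlinarith [sq_nonneg r]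
    rw [abs_le] at e q1 q2 q3 this ⊢
    have := hre i
    constructor <;> nlinarith
  · set p : Fin 4 → ℝ := fun i => δ * (crossDir i * b).re with hpdef
    set Y : Fin 4 → ℂ := fun i => δ * crossDir i * (a - b) with hYdef
    have hn : ∀ i, |Real.exp (p i + x i) * ‖1 + Y i‖ - (1 + p i + x i + (Y i).re + (p i) ^ 2 / 2
        + (Y i).im ^ 2 / 2 + p i * (Y i).re)| ≤ 100 * r ^ 3 := by
      intro i
      have e := hm i
      have q1 : |x i * p i| ≤ r ^ 2 * r := by rw [abs_mul]; gcongr; exacts [hxr i, hp i]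
      have q2 : |x i * (Y i).re| ≤ r ^ 2 * (2 * r) := by
        rw [abs_mul]; gcongr; exacts [hxr i, hYr i]
      have q3 : |x i ^ 2| ≤ r ^ 2 * r := by
        rw [pow_two, abs_mul]; gcongr; exacts [hxr i, hxd i]
      have : (2 * r) ^ 3 = 8 * r ^ 3 := by ring
      have := pow_nonneg hr0 3
      change |Real.exp (p i + x i) * ‖1 + Y i‖ - (1 + (p i + x i) + (Y i).re + (p i + x i) ^ 2 / 2
        + (Y i).im ^ 2 / 2 + (p i + x i) * (Y i).re)| ≤ _ at e
      rw [abs_le] at e q1 q2 q3 ⊢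
      constructor <;> nlinarith
    have hsum : ∑ i, (1 + p i + x i + (Y i).re + (p i) ^ 2 / 2
        + (Y i).im ^ 2 / 2 + p i * (Y i).re) = 4 + ∑ i, x i + δ ^ 2 * ‖a‖ ^ 2 := by
      rw [Complex.sq_norm, Complex.normSq_apply]
      simp only [Fin.sum_univ_four, hpdef, hYdef, crossDir]
      simp
      ring
    have : ∑ i, Real.exp (p i + x i) * ‖1 + Y i‖ - 4 - ∑ i, x i - δ ^ 2 * ‖a‖ ^ 2
        = ∑ i, (Real.exp (p i + x i) * ‖1 + Y i‖ - (1 + p i + x i + (Y i).re + (p i) ^ 2 / 2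
        + (Y i).im ^ 2 / 2 + p i * (Y i).re)) := by
      rw [Finset.sum_sub_distrib, hsum]; ring
    rw [this]
    calc _ ≤ ∑ i : Fin 4, 100 * r ^ 3 := (Finset.abs_sum_le_sum_abs _ _).trans
          (Finset.sum_le_sum fun i _ => hn i)
      _ = 400 * R ^ 3 * δ ^ 3 := by simp; rw [hr3]; ring

/-- A globally defined `C¹` curve `c` with derivative `c'` which joins `x` to `y` inside `Ω` as the
parameter runs through `[0,1]`. -/
structure CurveIn (Ω : Set ℂ) (x y : ℂ) (c c' : ℝ → ℂ) : Prop where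
  hasDeriv : ∀ s, HasDerivAt c (c' s) s
  cont : Continuous c'
  mem : ∀ s ∈ Icc (0:ℝ) 1, c s ∈ Ω
  src : c 0 = x
  tgt : c 1 = y

/-- `y` can be reached from `x` inside `Ω` by a `C¹` curve of `ω|dz|`-length at most `L`. -/
def Reach (ω : ℂ → ℝ) (Ω : Set ℂ) (x y : ℂ) (L : ℝ) : Prop :=
  ∃ c c' : ℝ → ℂ, CurveIn Ω x y c c' ∧ ∫ s in (0:ℝ)..1, ω (c s) * ‖c' s‖ ≤ L

theorem hasDerivAt_max_zero_sq (s : ℝ) :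
    HasDerivAt (fun s : ℝ => max s 0 ^ 2) (2 * max s 0) s := by
  rcases lt_trichotomy s 0 with h | h | h
  · rw [max_eq_right h.le, mul_zero]
    refine (hasDerivAt_const s (0:ℝ)).congr_of_eventuallyEq ?_
    filter_upwards [gt_mem_nhds h] with r hr
    simp [max_eq_right hr.le]
  · subst h
    rw [hasDerivAt_iff_isLittleO_nhds_zero]
    refine Asymptotics.IsBigO.trans_isLittleO (g := fun h : ℝ => h ^ 2) ?_ ?_
    · refine Asymptotics.IsBigO.of_bound 1 (Eventually.of_forall fun h => ?_)
      rcases le_total h 0 with h0 | h0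
      · simp [h0]; positivity
      · simp [h0]
    · simpa using Asymptotics.isLittleO_pow_id (𝕜 := ℝ) (n := 2) (by norm_num)
  · rw [max_eq_left h.le]
    have := hasDerivAt_pow 2 s
    norm_num at this
    refine this.congr_of_eventuallyEq ?_
    filter_upwards [lt_mem_nhds h] with r hr
    simp [max_eq_left hr.le]

namespace CurveIn

variable {Ω : Set ℂ} {x y : ℂ} {c c' : ℝ → ℂ} {ω : ℂ → ℝ}

theorem continuous (h : CurveIn Ω x y c c') : Continuous c :=
  continuous_iff_continuousAt.2 fun s => (h.hasDeriv s).continuousAt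

theorem continuousOn_speed (h : CurveIn Ω x y c c') (hω : ContinuousOn ω Ω) :
    ContinuousOn (fun s => ω (c s) * ‖c' s‖) (Icc 0 1) :=
  (hω.comp h.continuous.continuousOn h.mem).mul h.cont.norm.continuousOn

theorem intervalIntegrable_speed (h : CurveIn Ω x y c c') (hω : ContinuousOn ω Ω) {a b : ℝ}
    (ha : a ∈ Icc (0:ℝ) 1) (hb : b ∈ Icc (0:ℝ) 1) :
    IntervalIntegrable (fun s => ω (c s) * ‖c' s‖) volume a b :=
  ((h.continuousOn_speed hω).mono (by
    intro s hs
    rw [mem_uIcc] at hs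
    rcases hs with hs | hs
    · exact ⟨ha.1.trans hs.1, hs.2.trans hb.2⟩
    · exact ⟨hb.1.trans hs.1, hs.2.trans ha.2⟩)).intervalIntegrable

theorem speed_nonneg (h : CurveIn Ω x y c c') (hω0 : ∀ z ∈ Ω, 0 ≤ ω z) {s : ℝ}
    (hs : s ∈ Icc (0:ℝ) 1) : 0 ≤ ω (c s) * ‖c' s‖ :=
  mul_nonneg (hω0 _ (h.mem s hs)) (norm_nonneg _)

theorem length_nonneg (h : CurveIn Ω x y c c') (hω0 : ∀ z ∈ Ω, 0 ≤ ω z) :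
    0 ≤ ∫ s in (0:ℝ)..1, ω (c s) * ‖c' s‖ :=
  intervalIntegral.integral_nonneg zero_le_one fun _ hs => h.speed_nonneg hω0 hs

theorem length_subcurve_le (h : CurveIn Ω x y c c') (hω : ContinuousOn ω Ω)
    (hω0 : ∀ z ∈ Ω, 0 ≤ ω z) {a b : ℝ} (ha : 0 ≤ a) (hab : a ≤ b) (hb : b ≤ 1) :
    ∫ s in a..b, ω (c s) * ‖c' s‖ ≤ ∫ s in (0:ℝ)..1, ω (c s) * ‖c' s‖ := by
  refine intervalIntegral.integral_mono_interval ha hab hb ?_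
    (h.intervalIntegrable_speed hω (by simp) (by simp))
  filter_upwards [ae_restrict_mem measurableSet_Ioc] with s hs
  exact h.speed_nonneg hω0 ⟨hs.1.le, hs.2⟩

/-- Affine reparametrization. -/
theorem affine (h : CurveIn Ω x y c c') {a b : ℝ} (ha : a ∈ Icc (0:ℝ) 1)
    (hb : b ∈ Icc (0:ℝ) 1) :
    CurveIn Ω (c a) (c b) (fun s => c (a + (b - a) * s)) (fun s => ((b - a : ℝ) : ℂ) *
      c' (a + (b - a) * s)) where
  hasDeriv s := by
    have e : HasDerivAt (fun s : ℝ => a + (b - a) * s) (b - a) s := by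
      simpa using ((hasDerivAt_id s).const_mul (b - a)).const_add a
    have := HasDerivAt.scomp s (h.hasDeriv (a + (b - a) * s)) e
    rwa [Complex.real_smul] at this
  cont := by
    have := h.cont
    fun_prop
  mem s hs := by
    refine h.mem _ ⟨?_, ?_⟩
    · nlinarith [ha.1, ha.2, hb.1, hb.2, hs.1, hs.2]
    · nlinarith [ha.1, ha.2, hb.1, hb.2, hs.1, hs.2]
  src := by simp
  tgt := by simp

theorem length_affine_of_le {a b : ℝ} (hab : a ≤ b) :
    ∫ s in (0:ℝ)..1, ω (c (a + (b - a) * s)) * ‖((b - a : ℝ) : ℂ) * c' (a + (b - a) * s)‖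
      = ∫ s in a..b, ω (c s) * ‖c' s‖ := by
  have := intervalIntegral.mul_integral_comp_add_mul (a := 0) (b := 1)
    (f := fun s => ω (c s) * ‖c' s‖) (b - a) a
  simp only [mul_zero, add_zero, mul_one, add_sub_cancel] at this
  rw [← this, ← intervalIntegral.integral_const_mul]
  congr 1; ext s
  rw [norm_mul, Complex.norm_real, Real.norm_eq_abs, abs_of_nonneg (by linarith)]
  ring

theorem reach_subcurve (h : CurveIn Ω x y c c') {a b : ℝ} (ha : 0 ≤ a) (hab : a ≤ b)
    (hb : b ≤ 1) : Reach ω Ω (c a) (c b) (∫ s in a..b, ω (c s) * ‖c' s‖) :=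
  ⟨_, _, h.affine ⟨ha, hab.trans hb⟩ ⟨ha.trans hab, hb⟩, (length_affine_of_le hab).le⟩

theorem reach (h : CurveIn Ω x y c c') : Reach ω Ω x y (∫ s in (0:ℝ)..1, ω (c s) * ‖c' s‖) :=
  ⟨c, c', h, le_rfl⟩

end CurveIn

namespace Reach

variable {Ω : Set ℂ} {x y z : ℂ} {ω : ℂ → ℝ} {L L₁ L₂ : ℝ}

theorem mono (h : Reach ω Ω x y L₁) (hL : L₁ ≤ L₂) : Reach ω Ω x y L₂ := by
  obtain ⟨c, c', hc, hl⟩ := h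
  exact ⟨c, c', hc, hl.trans hL⟩

theorem mem_right (h : Reach ω Ω x y L) : y ∈ Ω := by
  obtain ⟨c, c', hc, -⟩ := h
  exact hc.tgt ▸ hc.mem 1 (by simp)

theorem nonneg (h : Reach ω Ω x y L) (hω0 : ∀ z ∈ Ω, 0 ≤ ω z) : 0 ≤ L := by
  obtain ⟨c, c', hc, hl⟩ := h
  exact (hc.length_nonneg hω0).trans hl

theorem refl (hx : x ∈ Ω) : Reach ω Ω x x 0 :=
  ⟨fun _ => x, fun _ => 0, ⟨fun s => hasDerivAt_const s x, continuous_const, fun _ _ => hx, rfl,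
    rfl⟩, by simp⟩

theorem symm (h : Reach ω Ω x y L) : Reach ω Ω y x L := by
  obtain ⟨c, c', hc, hl⟩ := h
  have := hc.affine (a := 1) (b := 0) (by simp) (by simp)
  rw [hc.src, hc.tgt] at this
  refine ⟨_, _, this, le_trans (le_of_eq ?_) hl⟩
  have e := intervalIntegral.integral_comp_sub_left (a := 0) (b := 1)
    (fun s => ω (c s) * ‖c' s‖) 1
  simp only [sub_self, sub_zero] at e
  rw [← e]
  congr 1; ext s
  rw [show (1:ℝ) + (0 - 1) * s = 1 - s by ring]
  simp

theorem segment {U : ℝ} (hs : ∀ s ∈ Icc (0:ℝ) 1, x + s * (y - x) ∈ Ω)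
    (hω : ContinuousOn ω Ω) (hU : ∀ s ∈ Icc (0:ℝ) 1, ω (x + s * (y - x)) ≤ U) :
    Reach ω Ω x y (U * ‖y - x‖) := by
  have hc : CurveIn Ω x y (fun s : ℝ => x + s * (y - x)) (fun _ => y - x) :=
    { hasDeriv := fun s => by
        have : HasDerivAt (fun s : ℝ => (s : ℂ)) 1 s := Complex.ofRealCLM.hasDerivAt
        simpa using (this.mul_const (y - x)).const_add x
      cont := continuous_const
      mem := hs
      src := by simp
      tgt := by simp }
  refine ⟨_, _, hc, ?_⟩
  calc _ ≤ ∫ s in (0:ℝ)..1, U * ‖y - x‖ := by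
        refine intervalIntegral.integral_mono_on zero_le_one
          (hc.intervalIntegrable_speed hω (by simp) (by simp)) (by simp) fun s hs => ?_
        gcongr
        exact hU s hs
    _ = _ := by simp

theorem trans (hω : ContinuousOn ω Ω) (h₁ : Reach ω Ω x y L₁) (h₂ : Reach ω Ω y z L₂) :
    Reach ω Ω x z (L₁ + L₂) := by
  obtain ⟨c, c', hc, hl⟩ := h₁
  obtain ⟨e, e', he, hk⟩ := h₂
  set f : ℝ → ℝ := fun s => 1 - max (1 - 2 * s) 0 ^ 2 with hf
  set f' : ℝ → ℝ := fun s => 4 * max (1 - 2 * s) 0 with hf'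
  set g : ℝ → ℝ := fun s => max (2 * s - 1) 0 ^ 2 with hg
  set g' : ℝ → ℝ := fun s => 4 * max (2 * s - 1) 0 with hg'
  have df : ∀ s, HasDerivAt f (f' s) s := by
    intro s
    have a : HasDerivAt (fun s : ℝ => 1 - 2 * s) (-2) s := by
      simpa using ((hasDerivAt_id s).const_mul 2).const_sub 1
    have := ((hasDerivAt_max_zero_sq (1 - 2 * s)).comp s a).const_sub 1
    exact this.congr_deriv (by simp only [hf']; ring)
  have dg : ∀ s, HasDerivAt g (g' s) s := by
    intro s
    have a : HasDerivAt (fun s : ℝ => 2 * s - 1) 2 s := by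
      simpa using ((hasDerivAt_id s).const_mul 2).sub_const 1
    have := (hasDerivAt_max_zero_sq (2 * s - 1)).comp s a
    exact this.congr_deriv (by simp only [hg']; ring)
  have cf : Continuous f' := by fun_prop
  have cg : Continuous g' := by fun_prop
  have f1 : ∀ s ∈ Icc (0:ℝ) (1 / 2), f s ∈ Icc (0:ℝ) 1 ∧ g s = 0 ∧ g' s = 0 ∧ 0 ≤ f' s := by
    intro s hs
    have h1 : max (1 - 2 * s) 0 = 1 - 2 * s := max_eq_left (by linarith [hs.2])
    have h2 : max (2 * s - 1) 0 = 0 := max_eq_right (by linarith [hs.2])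
    simp only [hf, hg, hf', hg', h1, h2]
    refine ⟨⟨?_, ?_⟩, by norm_num, by norm_num, ?_⟩ <;> nlinarith [hs.1, hs.2]
  have f2 : ∀ s ∈ Icc (1 / 2 : ℝ) 1, g s ∈ Icc (0:ℝ) 1 ∧ f s = 1 ∧ f' s = 0 ∧ 0 ≤ g' s := by
    intro s hs
    have h1 : max (1 - 2 * s) 0 = 0 := max_eq_right (by linarith [hs.1])
    have h2 : max (2 * s - 1) 0 = 2 * s - 1 := max_eq_left (by linarith [hs.1])
    simp only [hf, hg, hf', hg', h1, h2]
    refine ⟨⟨?_, ?_⟩, by norm_num, by norm_num, ?_⟩ <;> nlinarith [hs.1, hs.2]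
  have hcurve : CurveIn Ω x z (fun s => c (f s) + e (g s) - y)
      (fun s => (f' s : ℂ) * c' (f s) + (g' s : ℂ) * e' (g s)) :=
    { hasDeriv := fun s => by
        have a := HasDerivAt.scomp s (hc.hasDeriv (f s)) (df s)
        have b := HasDerivAt.scomp s (he.hasDeriv (g s)) (dg s)
        rw [Complex.real_smul] at a b
        exact (a.add b).sub_const y
      cont := by
        have := hc.cont
        have := he.cont
        have : Continuous f := by fun_prop
        have : Continuous g := by fun_prop
        fun_prop
      mem := fun s hs => by
        rcases le_total s (1 / 2) with h | h
        · obtain ⟨a, b, -⟩ := f1 s ⟨hs.1, h⟩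
          simpa [b, he.src] using hc.mem _ a
        · obtain ⟨a, b, -⟩ := f2 s ⟨h, hs.2⟩
          simpa [b, hc.tgt] using he.mem _ a
      src := by
        obtain ⟨-, b, -⟩ := f1 0 (by norm_num)
        have : f 0 = 0 := by simp [hf]
        simp [b, he.src, this, hc.src]
      tgt := by
        obtain ⟨-, b, -⟩ := f2 1 (by norm_num)
        have : g 1 = 1 := by norm_num [hg]
        simp [b, hc.tgt, this, he.tgt] }
  refine ⟨_, _, hcurve, ?_⟩
  have i1 := hcurve.intervalIntegrable_speed hω (a := 0) (b := 1 / 2) (by norm_num) (by norm_num)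
  have i2 := hcurve.intervalIntegrable_speed hω (a := 1 / 2) (b := 1) (by norm_num) (by norm_num)
  rw [← intervalIntegral.integral_add_adjacent_intervals i1 i2]
  refine add_le_add (le_trans (le_of_eq ?_) hl) (le_trans (le_of_eq ?_) hk)
  · have f0 : f 0 = 0 := by simp [hf]
    have fh : f (1 / 2) = 1 := (f2 (1 / 2) (by norm_num)).2.1
    have := intervalIntegral.integral_comp_mul_deriv'' (a := 0) (b := 1 / 2) (f := f) (f' := f')
      (g := fun s => ω (c s) * ‖c' s‖) (fun s _ => (df s).continuousAt.continuousWithinAt)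
      (fun s _ => (df s).hasDerivWithinAt) cf.continuousOn
      ((hc.continuousOn_speed hω).mono (by
        rw [uIcc_of_le (by norm_num)]
        rintro _ ⟨s, hs, rfl⟩
        exact (f1 s hs).1))
    rw [f0, fh] at this
    rw [← this]
    refine intervalIntegral.integral_congr fun s hs => ?_
    rw [uIcc_of_le (by norm_num)] at hs
    obtain ⟨a, b, b', d⟩ := f1 s hs
    simp only [b, b', he.src, Function.comp, Complex.ofReal_zero, zero_mul, add_zero,
      add_sub_cancel_right, norm_mul, Complex.norm_real, Real.norm_eq_abs, abs_of_nonneg d]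
    ring
  · have f0 : g 1 = 1 := by norm_num [hg]
    have fh : g (1 / 2) = 0 := (f1 (1 / 2) (by norm_num)).2.1
    have := intervalIntegral.integral_comp_mul_deriv'' (a := 1 / 2) (b := 1) (f := g) (f' := g')
      (g := fun s => ω (e s) * ‖e' s‖) (fun s _ => (dg s).continuousAt.continuousWithinAt)
      (fun s _ => (dg s).hasDerivWithinAt) cg.continuousOn
      ((he.continuousOn_speed hω).mono (by
        rw [uIcc_of_le (by norm_num)]
        rintro _ ⟨s, hs, rfl⟩
        exact (f2 s hs).1))
    rw [f0, fh] at this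
    rw [← this]
    refine intervalIntegral.integral_congr fun s hs => ?_
    rw [uIcc_of_le (by norm_num)] at hs
    obtain ⟨a, b, b', d⟩ := f2 s hs
    simp only [b, b', hc.tgt, Function.comp, Complex.ofReal_zero, zero_mul, zero_add,
      add_sub_cancel_left, norm_mul, Complex.norm_real, Real.norm_eq_abs, abs_of_nonneg d]
    ring

theorem split (hω : ContinuousOn ω Ω) {a b : ℝ} (ha : 0 ≤ a) (hb : 0 ≤ b)
    (h : Reach ω Ω x y (a + b)) : ∃ z, Reach ω Ω x z a ∧ Reach ω Ω z y b := by
  obtain ⟨c, c', hc, hl⟩ := h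
  have hi := hc.intervalIntegrable_speed hω (a := 0) (b := 1) (by simp) (by simp)
  by_cases hla : ∫ s in (0:ℝ)..1, ω (c s) * ‖c' s‖ ≤ a
  · exact ⟨y, hc.reach.mono hla, (refl (hc.tgt ▸ hc.mem 1 (by simp))).mono hb⟩
  · push Not at hla
    have hcont : ContinuousOn (fun r => ∫ s in (0:ℝ)..r, ω (c s) * ‖c' s‖) (Icc 0 1) := by
      have := intervalIntegral.continuousOn_primitive_interval' (a := 0) hi (by simp)
      rwa [uIcc_of_le zero_le_one] at this
    obtain ⟨r, hr, e⟩ := intermediate_value_Icc zero_le_one hcont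
      (show a ∈ Icc _ _ from ⟨by simpa using ha, hla.le⟩)
    have r1 := hc.reach_subcurve (ω := ω) le_rfl hr.1 hr.2
    have r2 := hc.reach_subcurve (ω := ω) hr.1 hr.2 le_rfl
    rw [hc.src] at r1
    rw [hc.tgt] at r2
    refine ⟨c r, r1.mono e.le, r2.mono ?_⟩
    have := intervalIntegral.integral_add_adjacent_intervals
      (hc.intervalIntegrable_speed hω (a := 0) (b := r) (by simp) hr)
      (hc.intervalIntegrable_speed hω hr (b := 1) (by simp))
    simp only at e
    linarith

end Reach

theorem exists_first_exit {c : ℝ → ℂ} (hc : Continuous c) {U : Set ℂ} (hU : IsOpen U)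
    (h0 : c 0 ∈ U) {r : ℝ} (hr : r ∈ Icc (0:ℝ) 1) (hrU : c r ∉ U) :
    ∃ q ∈ Icc (0:ℝ) 1, c q ∉ U ∧ (∀ s ∈ Ico 0 q, c s ∈ U) ∧ ∀ s ∈ Icc 0 q, c s ∈ closure U := by
  set S := Icc (0:ℝ) 1 ∩ c ⁻¹' Uᶜ
  have hS : IsCompact S := isCompact_Icc.inter_right (hU.isClosed_compl.preimage hc)
  obtain ⟨q, hq⟩ := hS.exists_isLeast ⟨r, hr, hrU⟩
  have hq0 : 0 < q := by
    rcases hq.1.1.1.eq_or_lt with h | h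
    · exact absurd (h ▸ h0) hq.1.2
    · exact h
  have hI : ∀ s ∈ Ico 0 q, c s ∈ U := by
    intro s hs
    by_contra hn
    exact absurd (hq.2 ⟨⟨hs.1, hs.2.le.trans hq.1.1.2⟩, hn⟩) (not_le.2 hs.2)
  refine ⟨q, hq.1.1, hq.1.2, hI, ?_⟩
  have : MapsTo c (closure (Ico 0 q)) (closure U) := MapsTo.closure hI hc
  rwa [closure_Ico hq0.ne] at this

/-- A curve whose length is less than `m * r` cannot leave a ball of radius `r` on which the
weight is at least `m`. -/
theorem CurveIn.norm_sub_lt {Ω : Set ℂ} {x y : ℂ} {c c' : ℝ → ℂ} {ω : ℂ → ℝ}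
    (h : CurveIn Ω x y c c') (hω : ContinuousOn ω Ω) (hω0 : ∀ z ∈ Ω, 0 ≤ ω z) {m r : ℝ}
    (hr : 0 < r) (hm : ∀ z ∈ Ω, ‖z - x‖ ≤ r → m ≤ ω z)
    (hl : ∫ s in (0:ℝ)..1, ω (c s) * ‖c' s‖ < m * r) {s : ℝ} (hs : s ∈ Icc (0:ℝ) 1) :
    ‖c s - x‖ < r := by
  by_contra hn
  obtain ⟨q, hq, hqU, -, hcl⟩ := exists_first_exit h.continuous (isOpen_ball (x := x) (ε := r))
    (by rw [h.src]; exact mem_ball_self hr) hs (by rwa [mem_ball, dist_eq_norm])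
  rw [mem_ball, dist_eq_norm, not_lt] at hqU
  have hcl' : ∀ s ∈ Icc 0 q, ‖c s - x‖ ≤ r := fun s hs => by
    have := closure_ball_subset_closedBall (hcl s hs)
    rwa [mem_closedBall, dist_eq_norm] at this
  have e : ∫ s in (0:ℝ)..q, c' s = c q - x := by
    rw [← h.src]
    exact intervalIntegral.integral_eq_sub_of_hasDerivAt (fun s _ => h.hasDeriv s)
      (h.cont.intervalIntegrable _ _)
  have hm0 : 0 ≤ m := by
    by_contra hneg
    have := h.length_nonneg hω0
    nlinarith
  have k1 : ‖c q - x‖ ≤ ∫ s in (0:ℝ)..q, ‖c' s‖ := by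
    rw [← e]; exact intervalIntegral.norm_integral_le_integral_norm hq.1
  have k2 : ∫ s in (0:ℝ)..q, m * ‖c' s‖ ≤ ∫ s in (0:ℝ)..q, ω (c s) * ‖c' s‖ := by
    refine intervalIntegral.integral_mono_on hq.1 ?_
      (h.intervalIntegrable_speed hω (by simp) hq) fun s hs => ?_
    · exact (h.cont.norm.intervalIntegrable _ _).const_mul m
    · gcongr
      exact hm _ (h.mem s ⟨hs.1, hs.2.trans hq.2⟩) (hcl' s hs)
  have k3 := h.length_subcurve_le hω hω0 le_rfl hq.1 hq.2
  rw [intervalIntegral.integral_const_mul] at k2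
  nlinarith

theorem Reach.norm_sub_lt {Ω : Set ℂ} {x y : ℂ} {ω : ℂ → ℝ} {L : ℝ}
    (h : Reach ω Ω x y L) (hω : ContinuousOn ω Ω) (hω0 : ∀ z ∈ Ω, 0 ≤ ω z) {m r : ℝ}
    (hr : 0 < r) (hm : ∀ z ∈ Ω, ‖z - x‖ ≤ r → m ≤ ω z) (hl : L < m * r) : ‖y - x‖ < r := by
  obtain ⟨c, c', hc, hl'⟩ := h
  simpa [hc.tgt] using hc.norm_sub_lt hω hω0 hr hm (hl'.trans_lt hl) (s := 1) (by simp)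

section HopfRinow

variable {Ω : Set ℂ} {ω : ℂ → ℝ} {x y p : ℂ} {L : ℝ}

theorem exists_local_weight_bounds (hΩ : IsOpen Ω) (hω : ContinuousOn ω Ω)
    (hpos : ∀ z ∈ Ω, 0 < ω z) (hx : x ∈ Ω) :
    ∃ r > 0, ∃ m > 0, ∃ U > 0, closedBall x r ⊆ Ω ∧
      ∀ z, ‖z - x‖ ≤ r → m ≤ ω z ∧ ω z ≤ U := by
  have h0 := hpos x hx
  have h1 : ∀ᶠ z in nhds x, z ∈ Ω ∧ ω x / 2 < ω z ∧ ω z < 2 * ω x :=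
    (hΩ.eventually_mem hx).and (((hω.continuousAt (hΩ.mem_nhds hx)).eventually
      (lt_mem_nhds (by linarith))).and ((hω.continuousAt (hΩ.mem_nhds hx)).eventually
      (gt_mem_nhds (by linarith))))
  obtain ⟨r, hr, h⟩ := Metric.nhds_basis_closedBall.eventually_iff.1 h1
  refine ⟨r, hr, ω x / 2, by positivity, 2 * ω x, by positivity, fun z hz => (h hz).1, ?_⟩
  intro z hz
  have := h (show z ∈ closedBall x r by rwa [mem_closedBall, dist_eq_norm])
  exact ⟨this.2.1.le, this.2.2.le⟩

theorem reach_of_norm_sub_le (hω : ContinuousOn ω Ω) {r U : ℝ} (hr : closedBall x r ⊆ Ω)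
    (hU : ∀ z, ‖z - x‖ ≤ r → ω z ≤ U) (hy : ‖y - x‖ ≤ r) : Reach ω Ω x y (U * ‖y - x‖) := by
  have hn : ∀ s ∈ Icc (0:ℝ) 1, ‖x + s * (y - x) - x‖ ≤ r := by
    intro s hs
    rw [add_sub_cancel_left, norm_mul, Complex.norm_real, Real.norm_eq_abs, abs_of_nonneg hs.1]
    nlinarith [norm_nonneg (y - x), hs.2]
  refine Reach.segment (fun s hs => hr ?_) hω fun s hs => hU _ (hn s hs)
  rw [mem_closedBall, dist_eq_norm]
  exact hn s hs

theorem exists_nhds_reach (hΩ : IsOpen Ω) (hω : ContinuousOn ω Ω) (hpos : ∀ z ∈ Ω, 0 < ω z)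
    (hx : x ∈ Ω) {ε : ℝ} (hε : 0 < ε) : ∀ᶠ y in nhds x, Reach ω Ω x y ε := by
  obtain ⟨r, hr, m, hm, U, hU, hb, h⟩ := exists_local_weight_bounds hΩ hω hpos hx
  filter_upwards [ball_mem_nhds x (show 0 < min r (ε / U) by positivity)] with y hy
  rw [mem_ball, dist_eq_norm, lt_min_iff, lt_div_iff₀ hU] at hy
  exact (reach_of_norm_sub_le hω hb (fun z hz => (h z hz).2) hy.1.le).mono (by linarith)

theorem Reach.mem_connectedComponentIn (h : Reach ω Ω x y L) : y ∈ connectedComponentIn Ω x := by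
  obtain ⟨c, c', hc, -⟩ := h
  have h1 : IsPreconnected (c '' Icc 0 1) := isPreconnected_Icc.image _ hc.continuous.continuousOn
  exact h1.subset_connectedComponentIn ⟨0, by simp, hc.src⟩ (image_subset_iff.2 hc.mem)
    ⟨1, by simp, hc.tgt⟩

theorem exists_reach_of_mem_connectedComponentIn (hΩ : IsOpen Ω) (hω : ContinuousOn ω Ω)
    (hpos : ∀ z ∈ Ω, 0 < ω z) (hp : p ∈ Ω) (hy : y ∈ connectedComponentIn Ω p) :
    ∃ L, Reach ω Ω p y L := by
  set S := {y | ∃ L, Reach ω Ω p y L}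
  have h1 : IsOpen S := by
    rw [isOpen_iff_mem_nhds]
    rintro z ⟨L, hz⟩
    filter_upwards [exists_nhds_reach hΩ hω hpos hz.mem_right one_pos] with z' hz'
    exact ⟨_, hz.trans hω hz'⟩
  have h2 : IsOpen (Ω \ S) := by
    rw [isOpen_iff_mem_nhds]
    rintro z ⟨hz, hzS⟩
    filter_upwards [exists_nhds_reach hΩ hω hpos hz one_pos, hΩ.mem_nhds hz] with z' hz' hz''
    refine ⟨hz'', fun ⟨L, hL⟩ => hzS ⟨_, hL.trans hω hz'.symm⟩⟩
  have := isPreconnected_connectedComponentIn.subset_left_of_subset_union h1 h2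
    (disjoint_sdiff_right) (fun z hz => by
      by_cases h : z ∈ S
      · exact Or.inl h
      · exact Or.inr ⟨connectedComponentIn_subset _ _ hz, h⟩)
    ⟨p, mem_connectedComponentIn hp, 0, Reach.refl hp⟩
  exact this hy

theorem bddBelow_lengths (v : ℂ → ℝ) (Ω : Set ℂ) (x y : ℂ) :
    0 ∈ lowerBounds {L : ℝ | ∃ γ : ℝ → ℂ, ContDiffOn ℝ 1 γ (Icc 0 1) ∧
      (∀ s ∈ Icc (0:ℝ) 1, γ s ∈ Ω) ∧ γ 0 = x ∧ γ 1 = y ∧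
      L = ∫ s in (0:ℝ)..1, Real.sqrt (v (γ s)) * ‖derivWithin γ (Icc 0 1) s‖} := by
  rintro L ⟨γ, -, -, -, -, rfl⟩
  exact intervalIntegral.integral_nonneg zero_le_one fun s _ => by positivity

theorem confDist_nonneg (v : ℂ → ℝ) (Ω : Set ℂ) (x y : ℂ) : 0 ≤ confDist v Ω x y :=
  Real.sInf_nonneg fun _ h => bddBelow_lengths v Ω x y h

theorem CurveIn.length_mem {c c' : ℝ → ℂ} (hc : CurveIn Ω x y c c') (v : ℂ → ℝ) :
    ∫ s in (0:ℝ)..1, Real.sqrt (v (c s)) * ‖c' s‖ ∈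
      {L : ℝ | ∃ γ : ℝ → ℂ, ContDiffOn ℝ 1 γ (Icc 0 1) ∧
      (∀ s ∈ Icc (0:ℝ) 1, γ s ∈ Ω) ∧ γ 0 = x ∧ γ 1 = y ∧
      L = ∫ s in (0:ℝ)..1, Real.sqrt (v (γ s)) * ‖derivWithin γ (Icc 0 1) s‖} := by
  refine ⟨c, ContDiff.contDiffOn ?_, hc.mem, hc.src, hc.tgt, ?_⟩
  · rw [contDiff_one_iff_deriv]
    refine ⟨fun s => (hc.hasDeriv s).differentiableAt, ?_⟩
    rw [show deriv c = c' from funext fun s => (hc.hasDeriv s).deriv]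
    exact hc.cont
  · refine intervalIntegral.integral_congr fun s hs => ?_
    rw [uIcc_of_le zero_le_one] at hs
    rw [(hc.hasDeriv s).hasDerivWithinAt.derivWithin (uniqueDiffOn_Icc zero_lt_one s hs)]

theorem Reach.confDist_le {v : ℂ → ℝ} (h : Reach (fun z => Real.sqrt (v z)) Ω x y L) :
    confDist v Ω x y ≤ L := by
  obtain ⟨c, c', hc, hl⟩ := h
  exact (csInf_le ⟨0, bddBelow_lengths v Ω x y⟩ (hc.length_mem v)).trans hl

theorem reach_of_confDist_lt {v : ℂ → ℝ} {L' : ℝ}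
    (h : Reach (fun z => Real.sqrt (v z)) Ω x y L') (hL : confDist v Ω x y < L) :
    Reach (fun z => Real.sqrt (v z)) Ω x y L := by
  obtain ⟨c, c', hc, -⟩ := h
  obtain ⟨_, ⟨γ, hγ, hm, h0, h1, rfl⟩, hlt⟩ := exists_lt_of_csInf_lt ⟨_, hc.length_mem v⟩ hL
  have hd : ContinuousOn (derivWithin γ (Icc 0 1)) (Icc 0 1) :=
    hγ.continuousOn_derivWithin (uniqueDiffOn_Icc zero_lt_one) le_rfl
  set d : ℝ → ℂ := IccExtend zero_le_one ((Icc (0:ℝ) 1).domRestrict (derivWithin γ (Icc 0 1)))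
  have hdc : Continuous d := hd.domRestrict.Icc_extend'
  have hde : ∀ s ∈ Icc (0:ℝ) 1, d s = derivWithin γ (Icc 0 1) s := fun s hs =>
    IccExtend_of_mem _ _ hs
  have hγe : ∀ s ∈ Icc (0:ℝ) 1, γ 0 + ∫ r in (0:ℝ)..s, d r = γ s := by
    intro s hs
    have := intervalIntegral.integral_eq_sub_of_hasDeriv_right_of_le (a := 0) (b := s) (f := γ)
      (f' := d) hs.1 (hγ.continuousOn.mono (Icc_subset_Icc_right hs.2)) (fun r hr => by
        have hr' : r ∈ Icc (0:ℝ) 1 := ⟨hr.1.le, hr.2.le.trans hs.2⟩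
        rw [hde r hr']
        have e := (hγ.differentiableOn one_ne_zero r hr').hasDerivWithinAt
        exact (e.hasDerivAt (Icc_mem_nhds hr.1 (hr.2.trans_le hs.2))).hasDerivWithinAt)
      (hdc.intervalIntegrable _ _)
    rw [this]; ring
  refine ⟨fun s => γ 0 + ∫ r in (0:ℝ)..s, d r, d, ⟨fun s => ?_, hdc, ?_, by simp [h0], ?_⟩, ?_⟩
  · exact (intervalIntegral.integral_hasDerivAt_right (hdc.intervalIntegrable _ _)
      hdc.aestronglyMeasurable.stronglyMeasurableAtFilter hdc.continuousAt).const_add _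
  · intro s hs
    rw [hγe s hs]; exact hm s hs
  · rw [hγe 1 (by simp), h1]
  · refine le_trans (le_of_eq ?_) hlt.le
    refine intervalIntegral.integral_congr fun s hs => ?_
    rw [uIcc_of_le zero_le_one] at hs
    simp only
    rw [hγe s hs, hde s hs]

/-- A connected component of an open set, as a type without a preassigned topology. -/
structure ConfPoint (Ω : Set ℂ) (p : ℂ) where
  /-- The underlying point. -/
  pt : ℂ
  mem : pt ∈ connectedComponentIn Ω p

variable {v : ℂ → ℝ}

/-- A connected component of `Ω` with the distance induced by the conformal factor `v`. -/
@[reducible] noncomputable def confPseudoMetric (hΩ : IsOpen Ω)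
    (hω : ContinuousOn (fun z => Real.sqrt (v z)) Ω) (hpos : ∀ z ∈ Ω, 0 < Real.sqrt (v z))
    (hp : p ∈ Ω) : PseudoMetricSpace (ConfPoint Ω p) where
  dist a b := confDist v Ω a.pt b.pt
  dist_self a := le_antisymm
    (Reach.refl (connectedComponentIn_subset _ _ a.mem)).confDist_le (confDist_nonneg _ _ _ _)
  dist_comm a b := by
    have key : ∀ a b : ConfPoint Ω p, confDist v Ω b.pt a.pt ≤ confDist v Ω a.pt b.pt := by
      intro a b
      obtain ⟨L₁, h1⟩ := exists_reach_of_mem_connectedComponentIn hΩ hω hpos hp a.mem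
      obtain ⟨L₂, h2⟩ := exists_reach_of_mem_connectedComponentIn hΩ hω hpos hp b.mem
      exact le_of_forall_gt_imp_ge_of_dense fun L hL =>
        (reach_of_confDist_lt (h1.symm.trans hω h2) hL).symm.confDist_le
    exact le_antisymm (key b a) (key a b)
  dist_triangle a b c := by
    obtain ⟨L₁, h1⟩ := exists_reach_of_mem_connectedComponentIn hΩ hω hpos hp a.mem
    obtain ⟨L₂, h2⟩ := exists_reach_of_mem_connectedComponentIn hΩ hω hpos hp b.mem
    obtain ⟨L₃, h3⟩ := exists_reach_of_mem_connectedComponentIn hΩ hω hpos hp c.mem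
    refine le_of_forall_pos_le_add fun ε hε => ?_
    have r1 := reach_of_confDist_lt (h1.symm.trans hω h2)
      (show confDist v Ω a.pt b.pt < confDist v Ω a.pt b.pt + ε / 2 by linarith)
    have r2 := reach_of_confDist_lt (h2.symm.trans hω h3)
      (show confDist v Ω b.pt c.pt < confDist v Ω b.pt c.pt + ε / 2 by linarith)
    exact (r1.trans hω r2).confDist_le.trans (by linarith)

theorem exists_compact_reach_of_lt (hΩ : IsOpen Ω)
    (hω : ContinuousOn (fun z => Real.sqrt (v z)) Ω) (hpos : ∀ z ∈ Ω, 0 < Real.sqrt (v z))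
    (hcomp : ConfComplete v Ω) (hp : p ∈ Ω) {A : ℝ} (hA : 0 < A)
    (h : ∀ r < A, ∃ K, IsCompact K ∧ K ⊆ Ω ∧
      ∀ y, Reach (fun z => Real.sqrt (v z)) Ω p y r → y ∈ K) :
    ∃ K, IsCompact K ∧ K ⊆ Ω ∧ ∀ y, Reach (fun z => Real.sqrt (v z)) Ω p y A → y ∈ K := by
  let _ := confPseudoMetric hΩ hω hpos hp
  set w : ℂ → ℝ := fun z => Real.sqrt (v z)
  have hreach : ∀ a b : ConfPoint Ω p, ∀ L, dist a b < L → Reach w Ω a.pt b.pt L := by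
    intro a b L hL
    obtain ⟨L₁, h1⟩ := exists_reach_of_mem_connectedComponentIn hΩ hω hpos hp a.mem
    obtain ⟨L₂, h2⟩ := exists_reach_of_mem_connectedComponentIn hΩ hω hpos hp b.mem
    exact reach_of_confDist_lt (h1.symm.trans hω h2) hL
  have hdist : ∀ a b : ConfPoint Ω p, ∀ L, Reach w Ω a.pt b.pt L → dist a b ≤ L :=
    fun a b L hL => hL.confDist_le
  have hinj : Function.Injective (ConfPoint.pt : ConfPoint Ω p → ℂ) := by
    rintro ⟨a, _⟩ ⟨b, _⟩ h
    simpa using h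
  have hcont : Continuous (ConfPoint.pt : ConfPoint Ω p → ℂ) := by
    rw [Metric.continuous_iff]
    intro b ε hε
    obtain ⟨r, hr, m, hm, U, hU, hb, hl⟩ := exists_local_weight_bounds hΩ hω hpos
      (connectedComponentIn_subset _ _ b.mem)
    refine ⟨m * min r ε / 2, by positivity, fun a ha => ?_⟩
    rw [dist_comm] at ha
    have := (hreach b a _ ha).norm_sub_lt hω (fun z hz => (hpos z hz).le)
      (show 0 < min r ε by positivity) (m := m)
      (fun z _ hz => (hl z (hz.trans (min_le_left _ _))).1) (half_lt_self (by positivity))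
    rw [dist_eq_norm]
    exact this.trans_le (min_le_right _ _)
  have : CompleteSpace (ConfPoint Ω p) := by
    refine Metric.complete_of_cauchySeq_tendsto fun x hx => ?_
    obtain ⟨l, hl, hlim⟩ := hcomp p hp (fun n => (x n).pt) (fun n => (x n).mem)
      (Metric.cauchySeq_iff.1 hx)
    exact ⟨⟨l, hl⟩, tendsto_iff_dist_tendsto_zero.2 hlim⟩
  set S : Set (ConfPoint Ω p) := {a | Reach w Ω p a.pt A}
  have htb : TotallyBounded S := by
    rw [Metric.totallyBounded_iff]
    intro ε hε
    obtain ⟨K, hK, hKΩ, hmem⟩ := h (max 0 (A - ε / 4)) (max_lt hA (by linarith))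
    obtain ⟨t, htK, htc⟩ := hK.elim_nhds_subcover (fun x => {y | Reach w Ω x y (ε / 4)})
      (fun x hx => exists_nhds_reach hΩ hω hpos (hKΩ hx) (by linarith))
    refine ⟨ConfPoint.pt ⁻¹' (t : Set ℂ), t.finite_toSet.preimage hinj.injOn, ?_⟩
    intro a ha
    have ha' : Reach w Ω p a.pt (max 0 (A - ε / 4) + min A (ε / 4)) := by
      refine Reach.mono ha ?_
      rcases le_total A (ε / 4) with h' | h'
      · rw [min_eq_left h', max_eq_left (by linarith)]; linarith
      · rw [min_eq_right h', max_eq_right (by linarith)]; linarith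
    obtain ⟨z, hz, hza⟩ := ha'.split hω (le_max_left _ _) (by positivity)
    obtain ⟨x, hxt, hx⟩ := mem_iUnion₂.1 (htc (hmem z hz))
    refine mem_iUnion₂.2 ⟨⟨x, (hz.trans hω (Reach.symm hx)).mem_connectedComponentIn⟩, hxt, ?_⟩
    rw [mem_ball]
    refine (hdist _ _ _ ((Reach.trans hω hx hza).symm)).trans_lt ?_
    have := min_le_right A (ε / 4)
    linarith
  have hcl : IsCompact (closure S) := htb.closure.isCompact_of_isClosed isClosed_closure
  refine ⟨ConfPoint.pt '' closure S, hcl.image hcont, ?_, fun y hy => ?_⟩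
  · rintro _ ⟨a, -, rfl⟩
    exact connectedComponentIn_subset _ _ a.mem
  · exact ⟨⟨y, hy.mem_connectedComponentIn⟩, subset_closure hy, rfl⟩

/-- Hopf–Rinow: in a complete conformal metric, metric balls are relatively compact. -/
theorem exists_compact_reach (hΩ : IsOpen Ω)
    (hω : ContinuousOn (fun z => Real.sqrt (v z)) Ω) (hpos : ∀ z ∈ Ω, 0 < Real.sqrt (v z))
    (hcomp : ConfComplete v Ω) (hp : p ∈ Ω) (A : ℝ) :
    ∃ K, IsCompact K ∧ K ⊆ Ω ∧ ∀ y, Reach (fun z => Real.sqrt (v z)) Ω p y A → y ∈ K := by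
  set w : ℂ → ℝ := fun z => Real.sqrt (v z)
  set S : Set ℝ := {r | ∃ K, IsCompact K ∧ K ⊆ Ω ∧ ∀ y, Reach w Ω p y r → y ∈ K}
  have hdown : ∀ r ∈ S, ∀ r' ≤ r, r' ∈ S := by
    rintro r ⟨K, hK, hKΩ, hm⟩ r' hr'
    exact ⟨K, hK, hKΩ, fun y hy => hm y (hy.mono hr')⟩
  have hext : ∀ r, 0 ≤ r → r ∈ S → ∃ r' > r, r' ∈ S := by
    rintro r hr0 ⟨K, hK, hKΩ, hm⟩
    obtain ⟨ε, hε, hεΩ⟩ := hK.exists_cthickening_subset_open hΩ hKΩ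
    have hK' : IsCompact (cthickening ε K) := hK.cthickening
    obtain ⟨m, hm0, hmb⟩ : ∃ m > 0, ∀ z ∈ cthickening ε K, m ≤ w z := by
      rcases (cthickening ε K).eq_empty_or_nonempty with he | hne
      · exact ⟨1, one_pos, by simp [he]⟩
      · obtain ⟨z, hz, hmin⟩ := hK'.exists_isMinOn hne (hω.mono hεΩ)
        exact ⟨w z, hpos z (hεΩ hz), fun y hy => hmin hy⟩
    refine ⟨r + m * ε / 2, by simp; positivity, cthickening ε K, hK', hεΩ, fun y hy => ?_⟩
    obtain ⟨z, hz, hzy⟩ := hy.split hω hr0 (by positivity)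
    have hzK := hm z hz
    have := hzy.norm_sub_lt hω (fun z hz => (hpos z hz).le) hε (m := m)
      (fun q _ hq => hmb q (closedBall_subset_cthickening hzK ε
        (by rwa [mem_closedBall, dist_eq_norm]))) (half_lt_self (by positivity))
    exact closedBall_subset_cthickening hzK ε (by rw [mem_closedBall, dist_eq_norm]; exact this.le)
  have hneg : ∀ r < 0, r ∈ S := fun r hr => ⟨∅, isCompact_empty, empty_subset _, fun y hy =>
    absurd (hy.nonneg fun z hz => (hpos z hz).le) (not_le.2 hr)⟩
  have hzero : (0:ℝ) ∈ S := by
    obtain ⟨r, hr, m, hm, U, hU, hb, hl⟩ := exists_local_weight_bounds hΩ hω hpos hp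
    refine ⟨closedBall p r, isCompact_closedBall _ _, hb, fun y hy => ?_⟩
    rw [mem_closedBall, dist_eq_norm]
    exact (hy.norm_sub_lt hω (fun z hz => (hpos z hz).le) hr (m := m)
      (fun z _ hz => (hl z hz).1) (by positivity)).le
  by_contra hA
  have hbdd : BddAbove S := ⟨A, fun r hr => by
    by_contra hlt
    exact hA (hdown r hr A (not_le.1 hlt).le)⟩
  obtain ⟨r₀, hr₀, hr₀S⟩ := hext 0 le_rfl hzero
  have hpos' : 0 < sSup S := hr₀.trans_le (le_csSup hbdd hr₀S)
  have hsup : sSup S ∈ S := by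
    refine exists_compact_reach_of_lt hΩ hω hpos hcomp hp hpos' fun r hr => ?_
    obtain ⟨r', hr', hlt⟩ := exists_lt_of_lt_csSup ⟨0, hzero⟩ hr
    exact hdown r' hr' r hlt.le
  obtain ⟨r', hr', hr'S⟩ := hext _ hpos'.le hsup
  exact absurd (le_csSup hbdd hr'S) (not_le.2 hr')

end HopfRinow

/-- The length element `√u` of the metric at time `t`. -/
noncomputable def lengthWeight (u : ℂ → ℝ → ℝ) (t : ℝ) (z : ℂ) : ℝ := Real.sqrt (u z t)

namespace ConfRFS

variable {T : ℝ} {M : Set (ℂ × ℝ)} {u : ℂ → ℝ → ℝ}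

theorem isOpen_timeSlice (h : ConfRFS T M u) (t : ℝ) : IsOpen (timeSlice M t) :=
  h.opn.preimage (by fun_prop : Continuous fun z : ℂ => (z, t))

theorem continuousOn_sqrt (h : ConfRFS T M u) :
    ContinuousOn (fun q : ℂ × ℝ => lengthWeight u q.2 q.1) M :=
  h.smooth.continuousOn.sqrt

theorem continuousOn_lengthWeight (h : ConfRFS T M u) (t : ℝ) :
    ContinuousOn (lengthWeight u t) (timeSlice M t) :=
  h.continuousOn_sqrt.comp (f := fun z : ℂ => (z, t)) (by fun_prop) fun _ hz => hz

theorem lengthWeight_pos (h : ConfRFS T M u) {t : ℝ} {z : ℂ} (hz : z ∈ timeSlice M t) :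
    0 < lengthWeight u t z := Real.sqrt_pos.2 (h.pos _ hz)

theorem exists_compact_reach_nhdsWithin (h : ConfRFS T M u) (hcomp : ConfRFSComplete T M u)
    {γ : ℝ → ℂ} {I : Set ℝ} (hγ : ContinuousOn γ I) (hγM : ∀ t ∈ I, (γ t, t) ∈ M) {A : ℝ}
    (hA : 0 ≤ A) {t₀ : ℝ} (ht₀ : t₀ ∈ I) :
    ∃ K, IsCompact K ∧ K ⊆ M ∧ ∀ᶠ t in nhdsWithin t₀ I, ∀ y,
      Reach (lengthWeight u t) (timeSlice M t) (γ t) y A → (y, t) ∈ K := by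
  obtain ⟨K₀, hK₀, hK₀M, hreach⟩ := exists_compact_reach (v := fun z => u z t₀)
    (h.isOpen_timeSlice t₀) (h.continuousOn_lengthWeight t₀)
    (fun z hz => h.lengthWeight_pos hz) (hcomp t₀ (h.sub (hγM t₀ ht₀))) (hγM t₀ ht₀) (A + 2)
  change ∀ y, Reach (lengthWeight u t₀) (timeSlice M t₀) (γ t₀) y (A + 2) → y ∈ K₀ at hreach
  have hP : IsCompact (K₀ ×ˢ {t₀}) := hK₀.prod isCompact_singleton
  obtain ⟨ε, hε, hεM⟩ := hP.exists_cthickening_subset_open h.opn (by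
    rintro ⟨z, t⟩ ⟨hz, rfl⟩
    exact hK₀M hz)
  set N := cthickening ε (K₀ ×ˢ {t₀})
  have hN : IsCompact N := hP.cthickening
  have hmemN : ∀ z ∈ cthickening ε K₀, ∀ t, |t - t₀| ≤ ε → (z, t) ∈ N := by
    intro z hz t ht
    rw [hK₀.cthickening_eq_biUnion_closedBall hε.le] at hz
    obtain ⟨k, hk, hzk⟩ := mem_iUnion₂.1 hz
    refine closedBall_subset_cthickening (show (k, t₀) ∈ K₀ ×ˢ {t₀} from ⟨hk, rfl⟩) ε ?_
    rw [mem_closedBall, Prod.dist_eq]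
    exact max_le hzk (by rwa [Real.dist_eq])
  have hK₀ne : (γ t₀, t₀) ∈ N := hmemN _ (self_subset_cthickening _ (hreach _ ((Reach.refl
    (hγM t₀ ht₀)).mono (by linarith)))) _ (by simp [hε.le])
  obtain ⟨q, hq, hmin⟩ := hN.exists_isMinOn ⟨_, hK₀ne⟩ (h.continuousOn_sqrt.mono hεM)
  set m := lengthWeight u q.2 q.1
  have hm : 0 < m := h.lengthWeight_pos (hεM hq)
  have huc := hN.uniformContinuousOn_of_continuous (h.continuousOn_sqrt.mono hεM)
  rw [Metric.uniformContinuousOn_iff] at huc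
  obtain ⟨δ, hδ, hδu⟩ := huc (m * (1 / (A + 1))) (by positivity)
  refine ⟨N, hN, hεM, ?_⟩
  have ev1 : ∀ᶠ t in nhdsWithin t₀ I, |t - t₀| < min δ ε := by
    refine mem_nhdsWithin_of_mem_nhds ?_
    filter_upwards [ball_mem_nhds t₀ (show 0 < min δ ε by positivity)] with t ht
    rwa [mem_ball, Real.dist_eq] at ht
  have ev2 : ∀ᶠ t in nhdsWithin t₀ I,
      Reach (lengthWeight u t₀) (timeSlice M t₀) (γ t₀) (γ t) 1 :=
    (hγ t₀ ht₀).eventually (exists_nhds_reach (h.isOpen_timeSlice t₀)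
      (h.continuousOn_lengthWeight t₀) (fun z hz => h.lengthWeight_pos hz) (hγM t₀ ht₀) one_pos)
  filter_upwards [ev1, ev2] with t ht hγt y hy
  rw [lt_min_iff] at ht
  have hω : ∀ z ∈ cthickening ε K₀,
      lengthWeight u t₀ z ≤ (1 + 1 / (A + 1)) * lengthWeight u t z := by
    intro z hz
    have a1 := hmemN z hz t ht.2.le
    have a2 := hmemN z hz t₀ (by simp [hε.le])
    have a3 := hδu _ a2 _ a1 (by
      rw [Prod.dist_eq, dist_self, max_eq_right dist_nonneg, Real.dist_eq, abs_sub_comm]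
      exact ht.1)
    rw [Real.dist_eq, abs_lt] at a3
    have a4 : m ≤ lengthWeight u t z := hmin a1
    have a5 : m * (1 / (A + 1)) ≤ lengthWeight u t z * (1 / (A + 1)) := by gcongr
    simp only at a3
    linarith [a3.2]
  obtain ⟨c, c', hc, hl⟩ := hy
  have hin : ∀ s ∈ Icc (0:ℝ) 1, c s ∈ thickening ε K₀ := by
    intro s hs
    by_contra hn
    obtain ⟨r, hr, hrU, -, hcl⟩ := exists_first_exit hc.continuous isOpen_thickening
      (by
        rw [hc.src]
        exact self_subset_thickening hε _ (hreach _ (hγt.mono (by linarith)))) hs hn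
    refine hrU (self_subset_thickening hε _ (hreach _ ?_))
    have hcl' : ∀ s ∈ Icc 0 r, c s ∈ cthickening ε K₀ := fun s hs =>
      closure_thickening_subset_cthickening _ _ (hcl s hs)
    have hsub : CurveIn (timeSlice M t ∩ cthickening ε K₀) (c 0) (c r)
        (fun s => c (0 + (r - 0) * s)) (fun s => ((r - 0 : ℝ) : ℂ) * c' (0 + (r - 0) * s)) := by
      have := hc.affine (a := 0) (b := r) (by simp) hr
      refine ⟨this.hasDeriv, this.cont, fun s hs => ⟨this.mem s hs, hcl' _ ⟨?_, ?_⟩⟩, this.src,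
        this.tgt⟩
      · nlinarith [hs.1, hr.1]
      · nlinarith [hs.2, hr.1]
    have hsub₀ : CurveIn (timeSlice M t₀) (c 0) (c r) _ _ :=
      ⟨hsub.hasDeriv, hsub.cont, fun s hs => hεM (hmemN _ (hsub.mem s hs).2 t₀ (by simp [hε.le])),
        hsub.src, hsub.tgt⟩
    have hsubt : CurveIn (timeSlice M t) (c 0) (c r) _ _ :=
      ⟨hsub.hasDeriv, hsub.cont, fun s hs => (hsub.mem s hs).1, hsub.src, hsub.tgt⟩
    have hlen := hsub₀.reach (ω := lengthWeight u t₀)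
    rw [hc.src] at hlen
    refine (hγt.trans (h.continuousOn_lengthWeight t₀) hlen).mono ?_
    have k1 := intervalIntegral.integral_mono_on zero_le_one
      (hsub₀.intervalIntegrable_speed (h.continuousOn_lengthWeight t₀) (by simp) (by simp))
      ((hsubt.intervalIntegrable_speed (h.continuousOn_lengthWeight t) (by simp)
        (by simp)).const_mul (1 + 1 / (A + 1))) (fun s hs => by
        rw [← mul_assoc]
        gcongr
        exact hω _ (hsub.mem s hs).2)
    rw [intervalIntegral.integral_const_mul,
      CurveIn.length_affine_of_le (ω := lengthWeight u t) hr.1] at k1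
    have k2 := hc.length_subcurve_le (h.continuousOn_lengthWeight t)
      (fun z hz => (h.lengthWeight_pos hz).le) le_rfl hr.1 hr.2
    have k3 : (1 + 1 / (A + 1)) * ∫ s in (0:ℝ)..r, lengthWeight u t (c s) * ‖c' s‖
        ≤ (1 + 1 / (A + 1)) * A := by
      gcongr; exact k2.trans hl
    have k4 : (1 + 1 / (A + 1)) * A ≤ A + 1 := by
      have : 1 / (A + 1) * (A + 1) = 1 := by field_simp
      have : 0 < 1 / (A + 1) := by positivity
      nlinarith
    linarith
  rw [← hc.tgt]
  exact hmemN _ (thickening_subset_cthickening _ _ (hin 1 (by simp))) t ht.2.le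

/-- Points at bounded distance from a compact piece of a worldline form a relatively compact
subset of a complete spacetime. -/
theorem exists_compact_reach_worldline (h : ConfRFS T M u) (hcomp : ConfRFSComplete T M u)
    {γ : ℝ → ℂ} {I : Set ℝ} (hI : IsCompact I) (hγ : ContinuousOn γ I)
    (hγM : ∀ t ∈ I, (γ t, t) ∈ M) {A : ℝ} (hA : 0 ≤ A) :
    ∃ K, IsCompact K ∧ K ⊆ M ∧ ∀ t ∈ I, ∀ y,
      Reach (lengthWeight u t) (timeSlice M t) (γ t) y A → (y, t) ∈ K := by
  refine hI.induction_on (p := fun J => ∃ K, IsCompact K ∧ K ⊆ M ∧ ∀ t ∈ J, ∀ y,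
      Reach (lengthWeight u t) (timeSlice M t) (γ t) y A → (y, t) ∈ K) ?_ ?_ ?_ ?_
  · exact ⟨∅, isCompact_empty, empty_subset _, by simp⟩
  · rintro s t hst ⟨K, hK, hKM, hm⟩
    exact ⟨K, hK, hKM, fun r hr => hm r (hst hr)⟩
  · rintro s t ⟨K, hK, hKM, hm⟩ ⟨K', hK', hKM', hm'⟩
    refine ⟨K ∪ K', hK.union hK', union_subset hKM hKM', fun r hr y hy => ?_⟩
    rcases hr with hr | hr
    · exact Or.inl (hm r hr y hy)
    · exact Or.inr (hm' r hr y hy)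
  · intro t ht
    obtain ⟨K, hK, hKM, hm⟩ := h.exists_compact_reach_nhdsWithin hcomp hγ hγM hA ht
    exact ⟨_, hm, K, hK, hKM, fun r hr => hr⟩

end ConfRFS

/-- Taylor expansion at the four points `z + δ η k`, `η ∈ {1, -1, i, -i}`, at time `t - δ² / 4`. -/
theorem exists_cross_taylor_bound {M K : Set (ℂ × ℝ)} (hM : IsOpen M) {g : ℂ × ℝ → ℝ}
    (hg : ContDiffOn ℝ (⊤ : ℕ∞) g M) (hK : IsCompact K) (hKM : K ⊆ M) {R : ℝ} (hR : 1 ≤ R) :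
    ∃ C : ℝ, 0 ≤ C ∧ ∃ δ₀ : ℝ, 0 < δ₀ ∧ δ₀ ≤ 1 ∧ ∀ z t, (z, t) ∈ K → ∀ δ, 0 ≤ δ → δ ≤ δ₀ →
      ∀ k : ℂ, ‖k‖ ≤ R → (∀ i, (z + δ * crossDir i * k, t - δ ^ 2 / 4) ∈ M) ∧
      (∀ i, |g (z + δ * crossDir i * k, t - δ ^ 2 / 4) - g (z, t)
        - δ * (crossDir i * (spatialGrad g (z, t) * k)).re| ≤ C * δ ^ 2) ∧
      |∑ i, g (z + δ * crossDir i * k, t - δ ^ 2 / 4) - 4 * g (z, t)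
        - δ ^ 2 * (‖k‖ ^ 2 * spatialLap g (z, t) - timeDeriv g (z, t))| ≤ C * δ ^ 3 := by
  obtain ⟨C, hC, δ₀, hδ₀, hδ₁, H⟩ := exists_parabolic_taylor_bound hM hg hK hKM hR
  have h1 : ContDiffOn ℝ (⊤ : ℕ∞) (fderiv ℝ g) M := hg.fderiv_of_isOpen hM (by simp)
  have h2 : ContDiffOn ℝ (⊤ : ℕ∞) (fderiv ℝ (fderiv ℝ g)) M := h1.fderiv_of_isOpen hM (by simp)
  obtain ⟨B, hB⟩ := hK.exists_bound_of_continuousOn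
    (f := fderiv ℝ (fderiv ℝ g)) (h2.continuousOn.mono hKM)
  obtain ⟨B', hB'⟩ := hK.exists_bound_of_continuousOn
    (f := fderiv ℝ g) (h1.continuousOn.mono hKM)
  refine ⟨4 * C + |B| * R ^ 2 + |B'|, by positivity, δ₀, hδ₀, hδ₁,
    fun z t hzt δ h0 hδ k hk => ?_⟩
  have hn : ∀ i, ‖δ * crossDir i * k‖ ≤ R * δ := fun i => by
    rw [norm_mul, norm_mul, norm_crossDir, Complex.norm_real, Real.norm_eq_abs, abs_of_nonneg h0]
    nlinarith
  have hT := fun i => H z t hzt δ h0 hδ (δ * crossDir i * k) (δ ^ 2 / 4) (hn i) (by positivity)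
    (by nlinarith [sq_nonneg δ])
  have hhess : ∀ i, spatialHess g (z, t) (δ * crossDir i * k)
      = δ ^ 2 * spatialHess g (z, t) (crossDir i * k) := fun i => by
    rw [mul_assoc, spatialHess_smul]
  have hgrad : ∀ i, (spatialGrad g (z, t) * (δ * crossDir i * k)).re
      = δ * (crossDir i * (spatialGrad g (z, t) * k)).re := fun i => by
    rw [show spatialGrad g (z, t) * (δ * crossDir i * k)
      = δ * (crossDir i * (spatialGrad g (z, t) * k)) by ring, Complex.re_ofReal_mul]
  simp only [hhess, hgrad] at hT
  have hd1 : δ ≤ 1 := hδ.trans hδ₁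
  have hd3 : δ ^ 3 ≤ δ ^ 2 := by nlinarith [sq_nonneg δ]
  refine ⟨fun i => (hT i).1, fun i => ?_, ?_⟩
  · have e := (hT i).2
    have b1 : |spatialHess g (z, t) (crossDir i * k)| ≤ |B| * R ^ 2 := by
      have := ContinuousLinearMap.le_opNorm₂ (fderiv ℝ (fderiv ℝ g) (z, t))
        (crossDir i * k, 0) (crossDir i * k, 0)
      have hk' : ‖((crossDir i * k, (0:ℝ)) : ℂ × ℝ)‖ ≤ R := by
        simp [norm_crossDir, hk]
      calc _ ≤ _ := this
        _ ≤ |B| * R * R := by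
          gcongr
          exact (hB _ hzt).trans (le_abs_self B)
        _ = _ := by ring
    have b2 : |timeDeriv g (z, t)| ≤ |B'| := by
      have := ContinuousLinearMap.le_opNorm (fderiv ℝ g (z, t)) (0, 1)
      have h01 : ‖((0 : ℂ), (1 : ℝ))‖ ≤ 1 := by simp
      calc _ ≤ _ := this
        _ ≤ |B'| * 1 := by
          gcongr
          exact (hB' _ hzt).trans (le_abs_self B')
        _ = _ := by ring
    have c1 : |δ ^ 2 * spatialHess g (z, t) (crossDir i * k)| ≤ δ ^ 2 * (|B| * R ^ 2) := by
      rw [abs_mul, abs_of_nonneg (sq_nonneg δ)]; gcongr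
    have c2 : |δ ^ 2 * timeDeriv g (z, t)| ≤ δ ^ 2 * |B'| := by
      rw [abs_mul, abs_of_nonneg (sq_nonneg δ)]; gcongr
    have c3 : C * δ ^ 3 ≤ C * δ ^ 2 := by gcongr
    have c4 : 0 ≤ C * δ ^ 2 := by positivity
    have c5 : 0 ≤ |B| * R ^ 2 * δ ^ 2 := by positivity
    have c6 : 0 ≤ |B'| * δ ^ 2 := by positivity
    rw [abs_le] at e c1 c2 ⊢
    constructor <;> nlinarith
  · have hL := spatialHess_add_spatialHess_I_mul hM hg (hKM hzt) k
    have hsum : ∑ i, (δ * (crossDir i * (spatialGrad g (z, t) * k)).re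
        + (1 / 2) * (δ ^ 2 * spatialHess g (z, t) (crossDir i * k))
        - δ ^ 2 / 4 * timeDeriv g (z, t))
        = δ ^ 2 * (‖k‖ ^ 2 * spatialLap g (z, t) - timeDeriv g (z, t)) := by
      rw [← hL]
      simp only [Fin.sum_univ_four, crossDir]
      simp [spatialHess_neg]
      ring
    have : ∑ i, g (z + δ * crossDir i * k, t - δ ^ 2 / 4) - 4 * g (z, t)
        - δ ^ 2 * (‖k‖ ^ 2 * spatialLap g (z, t) - timeDeriv g (z, t))
        = ∑ i, (g (z + δ * crossDir i * k, t - δ ^ 2 / 4) - g (z, t)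
          - δ * (crossDir i * (spatialGrad g (z, t) * k)).re
          - (1 / 2) * (δ ^ 2 * spatialHess g (z, t) (crossDir i * k))
          + δ ^ 2 / 4 * timeDeriv g (z, t)) := by
      rw [← hsum]
      simp only [Finset.sum_sub_distrib, Finset.sum_add_distrib]
      simp
      ring
    rw [this]
    refine (Finset.abs_sum_le_sum_abs _ _).trans ((Finset.sum_le_sum fun i _ => (hT i).2).trans ?_)
    have c5 : 0 ≤ (|B| * R ^ 2 + |B'|) * δ ^ 3 := by positivity
    simp
    nlinarith

/-- Half the logarithm of the conformal factor. -/
noncomputable def halfLog (u : ℂ → ℝ → ℝ) : ℂ × ℝ → ℝ := (1 / 2 : ℝ) • logFactor u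

theorem timeDeriv_halfLog (u : ℂ → ℝ → ℝ) (q : ℂ × ℝ) :
    timeDeriv (halfLog u) q = timeDeriv (logFactor u) q / 2 := by
  have : Invertible (1 / 2 : ℝ) := invertibleOfNonzero (by norm_num)
  rw [timeDeriv, halfLog, fderiv_const_smul_of_invertible, smul_apply, timeDeriv, smul_eq_mul]
  ring

set_option maxSynthPendingDepth 3 in
theorem spatialLap_halfLog (u : ℂ → ℝ → ℝ) (q : ℂ × ℝ) :
    spatialLap (halfLog u) q = spatialLap (logFactor u) q / 2 := by
  have : Invertible (1 / 2 : ℝ) := invertibleOfNonzero (by norm_num)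
  have e : fderiv ℝ (halfLog u) = (1 / 2 : ℝ) • fderiv ℝ (logFactor u) :=
    funext fun q => fderiv_const_smul_of_invertible _
  have e2 : fderiv ℝ (fderiv ℝ (halfLog u)) q = (1 / 2 : ℝ) • fderiv ℝ (fderiv ℝ (logFactor u)) q := by
    rw [e]
    exact fderiv_const_smul_of_invertible _
  simp only [spatialLap, spatialHess, e2, smul_apply, smul_eq_mul]
  ring

namespace ConfRFS

variable {T : ℝ} {M : Set (ℂ × ℝ)} {u : ℂ → ℝ → ℝ}

theorem contDiffOn_halfLog (h : ConfRFS T M u) : ContDiffOn ℝ (⊤ : ℕ∞) (halfLog u) M :=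
  ContDiffOn.congr (h.contDiffOn_logFactor.const_smul (1 / 2 : ℝ)) fun _ _ => rfl

theorem exp_halfLog (h : ConfRFS T M u) {z : ℂ} {t : ℝ} (hq : (z, t) ∈ M) :
    Real.exp (halfLog u (z, t)) = lengthWeight u t z := by
  have := h.exp_logFactor hq
  rw [lengthWeight, ← this, halfLog, Real.sqrt_eq_rpow, ← Real.exp_mul]
  simp [mul_comm]

theorem spatialLap_halfLog_eq (h : ConfRFS T M u) {q : ℂ × ℝ} (hq : q ∈ M) :
    spatialLap (halfLog u) q = Real.exp (halfLog u q) ^ 2 * timeDeriv (halfLog u) q := by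
  rw [spatialLap_halfLog, timeDeriv_halfLog, ← h.exp_mul_timeDeriv hq, ← Real.exp_nat_mul,
    halfLog]
  simp
  ring

/-- The effect on the length element of moving a curve with velocity `e` in the directions
`δ η f v` and back in time by `δ² / 4`. -/
theorem exists_length_element_bound (h : ConfRFS T M u) {K : Set (ℂ × ℝ)} (hK : IsCompact K)
    (hKM : K ⊆ M) :
    ∃ C : ℝ, 0 ≤ C ∧ ∃ δ₀ : ℝ, 0 < δ₀ ∧ δ₀ ≤ 1 ∧ ∀ z t, (z, t) ∈ K → ∀ δ, 0 ≤ δ → δ ≤ δ₀ →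
      ∀ (v e : ℂ) (f g : ℝ), lengthWeight u t z * ‖v‖ = 1 → f ∈ Icc (0:ℝ) 1 → g ∈ Icc (0:ℝ) 2 →
      (∀ i, (z + δ * crossDir i * (f * v), t - δ ^ 2 / 4) ∈ M) ∧
      (∀ i, |lengthWeight u (t - δ ^ 2 / 4) (z + δ * crossDir i * (f * v)) *
        ‖e + δ * crossDir i * (g * lengthWeight u t z * ‖e‖ * v
          - f * spatialGrad (halfLog u) (z, t) * e * v)‖
        - lengthWeight u t z * ‖e‖ - δ * (crossDir i * (g * lengthWeight u t z ^ 2 * v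
          * (starRingEnd ℂ) e)).re| ≤ C * δ ^ 2 * (lengthWeight u t z * ‖e‖)) ∧
      ∑ i, lengthWeight u (t - δ ^ 2 / 4) (z + δ * crossDir i * (f * v)) *
        ‖e + δ * crossDir i * (g * lengthWeight u t z * ‖e‖ * v
          - f * spatialGrad (halfLog u) (z, t) * e * v)‖
        ≤ (4 + δ ^ 2 * (g ^ 2 + (f ^ 2 - 1) * timeDeriv (halfLog u) (z, t)) + C * δ ^ 3) *
          (lengthWeight u t z * ‖e‖) := by
  have hw := h.contDiffOn_halfLog
  have h1 : ContDiffOn ℝ (⊤ : ℕ∞) (fderiv ℝ (halfLog u)) M := hw.fderiv_of_isOpen h.opn (by simp)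
  obtain ⟨B, hB⟩ := hK.exists_bound_of_continuousOn
    (f := fun q : ℂ × ℝ => (lengthWeight u q.2 q.1)⁻¹)
    ((h.continuousOn_sqrt.inv₀ fun q hq => (h.lengthWeight_pos hq).ne').mono hKM)
  obtain ⟨B', hB'⟩ := hK.exists_bound_of_continuousOn (f := spatialGrad (halfLog u)) (by
    refine ContinuousOn.mono ?_ hKM
    have e1 := h1.continuousOn.clm_apply (continuousOn_const (c := ((1 : ℂ), (0 : ℝ))))
    have e2 := h1.continuousOn.clm_apply (continuousOn_const (c := (Complex.I, (0 : ℝ))))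
    exact Complex.equivRealProdCLM.symm.continuous.comp_continuousOn (e1.prodMk e2.neg))
  obtain ⟨C₁, hC₁, δ₁, hδ₁, -, H₁⟩ := exists_cross_taylor_bound h.opn hw hK hKM
    (R := 1 + |B|) (by simp)
  have hR2 : 1 ≤ 2 + |B| * |B'| + C₁ := by
    have : 0 ≤ |B| * |B'| := by positivity
    linarith
  obtain ⟨C₂, hC₂, δ₂, hδ₂, hδ₂', H₂⟩ := exists_length_ratio_bound hR2
  refine ⟨C₁ + C₂, by positivity, min δ₁ δ₂, by positivity, (min_le_right _ _).trans hδ₂',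
    fun z t hzt δ h0 hδ v e f g hv hf hg => ?_⟩
  have hEpos : 0 < lengthWeight u t z := h.lengthWeight_pos (hKM hzt)
  have hEexp := h.exp_halfLog (hKM hzt)
  set E := lengthWeight u t z with hE
  set κ := spatialGrad (halfLog u) (z, t) with hκ
  have hvn : ‖v‖ = E⁻¹ := by field_simp; linarith
  have hvB : ‖v‖ ≤ |B| := by
    have := hB _ hzt
    simp only [Real.norm_eq_abs] at this
    rw [hvn]
    exact (le_abs_self _).trans (this.trans (le_abs_self _))
  have hκB : ‖κ‖ ≤ |B'| := (hB' _ hzt).trans (le_abs_self _)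
  have hf1 : |f| ≤ 1 := by rw [abs_of_nonneg hf.1]; exact hf.2
  have hfv : ‖(f : ℂ) * v‖ ≤ |B| := by
    rw [norm_mul, Complex.norm_real, Real.norm_eq_abs]
    nlinarith [abs_nonneg f, norm_nonneg v]
  obtain ⟨m, t1, t2⟩ := H₁ z t hzt δ h0 (hδ.trans (min_le_left _ _)) (f * v) (by linarith)
  refine ⟨m, ?_⟩
  have hexp : ∀ i, lengthWeight u (t - δ ^ 2 / 4) (z + δ * crossDir i * (f * v))
      = Real.exp (halfLog u (z + δ * crossDir i * (f * v), t - δ ^ 2 / 4)) :=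
    fun i => (h.exp_halfLog (m i)).symm
  set b : ℂ := κ * (f * v) with hb
  set x : Fin 4 → ℝ := fun i => halfLog u (z + δ * crossDir i * (f * v), t - δ ^ 2 / 4)
    - halfLog u (z, t) - δ * (crossDir i * b).re with hx
  have hxi : ∀ i, |x i| ≤ (2 + |B| * |B'| + C₁) * δ ^ 2 := fun i => (t1 i).trans (by
    gcongr
    have : 0 ≤ |B| * |B'| := by positivity
    linarith)
  have hexp' : ∀ i, lengthWeight u (t - δ ^ 2 / 4) (z + δ * crossDir i * (f * v))
      = E * Real.exp (δ * (crossDir i * b).re + x i) := fun i => by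
    rw [hexp i, ← hEexp, ← Real.exp_add]
    congr 1
    simp only [hx]; ring
  rcases eq_or_ne e 0 with he | he
  · subst he
    simp
  have hen : 0 < ‖e‖ := norm_pos_iff.2 he
  have hee : (starRingEnd ℂ) e * e = (‖e‖ : ℂ) ^ 2 := by
    rw [Complex.conj_mul']
  have henC : (‖e‖ : ℂ) ≠ 0 := by exact_mod_cast hen.ne'
  set a : ℂ := g * E * v * (starRingEnd ℂ) e / ‖e‖ with ha
  have han : ‖a‖ = g := by
    rw [ha, norm_div, norm_mul, norm_mul, norm_mul, Complex.norm_real, Complex.norm_real,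
      Complex.norm_real, Complex.norm_conj, norm_norm, hvn, Real.norm_eq_abs, Real.norm_eq_abs,
      abs_of_nonneg hg.1, abs_of_pos hEpos]
    field_simp
  have hbn : ‖b‖ ≤ |B'| * |B| := by
    rw [hb, norm_mul]; gcongr
  have hcurve : ∀ i, e + δ * crossDir i * (g * E * ‖e‖ * v - f * κ * e * v)
      = e * (1 + δ * crossDir i * (a - b)) := fun i => by
    have : e * a = g * E * ‖e‖ * v := by
      rw [ha]
      field_simp
      linear_combination ((g : ℂ) * E * v) * hee
    rw [mul_add, mul_one]
    congr 1
    calc _ = δ * crossDir i * (e * a - f * κ * e * v) := by rw [this]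
      _ = _ := by rw [hb]; ring
  obtain ⟨r1, r2⟩ := H₂ δ h0 (hδ.trans (min_le_right _ _)) a b x
    (by rw [han]; have : 0 ≤ |B| * |B'| := by positivity
        linarith [hg.2])
    (by linarith) hxi
  have hI : ∀ i, lengthWeight u (t - δ ^ 2 / 4) (z + δ * crossDir i * (f * v)) *
        ‖e + δ * crossDir i * (g * E * ‖e‖ * v - f * κ * e * v)‖
      = E * ‖e‖ * (Real.exp (δ * (crossDir i * b).re + x i)
        * ‖1 + δ * crossDir i * (a - b)‖) := fun i => by
    rw [hexp' i, hcurve i, norm_mul]; ring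
  have hJ : ∀ i, (crossDir i * (g * E ^ 2 * v * (starRingEnd ℂ) e)).re
      = E * ‖e‖ * (crossDir i * a).re := fun i => by
    rw [← Complex.re_ofReal_mul]
    congr 1
    rw [ha]
    push_cast
    field_simp
  have hP : 0 ≤ E * ‖e‖ := by positivity
  constructor
  · intro i
    rw [hI i, hJ i]
    have : E * ‖e‖ * (Real.exp (δ * (crossDir i * b).re + x i)
        * ‖1 + δ * crossDir i * (a - b)‖) - E * ‖e‖ - δ * (E * ‖e‖ * (crossDir i * a).re)
        = E * ‖e‖ * (Real.exp (δ * (crossDir i * b).re + x i)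
        * ‖1 + δ * crossDir i * (a - b)‖ - 1 - δ * (crossDir i * a).re) := by ring
    rw [this, abs_mul, abs_of_nonneg hP, mul_comm]
    gcongr
    refine (r1 i).trans ?_
    gcongr
    linarith
  · simp only [hI]
    rw [← Finset.mul_sum, mul_comm]
    gcongr
    have hxs : ∑ i, x i = ∑ i, halfLog u (z + δ * crossDir i * (f * v), t - δ ^ 2 / 4)
        - 4 * halfLog u (z, t) := by
      simp only [hx, Finset.sum_sub_distrib]
      have : ∑ i, δ * (crossDir i * b).re = 0 := by
        simp [Fin.sum_univ_four, crossDir]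
      rw [this]
      simp
    have hlap : ‖(f : ℂ) * v‖ ^ 2 * spatialLap (halfLog u) (z, t)
        = f ^ 2 * timeDeriv (halfLog u) (z, t) := by
      rw [h.spatialLap_halfLog_eq (hKM hzt), hEexp, norm_mul, hvn, Complex.norm_real,
        Real.norm_eq_abs, mul_pow, sq_abs]
      field_simp
    rw [hlap, ← hxs] at t2
    rw [han] at r2
    rw [abs_le] at t2 r2
    nlinarith [t2.2, r2.2]

end ConfRFS

/-- A cutoff along a curve of length at least one, as a function of the arc length `∫ ℓ`. -/
theorem exists_length_cutoff {ℓ : ℝ → ℝ} (hℓ : Continuous ℓ) (hℓ0 : ∀ s ∈ Icc (0:ℝ) 1, 0 ≤ ℓ s)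
    (h1 : 1 ≤ ∫ s in (0:ℝ)..1, ℓ s) :
    ∃ f g : ℝ → ℝ, Continuous g ∧ (∀ s, HasDerivAt f (g s * ℓ s) s) ∧ f 0 = 0 ∧ f 1 = 1 ∧
      ∀ s ∈ Icc (0:ℝ) 1, f s ∈ Icc (0:ℝ) 1 ∧ g s ∈ Icc (0:ℝ) 2 ∧
        ∀ B w : ℝ, 0 ≤ B → (∫ r in (0:ℝ)..s, ℓ r ≤ 1 → |w| ≤ B) →
          g s ^ 2 + (f s ^ 2 - 1) * w ≤ (2 + B) * g s := by
  have hσ : ∀ s, HasDerivAt (fun s => ∫ r in (0:ℝ)..s, ℓ r) (ℓ s) s := fun s =>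
    intervalIntegral.integral_hasDerivAt_right (hℓ.intervalIntegrable _ _)
      (hℓ.stronglyMeasurableAtFilter _ _) hℓ.continuousAt
  have hσc : Continuous (fun s => ∫ r in (0:ℝ)..s, ℓ r) :=
    continuous_iff_continuousAt.2 fun s => (hσ s).continuousAt
  refine ⟨fun s => 1 - max (1 - ∫ r in (0:ℝ)..s, ℓ r) 0 ^ 2,
    fun s => 2 * max (1 - ∫ r in (0:ℝ)..s, ℓ r) 0, by fun_prop, fun s => ?_, by simp, ?_, ?_⟩
  · have := ((hasDerivAt_max_zero_sq _).comp s ((hσ s).const_sub 1)).const_sub 1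
    exact this.congr_deriv (by ring)
  · simp only
    rw [max_eq_right (by linarith)]
    norm_num
  · intro s hs
    have h0 : 0 ≤ ∫ r in (0:ℝ)..s, ℓ r :=
      intervalIntegral.integral_nonneg hs.1 fun r hr => hℓ0 r ⟨hr.1, hr.2.trans hs.2⟩
    rcases le_or_gt (∫ r in (0:ℝ)..s, ℓ r) 1 with h | h
    · simp only [max_eq_left (sub_nonneg.2 h)]
      set p := 1 - ∫ r in (0:ℝ)..s, ℓ r with hp
      have hp0 : 0 ≤ p := sub_nonneg.2 h
      have hp1 : p ≤ 1 := by linarith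
      have hpp : p ^ 2 ≤ p := by nlinarith
      have hp4 : p ^ 4 ≤ p ^ 2 := by nlinarith [sq_nonneg p]
      refine ⟨⟨by linarith, by nlinarith⟩, ⟨by linarith, by linarith⟩, fun B w hB hw => ?_⟩
      have hw := abs_le.1 (hw h)
      have k : 0 ≤ 2 * p ^ 2 - p ^ 4 := by nlinarith [sq_nonneg p]
      nlinarith [mul_nonneg k (by linarith [hw.1] : 0 ≤ B + w),
        mul_nonneg hB (sub_nonneg.2 hpp), mul_nonneg hB (by positivity : 0 ≤ p ^ 4)]
    · simp only [max_eq_right (by linarith : 1 - ∫ r in (0:ℝ)..s, ℓ r ≤ 0)]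
      norm_num

namespace ConfRFS

variable {T : ℝ} {M : Set (ℂ × ℝ)} {u : ℂ → ℝ → ℝ}

/-- A parallel field of unit vectors along a curve in a time-slice. -/
theorem exists_parallel_unit_field (h : ConfRFS T M u) {t : ℝ} {x y : ℂ} {c c' : ℝ → ℂ}
    (hc : CurveIn (timeSlice M t) x y c c') :
    ∃ κ v : ℝ → ℂ, Continuous κ ∧
      (∀ s ∈ Icc (0:ℝ) 1, κ s = spatialGrad (halfLog u) (c s, t)) ∧
      (∀ s, HasDerivAt v (-(κ s * c' s * v s)) s) ∧
      ∀ s ∈ Icc (0:ℝ) 1, lengthWeight u t (c s) * ‖v s‖ = 1 := by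
  have hw := h.contDiffOn_halfLog
  have h1 : ContDiffOn ℝ (⊤ : ℕ∞) (fderiv ℝ (halfLog u)) M := hw.fderiv_of_isOpen h.opn (by simp)
  have hcc : ContinuousOn (fun s => ((c s, t) : ℂ × ℝ)) (Icc 0 1) := by
    have := hc.continuous
    fun_prop
  have hgrad : ContinuousOn (fun s => spatialGrad (halfLog u) (c s, t)) (Icc 0 1) := by
    have h2 : ContinuousOn (fun s => fderiv ℝ (halfLog u) (c s, t)) (Icc 0 1) :=
      h1.continuousOn.comp hcc hc.mem
    have e : ∀ s, spatialGrad (halfLog u) (c s, t)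
        = ((fderiv ℝ (halfLog u) (c s, t) (1, 0) : ℝ) : ℂ)
          - ((fderiv ℝ (halfLog u) (c s, t) (Complex.I, 0) : ℝ) : ℂ) * Complex.I := fun s => by
      apply Complex.ext <;> simp [spatialGrad]
    simp only [e]
    exact (Complex.continuous_ofReal.comp_continuousOn (h2.clm_apply continuousOn_const)).sub
      ((Complex.continuous_ofReal.comp_continuousOn (h2.clm_apply continuousOn_const)).mul
        continuousOn_const)
  set κ : ℝ → ℂ := IccExtend zero_le_one (Set.domRestrict (Icc (0:ℝ) 1)
    fun s => spatialGrad (halfLog u) (c s, t)) with hκ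
  have hκc : Continuous κ := hgrad.domRestrict.Icc_extend'
  have hκe : ∀ s ∈ Icc (0:ℝ) 1, κ s = spatialGrad (halfLog u) (c s, t) := fun s hs => by
    rw [hκ, IccExtend_of_mem _ _ hs]
    rfl
  have hcont : Continuous fun s => κ s * c' s := hκc.mul hc.cont
  have hθ : ∀ s, HasDerivAt (fun s => ∫ r in (0:ℝ)..s, κ r * c' r) (κ s * c' s) s := fun s =>
    intervalIntegral.integral_hasDerivAt_right (hcont.intervalIntegrable _ _)
      (hcont.stronglyMeasurableAtFilter _ _) hcont.continuousAt
  set θ : ℝ → ℂ := fun s => ∫ r in (0:ℝ)..s, κ r * c' r with hθdef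
  refine ⟨κ, fun s => Complex.exp (-(halfLog u (c 0, t) : ℝ) - θ s), hκc, hκe, fun s => ?_,
    fun s hs => ?_⟩
  · exact (((hθ s).const_sub _).cexp).congr_deriv (by ring)
  · have hre : ∀ r, HasDerivAt (fun r => (θ r).re) (κ r * c' r).re r := fun r =>
      (Complex.reCLM.hasFDerivAt.comp_hasDerivAt r (hθ r))
    have hd : ∀ r ∈ Icc (0:ℝ) 1,
        HasDerivAt (fun r => halfLog u (c r, t) - (θ r).re) 0 r := fun r hr => by
      have hq : (c r, t) ∈ M := hc.mem r hr
      have d1 : HasFDerivAt (halfLog u) (fderiv ℝ (halfLog u) (c r, t)) (c r, t) :=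
        ((hw.contDiffAt (h.opn.mem_nhds hq)).differentiableAt (by simp)).hasFDerivAt
      have d2 : HasDerivAt (fun r => ((c r, t) : ℂ × ℝ)) (c' r, 0) r :=
        (hc.hasDeriv r).prodMk (hasDerivAt_const r t)
      have := (d1.comp_hasDerivAt r d2).sub (hre r)
      refine this.congr_deriv ?_
      rw [fderiv_eq_spatialGrad, hκe r hr]
      simp
    have hconst := constant_of_has_deriv_right_zero (a := 0) (b := 1)
      (f := fun r => halfLog u (c r, t) - (θ r).re)
      (fun r hr => (hd r hr).continuousAt.continuousWithinAt)
      (fun r hr => (hd r ⟨hr.1, hr.2.le⟩).hasDerivWithinAt) s hs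
    have hθ0 : θ 0 = 0 := by simp [hθdef]
    simp only [hθ0, Complex.zero_re, sub_zero] at hconst
    rw [← h.exp_halfLog (hc.mem s hs), Complex.norm_exp, ← Real.exp_add]
    simp
    linarith

/-- Second variation of length: moving the end point of a curve in the four directions
`crossDir` and back in time. -/
theorem exists_length_variation (h : ConfRFS T M u) {K : Set (ℂ × ℝ)} (hK : IsCompact K)
    (hKM : K ⊆ M) {A B : ℝ} (hA : 0 ≤ A) (hB : 0 ≤ B) :
    ∃ C : ℝ, 0 ≤ C ∧ ∃ δ₀ : ℝ, 0 < δ₀ ∧ δ₀ ≤ 1 ∧ ∀ t x y c c',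
      CurveIn (timeSlice M t) x y c c' → (∀ s ∈ Icc (0:ℝ) 1, (c s, t) ∈ K) →
      1 ≤ ∫ s in (0:ℝ)..1, lengthWeight u t (c s) * ‖c' s‖ →
      ∫ s in (0:ℝ)..1, lengthWeight u t (c s) * ‖c' s‖ ≤ A →
      (∀ s ∈ Icc (0:ℝ) 1, ∫ r in (0:ℝ)..s, lengthWeight u t (c r) * ‖c' r‖ ≤ 1 →
        |timeDeriv (halfLog u) (c s, t)| ≤ B) →
      ∃ v m : ℂ, lengthWeight u t y * ‖v‖ = 1 ∧ ‖m‖ ≤ 1 ∧ ∀ δ, 0 ≤ δ → δ ≤ δ₀ →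
        ∃ L : Fin 4 → ℝ,
          (∀ i, Reach (lengthWeight u (t - δ ^ 2 / 4)) (timeSlice M (t - δ ^ 2 / 4)) x
            (y + δ * crossDir i * v) (L i)) ∧
          (∀ i, |L i - (∫ s in (0:ℝ)..1, lengthWeight u t (c s) * ‖c' s‖)
            - δ * (crossDir i * m).re| ≤ C * δ ^ 2) ∧
          ∑ i, L i ≤ 4 * (∫ s in (0:ℝ)..1, lengthWeight u t (c s) * ‖c' s‖)
            + δ ^ 2 * (2 + B) + C * δ ^ 3 := by
  obtain ⟨C, hC, δ₀, hδ₀, hδ₁, H⟩ := h.exists_length_element_bound hK hKM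
  refine ⟨C * A, by positivity, δ₀, hδ₀, hδ₁, fun t x y c c' hc hcK hl1 hlA hcB => ?_⟩
  obtain ⟨κ, v, hκc, hκe, hv, hvn⟩ := h.exists_parallel_unit_field hc
  have hω := h.continuousOn_lengthWeight t
  have hEc : ContinuousOn (fun s => lengthWeight u t (c s)) (Icc 0 1) :=
    hω.comp hc.continuous.continuousOn hc.mem
  set E : ℝ → ℝ := IccExtend zero_le_one (Set.domRestrict (Icc (0:ℝ) 1)
    fun s => lengthWeight u t (c s)) with hE
  have hEcont : Continuous E := hEc.domRestrict.Icc_extend'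
  have hEe : ∀ s ∈ Icc (0:ℝ) 1, E s = lengthWeight u t (c s) := fun s hs => by
    rw [hE, IccExtend_of_mem _ _ hs]
    rfl
  have hIe : ∀ s ∈ Icc (0:ℝ) 1, ∫ r in (0:ℝ)..s, E r * ‖c' r‖
      = ∫ r in (0:ℝ)..s, lengthWeight u t (c r) * ‖c' r‖ := fun s hs => by
    refine intervalIntegral.integral_congr fun r hr => ?_
    rw [uIcc_of_le hs.1] at hr
    simp only [hEe r ⟨hr.1, hr.2.trans hs.2⟩]
  have hvc : Continuous v := continuous_iff_continuousAt.2 fun s => (hv s).continuousAt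
  have hlc : Continuous fun s => E s * ‖c' s‖ := hEcont.mul hc.cont.norm
  have hl0 : ∀ s ∈ Icc (0:ℝ) 1, 0 ≤ E s * ‖c' s‖ := fun s hs => by
    rw [hEe s hs]
    exact mul_nonneg (h.lengthWeight_pos (hc.mem s hs)).le (norm_nonneg _)
  obtain ⟨f, g, hgc, hf, hf0, hf1, hfg⟩ := exists_length_cutoff hlc hl0
    (by rw [hIe 1 (by simp)]; exact hl1)
  have hfc : Continuous f := continuous_iff_continuousAt.2 fun s => (hf s).continuousAt
  set ℓ := ∫ s in (0:ℝ)..1, lengthWeight u t (c s) * ‖c' s‖ with hℓ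
  have hℓE : ∫ s in (0:ℝ)..1, E s * ‖c' s‖ = ℓ := hIe 1 (by simp)
  have hgl : ∫ s in (0:ℝ)..1, g s * (E s * ‖c' s‖) = 1 := by
    rw [intervalIntegral.integral_eq_sub_of_hasDerivAt (fun s _ => hf s)
      ((hgc.mul hlc).intervalIntegrable _ _), hf0, hf1, sub_zero]
  have hmc : Continuous fun s => g s * (E s : ℂ) ^ 2 * v s * (starRingEnd ℂ) (c' s) := by
    have := hc.cont
    have := Complex.continuous_conj.comp hc.cont
    have := Complex.continuous_ofReal.comp hgc
    have := Complex.continuous_ofReal.comp hEcont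
    simp only [Function.comp_def] at *
    fun_prop
  refine ⟨v 1, ∫ s in (0:ℝ)..1, g s * (E s : ℂ) ^ 2 * v s * (starRingEnd ℂ) (c' s), ?_, ?_, ?_⟩
  · rw [← hc.tgt]
    exact hvn 1 (by simp)
  · refine le_trans ?_ hgl.le
    refine (intervalIntegral.norm_integral_le_integral_norm zero_le_one).trans ?_
    refine intervalIntegral.integral_mono_on zero_le_one (hmc.norm.intervalIntegrable _ _)
      ((hgc.mul hlc).intervalIntegrable _ _) fun s hs => ?_
    have h1 := hvn s hs
    rw [← hEe s hs] at h1
    have hE0 : 0 ≤ E s := by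
      rw [hEe s hs]
      exact (h.lengthWeight_pos (hc.mem s hs)).le
    simp only [norm_mul, norm_pow, Complex.norm_real, Real.norm_eq_abs, RCLike.norm_conj,
      abs_of_nonneg hE0, abs_of_nonneg (hfg s hs).2.1.1]
    exact le_of_eq (by linear_combination (g s * E s * ‖c' s‖) * h1)
  intro δ hδ hδle
  set t' := t - δ ^ 2 / 4 with ht'
  set e' : Fin 4 → ℝ → ℂ := fun i s => c' s + δ * crossDir i * (g s * E s * ‖c' s‖ * v s
    - f s * κ s * c' s * v s) with he'
  set e : Fin 4 → ℝ → ℂ := fun i s => c s + δ * crossDir i * (f s * v s) with he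
  have hfgc : Continuous fun s => g s * (E s : ℂ) * ‖c' s‖ * v s - f s * κ s * c' s * v s := by
    have := hc.cont
    have := Complex.continuous_ofReal.comp hgc
    have := Complex.continuous_ofReal.comp hfc
    have := Complex.continuous_ofReal.comp hEcont
    have := Complex.continuous_ofReal.comp hc.cont.norm
    simp only [Function.comp_def] at *
    fun_prop
  have HH := fun s (hs : s ∈ Icc (0:ℝ) 1) => H (c s) t (hcK s hs) δ hδ hδle (v s) (c' s) (f s) (g s)
    (hvn s hs) (hfg s hs).1 (hfg s hs).2.1
  have hcurve : ∀ i, CurveIn (timeSlice M t') x (y + δ * crossDir i * v 1) (e i) (e' i) := fun i =>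
    { hasDeriv := fun s => by
        have k1 := (hf s).ofReal_comp.mul (hv s)
        have k2 := (hc.hasDeriv s).add (k1.const_mul ((δ : ℂ) * crossDir i))
        refine k2.congr_deriv ?_
        simp only [he']
        push_cast
        ring
      cont := by
        have := hc.cont
        simp only [he']
        fun_prop
      mem := fun s hs => (HH s hs).1 i
      src := by simp [he, hf0, hc.src]
      tgt := by simp [he, hf1, hc.tgt] }
  have hω' := h.continuousOn_lengthWeight t'
  have hint := fun i => (hcurve i).intervalIntegrable_speed hω' (a := 0) (b := 1) (by simp) (by simp)
  have hl : IntervalIntegrable (fun s => E s * ‖c' s‖) volume 0 1 := hlc.intervalIntegrable _ _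
  refine ⟨fun i => ∫ s in (0:ℝ)..1, lengthWeight u t' (e i s) * ‖e' i s‖,
    fun i => (hcurve i).reach, fun i => ?_, ?_⟩
  · have hm1 : IntervalIntegrable (fun s => δ * (crossDir i * (g s * (E s : ℂ) ^ 2 * v s
        * (starRingEnd ℂ) (c' s))).re) volume 0 1 :=
      (continuous_const.mul (Complex.continuous_re.comp
        (continuous_const.mul hmc))).intervalIntegrable _ _
    have hm2 : ∫ s in (0:ℝ)..1, δ * (crossDir i * (g s * (E s : ℂ) ^ 2 * v s
        * (starRingEnd ℂ) (c' s))).re = δ * (crossDir i * ∫ s in (0:ℝ)..1, g s * (E s : ℂ) ^ 2 * v s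
        * (starRingEnd ℂ) (c' s)).re := by
      rw [intervalIntegral.integral_const_mul,
        ← intervalIntegral.integral_const_mul (crossDir i)]
      congr 1
      exact Complex.reCLM.intervalIntegral_comp_comm
        ((continuous_const.mul hmc).intervalIntegrable _ _)
    rw [← hℓE, ← hm2, ← intervalIntegral.integral_sub (hint i) hl,
      ← intervalIntegral.integral_sub ((hint i).sub hl) hm1]
    refine (intervalIntegral.abs_integral_le_integral_abs zero_le_one).trans ?_
    have k := intervalIntegral.integral_mono_on zero_le_one
      (((hint i).sub hl).sub hm1).abs (hl.const_mul (C * δ ^ 2)) fun s hs => by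
        have := (HH s hs).2.1 i
        rw [← hκe s hs, ← hEe s hs] at this
        exact this
    refine k.trans ?_
    rw [intervalIntegral.integral_const_mul, hℓE]
    nlinarith [mul_nonneg hC (sq_nonneg δ)]
  · rw [← intervalIntegral.integral_finsetSum fun i _ => hint i]
    have hgi : IntervalIntegrable (fun s => g s * (E s * ‖c' s‖)) volume 0 1 :=
      (hgc.mul hlc).intervalIntegrable _ _
    have k := intervalIntegral.integral_mono_on zero_le_one
      (IntervalIntegrable.sum Finset.univ fun i _ => hint i)
      (((hl.const_mul (4 + C * δ ^ 3))).add (hgi.const_mul (δ ^ 2 * (2 + B)))) fun s hs => by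
        have k1 := (HH s hs).2.2
        rw [← hκe s hs, ← hEe s hs] at k1
        have k2 := (hfg s hs).2.2 B _ hB (fun hh => hcB s hs (by rwa [← hIe s hs]))
        have k3 := mul_le_mul_of_nonneg_left
          (mul_le_mul_of_nonneg_right k2 (hl0 s hs)) (sq_nonneg δ)
        have : ∑ i, lengthWeight u t' (e i s) * ‖e' i s‖ ≤ (4 + C * δ ^ 3) * (E s * ‖c' s‖)
            + δ ^ 2 * (2 + B) * (g s * (E s * ‖c' s‖)) := by
          refine k1.trans ?_
          linarith
        simpa using this
    simp only [Finset.sum_apply] at k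
    refine k.trans ?_
    rw [intervalIntegral.integral_add (hl.const_mul _) (hgi.const_mul _),
      intervalIntegral.integral_const_mul, intervalIntegral.integral_const_mul, hℓE, hgl]
    nlinarith [mul_nonneg hC (pow_nonneg hδ 3)]

end ConfRFS

theorem sum_re_crossDir_mul_sq (m : ℂ) : ∑ i, (crossDir i * m).re ^ 2 = 2 * ‖m‖ ^ 2 := by
  rw [← Complex.normSq_eq_norm_sq, Complex.normSq_apply]
  simp only [Fin.sum_univ_four, crossDir]
  simp
  ring

/-- Increments of a square along four increments with prescribed first order parts. -/
theorem exists_sq_increment_bound {C Y : ℝ} (hC : 0 ≤ C) (hY : 0 ≤ Y) :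
    ∃ C' : ℝ, 0 ≤ C' ∧ ∀ (y D δ : ℝ) (m : ℂ) (j : Fin 4 → ℝ), 0 ≤ y → y ≤ Y → 0 ≤ δ → δ ≤ 1 →
      ‖m‖ ≤ 1 → (∀ i, |j i - δ * (crossDir i * m).re| ≤ C * δ ^ 2) →
      ∑ i, j i ≤ δ ^ 2 * D + C * δ ^ 3 →
      ∑ i, (2 * y * j i + j i ^ 2) ≤ δ ^ 2 * (2 * y * D + 2) + C' * δ ^ 3 ∧
      (∀ i, |2 * y * j i + j i ^ 2| ≤ C' * δ) ∧
      ∑ i, (2 * y * j i + j i ^ 2) ^ 2 ≤ 8 * y ^ 2 * δ ^ 2 + C' * δ ^ 3 := by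
  refine ⟨2 * Y * (1 + C) + (1 + C) ^ 2 + 2 * Y * C + 4 * (2 * C + C ^ 2)
    + 16 * Y ^ 2 * (2 * C + C ^ 2) + 16 * Y * (1 + C) ^ 3 + 4 * (1 + C) ^ 4, by positivity,
    fun y D δ m j hy hyY hδ hδ1 hm hj hs => ?_⟩
  have ha : ∀ i, |(crossDir i * m).re| ≤ 1 := fun i =>
    (Complex.abs_re_le_norm _).trans (by rw [norm_mul, norm_crossDir, one_mul]; exact hm)
  have hd2 : δ ^ 2 ≤ δ := by nlinarith
  have hd3 : δ ^ 3 ≤ δ ^ 2 := by nlinarith [sq_nonneg δ]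
  have hd4 : δ ^ 4 ≤ δ ^ 3 := by nlinarith [pow_nonneg hδ 3]
  have hj1 : ∀ i, |j i| ≤ (1 + C) * δ := fun i => by
    have k1 := abs_add_le (j i - δ * (crossDir i * m).re) (δ * (crossDir i * m).re)
    rw [sub_add_cancel, abs_mul, abs_of_nonneg hδ] at k1
    nlinarith [hj i, ha i]
  have hj2 : ∀ i, j i ^ 2 ≤ δ ^ 2 * (crossDir i * m).re ^ 2 + (2 * C + C ^ 2) * δ ^ 3 := fun i => by
    set p := (crossDir i * m).re
    have k1 : (j i - δ * p) ^ 2 ≤ (C * δ ^ 2) ^ 2 := sq_le_sq' (abs_le.1 (hj i)).1 (abs_le.1 (hj i)).2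
    have k2 : p * (j i - δ * p) ≤ C * δ ^ 2 := by
      refine (le_abs_self _).trans ?_
      rw [abs_mul]
      nlinarith [hj i, ha i, abs_nonneg p, abs_nonneg (j i - δ * p)]
    nlinarith [mul_le_mul_of_nonneg_left k2 hδ, mul_nonneg (sq_nonneg C) (sub_nonneg.2 hd4)]
  have hS2 : ∑ i, j i ^ 2 ≤ 2 * δ ^ 2 + 4 * (2 * C + C ^ 2) * δ ^ 3 := by
    refine (Finset.sum_le_sum fun i _ => hj2 i).trans ?_
    rw [Finset.sum_add_distrib, ← Finset.mul_sum, sum_re_crossDir_mul_sq]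
    simp
    have : ‖m‖ ^ 2 ≤ 1 := by nlinarith [norm_nonneg m]
    nlinarith [mul_nonneg (sq_nonneg δ) (sub_nonneg.2 this)]
  have hp3 : 0 ≤ δ ^ 3 := pow_nonneg hδ 3
  have q0 : 0 ≤ 2 * C + C ^ 2 := by positivity
  have q1 : 0 ≤ Y * (1 + C) := by positivity
  have q2 : 0 ≤ (1 + C) ^ 2 := by positivity
  have q3 : 0 ≤ Y * C := by positivity
  have q4 : 0 ≤ Y ^ 2 * (2 * C + C ^ 2) := by positivity
  have q5 : 0 ≤ Y * (1 + C) ^ 3 := by positivity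
  have q6 : 0 ≤ (1 + C) ^ 4 := by positivity
  refine ⟨?_, fun i => ?_, ?_⟩
  · rw [Finset.sum_add_distrib, ← Finset.mul_sum]
    have k1 : 2 * y * ∑ i, j i ≤ 2 * y * (δ ^ 2 * D) + 2 * Y * C * δ ^ 3 := by
      nlinarith [mul_le_mul_of_nonneg_left hs hy,
        mul_nonneg (mul_nonneg hC hp3) (sub_nonneg.2 hyY)]
    nlinarith [mul_nonneg q1 hp3, mul_nonneg q2 hp3, mul_nonneg q4 hp3, mul_nonneg q5 hp3,
      mul_nonneg q6 hp3]
  · have k1 : |2 * y * j i + j i ^ 2| ≤ 2 * y * |j i| + |j i| ^ 2 := by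
      refine (abs_add_le _ _).trans ?_
      rw [abs_mul, abs_of_nonneg (by positivity : 0 ≤ 2 * y), abs_pow]
    have k2 : y * |j i| ≤ Y * ((1 + C) * δ) := mul_le_mul hyY (hj1 i) (abs_nonneg _) hY
    have k3 : |j i| ^ 2 ≤ ((1 + C) * δ) ^ 2 := pow_le_pow_left₀ (abs_nonneg _) (hj1 i) 2
    nlinarith [mul_nonneg q0 hδ, mul_nonneg q3 hδ, mul_nonneg q4 hδ, mul_nonneg q5 hδ,
      mul_nonneg q6 hδ, mul_nonneg q2 (sub_nonneg.2 hd2)]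
  · have k0 : ∀ i, (2 * y * j i + j i ^ 2) ^ 2 ≤ 4 * y ^ 2 * j i ^ 2
        + (4 * (Y * (1 + C) ^ 3) + (1 + C) ^ 4) * δ ^ 3 := fun i => by
      have k1 : |j i| ^ 3 ≤ ((1 + C) * δ) ^ 3 := pow_le_pow_left₀ (abs_nonneg _) (hj1 i) 3
      have k2 : |j i| ^ 4 ≤ ((1 + C) * δ) ^ 4 := pow_le_pow_left₀ (abs_nonneg _) (hj1 i) 4
      have k3 : y * |j i| ^ 3 ≤ Y * ((1 + C) * δ) ^ 3 := mul_le_mul hyY k1 (by positivity) hY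
      have k4 : j i ^ 3 ≤ |j i| ^ 3 := by rw [← abs_pow]; exact le_abs_self _
      have k5 : j i ^ 4 = |j i| ^ 4 := by rw [← abs_pow, abs_of_nonneg (by positivity)]
      have k6 := mul_le_mul_of_nonneg_left k4 hy
      rw [← k5] at k2
      nlinarith [mul_nonneg q6 (sub_nonneg.2 hd4)]
    refine (Finset.sum_le_sum fun i _ => k0 i).trans ?_
    rw [Finset.sum_add_distrib, ← Finset.mul_sum]
    simp
    have k7 := mul_le_mul_of_nonneg_left hS2 (sq_nonneg y)
    have k8 : y ^ 2 * (2 * C + C ^ 2) ≤ Y ^ 2 * (2 * C + C ^ 2) := by gcongr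
    nlinarith [mul_nonneg q1 hp3, mul_nonneg q2 hp3, mul_nonneg q0 hp3, mul_nonneg q3 hp3,
      mul_le_mul_of_nonneg_right k8 hp3]

namespace ConfRFS

variable {T : ℝ} {M : Set (ℂ × ℝ)} {u : ℂ → ℝ → ℝ}

/-- Short displacements along a Lipschitz worldline have comparable length. -/
theorem exists_reach_worldline (h : ConfRFS T M u) {γ : ℝ → ℂ} {a b Λ : ℝ}
    (hγ : ContinuousOn γ (Icc a b)) (hγM : ∀ t ∈ Icc a b, (γ t, t) ∈ M) (hΛ0 : 0 ≤ Λ)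
    (hΛ : ∀ t ∈ Icc a b, ∀ t' ∈ Icc a b, ‖γ t - γ t'‖ ≤ Λ * |t - t'|) :
    ∃ U : ℝ, 0 ≤ U ∧ ∃ τ₀ : ℝ, 0 < τ₀ ∧ ∀ t ∈ Icc a b, ∀ t' ∈ Icc a b, |t - t'| ≤ τ₀ →
      Reach (lengthWeight u t') (timeSlice M t') (γ t') (γ t) (U * |t - t'|) := by
  have hG : IsCompact ((fun t => (γ t, t)) '' Icc a b) :=
    isCompact_Icc.image_of_continuousOn (hγ.prodMk continuousOn_id)
  obtain ⟨r, hr, hrM⟩ := hG.exists_cthickening_subset_open h.opn (image_subset_iff.2 hγM)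
  obtain ⟨U, hU⟩ := (hG.cthickening (r := r)).exists_bound_of_continuousOn
    (h.continuousOn_sqrt.mono hrM)
  have hin : ∀ t ∈ Icc a b, ∀ z, ‖z - γ t‖ ≤ r →
      (z, t) ∈ cthickening r ((fun t => (γ t, t)) '' Icc a b) := fun t ht z hz =>
    mem_cthickening_of_dist_le _ (γ t, t) r _ ⟨t, ht, rfl⟩
      (by rw [Prod.dist_eq, dist_self, dist_eq_norm]; exact max_le hz hr.le)
  refine ⟨|U| * Λ, by positivity, r / (Λ + 1), by positivity, fun t ht t' ht' htt => ?_⟩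
  have hn : ‖γ t - γ t'‖ ≤ r := by
    refine (hΛ t ht t' ht').trans ?_
    rw [le_div_iff₀ (by positivity)] at htt
    nlinarith [abs_nonneg (t - t')]
  refine (reach_of_norm_sub_le (h.continuousOn_lengthWeight t') (r := r) (U := |U|)
    (fun z hz => hrM (hin t' ht' z (by rwa [mem_closedBall, dist_eq_norm] at hz)))
    (fun z hz => ?_) hn).mono ?_
  · exact (le_abs_self _).trans ((hU _ (hin t' ht' z hz)).trans (le_abs_self _))
  · rw [mul_assoc]
    exact mul_le_mul_of_nonneg_left (hΛ t ht t' ht') (abs_nonneg _)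

/-- Moving the end point of a curve slightly changes its length only slightly. -/
theorem exists_length_perturbation (h : ConfRFS T M u) {K : Set (ℂ × ℝ)} (hK : IsCompact K)
    (hKM : K ⊆ M) {A A' : ℝ} (hAA : A < A') :
    ∃ δ₀ : ℝ, 0 < δ₀ ∧ δ₀ ≤ 1 ∧ ∀ t x y c c',
      CurveIn (timeSlice M t) x y c c' → (∀ s ∈ Icc (0:ℝ) 1, (c s, t) ∈ K) →
      ∫ s in (0:ℝ)..1, lengthWeight u t (c s) * ‖c' s‖ ≤ A →
      ∀ v : ℂ, lengthWeight u t y * ‖v‖ = 1 → ∀ δ, 0 ≤ δ → δ ≤ δ₀ → ∀ i,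
        Reach (lengthWeight u (t - δ ^ 2 / 4)) (timeSlice M (t - δ ^ 2 / 4)) x
            (y + δ * crossDir i * v) A' := by
  have hw := h.contDiffOn_halfLog
  have h1 : ContDiffOn ℝ (⊤ : ℕ∞) (fderiv ℝ (halfLog u)) M := hw.fderiv_of_isOpen h.opn (by simp)
  obtain ⟨B, hB⟩ := hK.exists_bound_of_continuousOn
    (f := fun q : ℂ × ℝ => (lengthWeight u q.2 q.1)⁻¹)
    ((h.continuousOn_sqrt.mono hKM).inv₀ fun q hq => (h.lengthWeight_pos (hKM hq)).ne')
  obtain ⟨U, hU⟩ := hK.exists_bound_of_continuousOn (h.continuousOn_sqrt.mono hKM)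
  obtain ⟨G, hG⟩ := hK.exists_bound_of_continuousOn (f := fderiv ℝ (halfLog u))
    (h1.continuousOn.mono hKM)
  set R : ℝ := max 1 |B| with hR
  have hR1 : 1 ≤ R := le_max_left _ _
  obtain ⟨C, hC, δ₀, hδ₀, hδ₁, H⟩ := exists_cross_taylor_bound h.opn hw hK hKM hR1
  obtain ⟨P, hP, hHP⟩ : ∃ P : ℝ, 0 ≤ P ∧ ∀ z t, (z, t) ∈ K → ∀ δ, 0 ≤ δ → δ ≤ δ₀ → ∀ k : ℂ, ‖k‖ ≤ R →
      ∀ i, (z + δ * crossDir i * k, t - δ ^ 2 / 4) ∈ M ∧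
        lengthWeight u (t - δ ^ 2 / 4) (z + δ * crossDir i * k)
        ≤ lengthWeight u t z * Real.exp (P * δ) := by
    refine ⟨|G| * R + C, by positivity, fun z t hz δ hδ hδ' k hk i => ?_⟩
    obtain ⟨k1, k2, -⟩ := H z t hz δ hδ hδ' k hk
    refine ⟨k1 i, ?_⟩
    rw [← h.exp_halfLog (k1 i), ← h.exp_halfLog (hKM hz), ← Real.exp_add]
    refine Real.exp_le_exp.2 ?_
    have e1 := (abs_le.1 (k2 i)).2
    have e2 : (crossDir i * (spatialGrad (halfLog u) (z, t) * k)).re ≤ |G| * R := by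
      have e3 := fderiv_eq_spatialGrad (halfLog u) (z, t) (crossDir i * k) 0
      rw [zero_mul, add_zero] at e3
      rw [show crossDir i * (spatialGrad (halfLog u) (z, t) * k)
        = spatialGrad (halfLog u) (z, t) * (crossDir i * k) by ring, ← e3]
      refine (Real.le_norm_self _).trans ((ContinuousLinearMap.le_opNorm _ _).trans ?_)
      refine mul_le_mul ((hG _ hz).trans (le_abs_self _)) ?_ (norm_nonneg _) (abs_nonneg _)
      rw [Prod.norm_mk, norm_zero, norm_mul, norm_crossDir, one_mul]
      exact max_le hk (by linarith)
    have e4 : C * δ ^ 2 ≤ C * δ := by nlinarith [mul_nonneg hC hδ]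
    nlinarith
  have hlim : Tendsto (fun δ : ℝ => Real.exp (P * δ) * (A + |U| * R * δ)) (nhds 0) (nhds A) := by
    have : Continuous fun δ : ℝ => Real.exp (P * δ) * (A + |U| * R * δ) := by fun_prop
    simpa using this.tendsto 0
  obtain ⟨ε, hε, hεA⟩ := Metric.eventually_nhds_iff.1 (hlim.eventually (gt_mem_nhds hAA))
  refine ⟨min (ε / 2) δ₀, lt_min (by positivity) hδ₀, (min_le_right _ _).trans hδ₁,
    fun t x y c c' hc hcK hl v hv δ hδ hδ' i => ?_⟩
  have hyK : (y, t) ∈ K := hc.tgt ▸ hcK 1 (by simp)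
  have hvR : ‖v‖ ≤ R := by
    have e := h.lengthWeight_pos (hKM hyK)
    have e1 := hB _ hyK
    rw [Real.norm_of_nonneg (inv_nonneg.2 e.le)] at e1
    have : ‖v‖ = (lengthWeight u t y)⁻¹ := by field_simp; linarith
    rw [this]
    exact e1.trans ((le_abs_self _).trans (le_max_right _ _))
  have HH := fun s (hs : s ∈ Icc (0:ℝ) 1) => hHP (c s) t (hcK s hs) δ hδ
    (hδ'.trans (min_le_right _ _)) (s * v)
    (by rw [norm_mul, Complex.norm_real, Real.norm_of_nonneg hs.1]
        nlinarith [hs.2, norm_nonneg v]) i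
  have hcurve : CurveIn (timeSlice M (t - δ ^ 2 / 4)) x (y + δ * crossDir i * v)
      (fun s : ℝ => c s + δ * crossDir i * (s * v)) (fun s => c' s + δ * crossDir i * v) :=
    { hasDeriv := fun s => by
        have k1 : HasDerivAt (fun s : ℝ => (s : ℂ)) 1 s := Complex.ofRealCLM.hasDerivAt
        have k2 := (hc.hasDeriv s).add ((k1.mul_const v).const_mul ((δ : ℂ) * crossDir i))
        exact k2.congr_deriv (by ring)
      cont := by
        have := hc.cont
        fun_prop
      mem := fun s hs => (HH s hs).1
      src := by simp [hc.src]
      tgt := by simp [hc.tgt] }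
  have hint := hcurve.intervalIntegrable_speed (h.continuousOn_lengthWeight _)
    (a := 0) (b := 1) (by simp) (by simp)
  have hint' := hc.intervalIntegrable_speed (h.continuousOn_lengthWeight _)
    (a := 0) (b := 1) (by simp) (by simp)
  refine hcurve.reach.mono ?_
  have k := intervalIntegral.integral_mono_on zero_le_one hint
    ((hint'.add (intervalIntegrable_const (c := |U| * R * δ))).const_mul (Real.exp (P * δ)))
    fun s hs => by
      have e0 := (h.lengthWeight_pos (hc.mem s hs)).le
      have e1 : ‖c' s + δ * crossDir i * v‖ ≤ ‖c' s‖ + R * δ := by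
        refine (norm_add_le _ _).trans ?_
        rw [norm_mul, norm_mul, norm_crossDir, Complex.norm_real, Real.norm_of_nonneg hδ]
        nlinarith
      have e2 : lengthWeight u t (c s) ≤ |U| :=
        (le_abs_self _).trans ((hU _ (hcK s hs)).trans (le_abs_self _))
      calc _ ≤ lengthWeight u t (c s) * Real.exp (P * δ) * (‖c' s‖ + R * δ) :=
            mul_le_mul (HH s hs).2 e1 (norm_nonneg _) (by positivity)
        _ = Real.exp (P * δ) * (lengthWeight u t (c s) * ‖c' s‖
            + lengthWeight u t (c s) * (R * δ)) := by ring
        _ ≤ Real.exp (P * δ) * (lengthWeight u t (c s) * ‖c' s‖ + |U| * (R * δ)) := by gcongr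
        _ = _ := by simp; ring
  refine k.trans ?_
  rw [intervalIntegral.integral_const_mul, intervalIntegral.integral_add hint'
    intervalIntegrable_const, intervalIntegral.integral_const]
  have e := hεA (y := δ) (by
    rw [dist_zero_right, Real.norm_of_nonneg hδ]
    have := hδ'.trans (min_le_left _ _)
    linarith)
  refine le_trans ?_ e.le
  simp only [sub_zero, one_smul]
  gcongr

end ConfRFS

namespace ConfRFS

variable {T : ℝ} {M : Set (ℂ × ℝ)} {u : ℂ → ℝ → ℝ}

/-- Evolution of the squared truncated distance from a worldline under the random walk with
steps `crossDir`, run backwards in time. The constant `D` does not depend on the radius. -/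
theorem exists_distance_step (h : ConfRFS T M u) (hcomp : ConfRFSComplete T M u) {γ : ℝ → ℂ}
    {a b Λ : ℝ} (hγ : ContinuousOn γ (Icc a b)) (hγM : ∀ t ∈ Icc a b, (γ t, t) ∈ M) (hΛ0 : 0 ≤ Λ)
    (hΛ : ∀ t ∈ Icc a b, ∀ t' ∈ Icc a b, ‖γ t - γ t'‖ ≤ Λ * |t - t'|) :
    ∃ D : ℝ, 0 ≤ D ∧ ∀ A : ℝ, 0 ≤ A → ∃ C : ℝ, 0 ≤ C ∧ ∃ δ₀ : ℝ, 0 < δ₀ ∧ δ₀ ≤ 1 ∧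
      ∀ t ∈ Icc a b, ∀ x ℓ, Reach (lengthWeight u t) (timeSlice M t) (γ t) x ℓ → ℓ ≤ A →
      ∀ δ, 0 ≤ δ → δ ≤ δ₀ → a ≤ t - δ ^ 2 / 4 →
      ∃ v : ℂ, lengthWeight u t x * ‖v‖ = 1 ∧ ∃ ℓ' d : Fin 4 → ℝ,
        (∀ i, Reach (lengthWeight u (t - δ ^ 2 / 4)) (timeSlice M (t - δ ^ 2 / 4))
          (γ (t - δ ^ 2 / 4)) (x + δ * crossDir i * v) (ℓ' i)) ∧
        (∀ i, max (ℓ' i - 3) 0 ^ 2 ≤ max (ℓ - 3) 0 ^ 2 + d i) ∧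
        ∑ i, d i ≤ δ ^ 2 * (2 * max (ℓ - 3) 0 * D + 2) + C * δ ^ 3 ∧
        (∀ i, |d i| ≤ C * δ) ∧ ∑ i, d i ^ 2 ≤ 8 * max (ℓ - 3) 0 ^ 2 * δ ^ 2 + C * δ ^ 3 := by
  obtain ⟨U, hU, τ₀, hτ₀, hstep⟩ := h.exists_reach_worldline hγ hγM hΛ0 hΛ
  obtain ⟨K₁, hK₁, hKM₁, hm₁⟩ :=
    h.exists_compact_reach_worldline hcomp isCompact_Icc hγ hγM zero_le_one
  have hw1 : ContinuousOn (timeDeriv (halfLog u)) M := by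
    have : timeDeriv (halfLog u) = fun q => timeDeriv (logFactor u) q / 2 :=
      funext (timeDeriv_halfLog u)
    rw [this]
    exact h.contDiffOn_timeDeriv.continuousOn.div_const 2
  obtain ⟨B, hB⟩ := hK₁.exists_bound_of_continuousOn (hw1.mono hKM₁)
  refine ⟨2 + |B| + U, by positivity, fun A hA => ?_⟩
  obtain ⟨K, hK, hKM, hm⟩ := h.exists_compact_reach_worldline hcomp isCompact_Icc hγ hγM hA
  obtain ⟨C₁, hC₁, δ₁, hδ₁, hδ₁', H₁⟩ := h.exists_length_variation hK hKM hA (abs_nonneg B)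
  obtain ⟨δ₂, hδ₂, -, H₂⟩ := h.exists_length_perturbation hK hKM (A := 2) (A' := 5 / 2)
    (by norm_num)
  have hCU : 0 ≤ C₁ + U := by positivity
  obtain ⟨C, hC, H₃⟩ := exists_sq_increment_bound hCU hA
  set δ₀ : ℝ := min (min δ₁ δ₂) (min τ₀ (1 / (U + 1))) with hδ₀
  refine ⟨C, hC, δ₀, by positivity, ((min_le_left _ _).trans (min_le_left _ _)).trans hδ₁',
    fun t ht x ℓ hr hℓA δ hδ hδle hat => ?_⟩
  have d1 : δ ≤ δ₁ := hδle.trans ((min_le_left _ _).trans (min_le_left _ _))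
  have d2 : δ ≤ δ₂ := hδle.trans ((min_le_left _ _).trans (min_le_right _ _))
  have d3 : δ ≤ τ₀ := hδle.trans ((min_le_right _ _).trans (min_le_left _ _))
  have d4 : δ ≤ 1 / (U + 1) := hδle.trans ((min_le_right _ _).trans (min_le_right _ _))
  have hδ1 : δ ≤ 1 := d1.trans hδ₁'
  have hωc := h.continuousOn_lengthWeight t
  have hω0 : ∀ z ∈ timeSlice M t, 0 ≤ lengthWeight u t z := fun z hz => (h.lengthWeight_pos hz).le
  have ht' : t - δ ^ 2 / 4 ∈ Icc a b := ⟨hat, by nlinarith [ht.2, sq_nonneg δ]⟩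
  have habs : |t - (t - δ ^ 2 / 4)| = δ ^ 2 / 4 := by
    rw [sub_sub_cancel, abs_of_nonneg (by positivity)]
  have hseg := hstep t ht _ ht' (by rw [habs]; nlinarith)
  rw [habs] at hseg
  set t' := t - δ ^ 2 / 4 with htdef
  have hωc' := h.continuousOn_lengthWeight t'
  obtain ⟨c, c', hc, hl⟩ := hr
  set L := ∫ s in (0:ℝ)..1, lengthWeight u t (c s) * ‖c' s‖ with hL
  have hsub : ∀ s ∈ Icc (0:ℝ) 1, Reach (lengthWeight u t) (timeSlice M t) (γ t) (c s)
      (∫ r in (0:ℝ)..s, lengthWeight u t (c r) * ‖c' r‖) := fun s hs => by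
    have := hc.reach_subcurve (ω := lengthWeight u t) le_rfl hs.1 hs.2
    rwa [hc.src] at this
  have hcK : ∀ s ∈ Icc (0:ℝ) 1, (c s, t) ∈ K := fun s hs => hm t ht _ ((hsub s hs).mono
    ((hc.length_subcurve_le hωc hω0 le_rfl hs.1 hs.2).trans (hl.trans hℓA)))
  have hxΩ : x ∈ timeSlice M t := hc.tgt ▸ hc.mem 1 (by simp)
  have hy0 : 0 ≤ max (ℓ - 3) 0 := le_max_right _ _
  have hyA : max (ℓ - 3) 0 ≤ A := max_le (by linarith) hA
  rcases le_or_gt 2 L with hL2 | hL2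
  · obtain ⟨v, m, hv, hm1, HL⟩ := H₁ t (γ t) x c c' hc hcK (by linarith) (hl.trans hℓA)
      fun s hs hs1 => (hB _ (hm₁ t ht _ ((hsub s hs).mono hs1))).trans (le_abs_self B)
    obtain ⟨L', hL'r, hL'1, hL's⟩ := HL δ hδ d1
    set j : Fin 4 → ℝ := fun i => L' i - L + U * (δ ^ 2 / 4) with hj
    have hp3 : 0 ≤ δ ^ 3 := pow_nonneg hδ 3
    obtain ⟨b1, b2, b3⟩ := H₃ (max (ℓ - 3) 0) (2 + |B| + U) δ m j hy0 hyA hδ hδ1 hm1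
      (fun i => by
        have e : j i - δ * (crossDir i * m).re
            = (L' i - L - δ * (crossDir i * m).re) + U * (δ ^ 2 / 4) := by rw [hj]; ring
        rw [e]
        refine (abs_add_le _ _).trans ?_
        rw [abs_of_nonneg (by positivity : 0 ≤ U * (δ ^ 2 / 4))]
        nlinarith [hL'1 i, mul_nonneg hU (sq_nonneg δ)])
      (by
        simp only [hj, Finset.sum_add_distrib, Finset.sum_sub_distrib]
        simp
        nlinarith [mul_nonneg hU hp3])
    refine ⟨v, hv, fun i => ℓ + j i, fun i => 2 * max (ℓ - 3) 0 * j i + j i ^ 2,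
      fun i => (hseg.trans hωc' (hL'r i)).mono ?_, fun i => ?_, b1, b2, b3⟩
    · simp only [hj]
      linarith
    · have e : max (ℓ - 3) 0 ^ 2 + (2 * max (ℓ - 3) 0 * j i + j i ^ 2)
          = (max (ℓ - 3) 0 + j i) ^ 2 := by ring
      rw [e]
      rcases le_total (ℓ + j i - 3) 0 with hn | hn
      · rw [max_eq_right hn]
        nlinarith [sq_nonneg (max (ℓ - 3) 0 + j i)]
      · rw [max_eq_left hn]
        exact pow_le_pow_left₀ hn (by linarith [le_max_left (ℓ - 3) 0]) 2
  · have hE := h.lengthWeight_pos hxΩ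
    have hv : lengthWeight u t x * ‖(((lengthWeight u t x)⁻¹ : ℝ) : ℂ)‖ = 1 := by
      rw [Complex.norm_real, Real.norm_of_nonneg (inv_nonneg.2 hE.le)]
      field_simp
    refine ⟨_, hv, fun _ => 3, fun _ => 0, fun i => (hseg.trans hωc'
      (H₂ t (γ t) x c c' hc hcK hL2.le _ hv δ hδ d2 i)).mono ?_, fun i => ?_, ?_, fun i => ?_, ?_⟩
    · rw [le_div_iff₀ (by positivity)] at d4
      nlinarith [mul_nonneg hU hδ]
    · simp
    · simp
      positivity
    · simp
      positivity
    · simp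
      positivity

end ConfRFS

theorem one_div_sub_sq_le {p d : ℝ} (hp : 0 < p) (hd : |d| ≤ p / 2) :
    1 / (p - d) ^ 2 ≤ 1 / p ^ 2 + 2 * d / p ^ 3 + 3 * d ^ 2 / p ^ 4 + 16 * |d| ^ 3 / p ^ 5 := by
  have h1 := (abs_le.1 hd).2
  have e : 1 / p ^ 2 + 2 * d / p ^ 3 + 3 * d ^ 2 / p ^ 4 + 16 * |d| ^ 3 / p ^ 5
      = (p ^ 3 + 2 * d * p ^ 2 + 3 * d ^ 2 * p + 16 * |d| ^ 3) / p ^ 5 := by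
    field_simp
  rw [e, div_le_div_iff₀ (pow_pos (by linarith) 2) (by positivity)]
  have h2 : p ^ 2 / 4 ≤ (p - d) ^ 2 := by nlinarith
  have h3 : d ^ 3 ≤ |d| ^ 3 := by rw [← abs_pow]; exact le_abs_self _
  have h4 : 0 ≤ |d| ^ 3 := by positivity
  nlinarith [mul_le_mul_of_nonneg_left h2 h4, mul_le_mul_of_nonneg_left h3 (sq_nonneg p),
    mul_nonneg hp.le (by positivity : 0 ≤ d ^ 4)]

theorem one_div_sub_le {τ e : ℝ} (hτ : 0 < τ) (he0 : 0 ≤ e) (he : e ≤ τ / 2) :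
    1 / (τ - e) ≤ 1 / τ + e / τ ^ 2 + 2 * e ^ 2 / τ ^ 3 := by
  have h : 1 / τ + e / τ ^ 2 + 2 * e ^ 2 / τ ^ 3 = (τ ^ 2 + e * τ + 2 * e ^ 2) / τ ^ 3 := by
    field_simp
  rw [h, div_le_div_iff₀ (by linarith) (by positivity)]
  nlinarith [mul_nonneg (sq_nonneg e) (by linarith : 0 ≤ τ - 2 * e)]

/-- The barrier `B / (A² - ρ)²` along increments of `ρ`. -/
theorem sum_barrier_le {B C D d₀ p δ y : ℝ} {d : Fin 4 → ℝ} (hB : 0 ≤ B) (hC : 0 ≤ C)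
    (hd₀ : 0 < d₀) (hp : d₀ ≤ p) (hδ : 0 ≤ δ) (hd : ∀ i, |d i| ≤ C * δ) (hCδ : C * δ ≤ d₀ / 2)
    (h1 : ∑ i, d i ≤ δ ^ 2 * D + C * δ ^ 3) (h2 : ∑ i, d i ^ 2 ≤ 8 * y ^ 2 * δ ^ 2 + C * δ ^ 3) :
    ∑ i, B / (p - d i) ^ 2 ≤ 4 * (B / p ^ 2) + δ ^ 2 * (B * (2 * D / p ^ 3 + 24 * y ^ 2 / p ^ 4))
      + B * (2 * C / d₀ ^ 3 + 3 * C / d₀ ^ 4 + 64 * C ^ 3 / d₀ ^ 5) * δ ^ 3 := by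
  have hp0 : 0 < p := hd₀.trans_le hp
  have hp3 : 0 ≤ δ ^ 3 := pow_nonneg hδ 3
  have k : ∀ i, B / (p - d i) ^ 2 ≤ B / p ^ 2 + 2 * B / p ^ 3 * d i + 3 * B / p ^ 4 * d i ^ 2
      + 16 * B / d₀ ^ 5 * (C ^ 3 * δ ^ 3) := fun i => by
    have e1 := mul_le_mul_of_nonneg_left (one_div_sub_sq_le hp0 (d := d i)
      ((hd i).trans (hCδ.trans (by linarith)))) hB
    have e2 : 16 * |d i| ^ 3 / p ^ 5 ≤ 16 * (C * δ) ^ 3 / d₀ ^ 5 := by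
      have := hd i
      gcongr
    calc B / (p - d i) ^ 2 = B * (1 / (p - d i) ^ 2) := by ring
      _ ≤ B * (1 / p ^ 2 + 2 * d i / p ^ 3 + 3 * d i ^ 2 / p ^ 4 + 16 * (C * δ) ^ 3 / d₀ ^ 5) :=
        e1.trans (by gcongr)
      _ = _ := by ring
  refine (Finset.sum_le_sum fun i _ => k i).trans ?_
  simp only [Finset.sum_add_distrib, ← Finset.mul_sum]
  simp only [Finset.sum_const, Finset.card_univ, Fintype.card_fin, nsmul_eq_mul]
  have k1 : 2 * B / p ^ 3 * ∑ i, d i ≤ 2 * B / p ^ 3 * (δ ^ 2 * D + C * δ ^ 3) := by gcongr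
  have k2 : 3 * B / p ^ 4 * ∑ i, d i ^ 2 ≤ 3 * B / p ^ 4 * (8 * y ^ 2 * δ ^ 2 + C * δ ^ 3) := by
    gcongr
  have k3 : 2 * B / p ^ 3 * (C * δ ^ 3) ≤ 2 * B / d₀ ^ 3 * (C * δ ^ 3) := by gcongr
  have k4 : 3 * B / p ^ 4 * (C * δ ^ 3) ≤ 3 * B / d₀ ^ 4 * (C * δ ^ 3) := by gcongr
  push_cast
  have e1 : δ ^ 2 * (B * (2 * D / p ^ 3 + 24 * y ^ 2 / p ^ 4))
      = 2 * B / p ^ 3 * (δ ^ 2 * D) + 3 * B / p ^ 4 * (8 * y ^ 2 * δ ^ 2) := by ring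
  have e2 : B * (2 * C / d₀ ^ 3 + 3 * C / d₀ ^ 4 + 64 * C ^ 3 / d₀ ^ 5) * δ ^ 3
      = 2 * B / d₀ ^ 3 * (C * δ ^ 3) + 3 * B / d₀ ^ 4 * (C * δ ^ 3)
        + 4 * (16 * B / d₀ ^ 5 * (C ^ 3 * δ ^ 3)) := by ring
  rw [e1, e2]
  linarith

/-- The barrier is a strict supersolution of `N_t = Δ N + N²`. -/
theorem barrier_supersolution {A B D N p τ y : ℝ} (hA : 0 < A) (hD : 0 ≤ D)
    (hB : B = 4 * A ^ 3 * D + 28 * A ^ 2 + 1) (hp : 0 < p) (hpA : p ≤ A ^ 2) (hy : 0 ≤ y)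
    (hyA : y ≤ A) (hτ : 0 < τ) (hN : 1 / τ + B / p ^ 2 ≤ N) :
    1 / τ ^ 2 + B * (2 * (2 * y * D + 2) / p ^ 3 + 24 * y ^ 2 / p ^ 4) + B / A ^ 8 ≤ N ^ 2 := by
  have hB0 : 0 < B := by rw [hB]; positivity
  have h1 : (1 / τ + B / p ^ 2) ^ 2 ≤ N ^ 2 := pow_le_pow_left₀ (by positivity) hN 2
  have h2 : 1 / τ ^ 2 + B ^ 2 / p ^ 4 ≤ (1 / τ + B / p ^ 2) ^ 2 := by
    have : 0 ≤ 1 / τ * (B / p ^ 2) := by positivity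
    have e : (1 / τ + B / p ^ 2) ^ 2 = 1 / τ ^ 2 + B ^ 2 / p ^ 4 + 2 * (1 / τ * (B / p ^ 2)) := by
      field_simp
      ring
    linarith
  have h3 : p * (2 * (2 * y * D + 2)) + 24 * y ^ 2 + 1 ≤ B := by
    have q1 : p * y ≤ A ^ 2 * A := mul_le_mul hpA hyA hy (by positivity)
    have q2 : y ^ 2 ≤ A ^ 2 := pow_le_pow_left₀ hy hyA 2
    rw [hB]
    nlinarith [mul_le_mul_of_nonneg_right q1 hD]
  have h4 : B / A ^ 8 ≤ B / p ^ 4 := by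
    have : p ^ 4 ≤ A ^ 8 := by
      calc p ^ 4 ≤ (A ^ 2) ^ 4 := pow_le_pow_left₀ hp.le hpA 4
        _ = A ^ 8 := by ring
    gcongr
  have h5 : B * (2 * (2 * y * D + 2) / p ^ 3 + 24 * y ^ 2 / p ^ 4) + B / p ^ 4
      = B / p ^ 4 * (p * (2 * (2 * y * D + 2)) + 24 * y ^ 2 + 1) := by
    field_simp
  have h6 : B / p ^ 4 * (p * (2 * (2 * y * D + 2)) + 24 * y ^ 2 + 1) ≤ B / p ^ 4 * B := by gcongr
  have h7 : B / p ^ 4 * B = B ^ 2 / p ^ 4 := by ring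
  linarith

namespace ConfRFS

variable {T : ℝ} {M : Set (ℂ × ℝ)} {u : ℂ → ℝ → ℝ}

/-- The increase of `N = ∂ₜ log u` under the random walk, run backwards in time. -/
theorem exists_timeDeriv_step (h : ConfRFS T M u) {K : Set (ℂ × ℝ)} (hK : IsCompact K)
    (hKM : K ⊆ M) :
    ∃ C : ℝ, 0 ≤ C ∧ ∃ δ₀ : ℝ, 0 < δ₀ ∧ ∀ z t, (z, t) ∈ K → ∀ δ, 0 ≤ δ → δ ≤ δ₀ →
      ∀ v : ℂ, lengthWeight u t z * ‖v‖ = 1 →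
      4 * timeDeriv (logFactor u) (z, t) + δ ^ 2 * timeDeriv (logFactor u) (z, t) ^ 2 - C * δ ^ 3
        ≤ ∑ i, timeDeriv (logFactor u) (z + δ * crossDir i * v, t - δ ^ 2 / 4) := by
  obtain ⟨B, hB⟩ := hK.exists_bound_of_continuousOn
    (f := fun q : ℂ × ℝ => (lengthWeight u q.2 q.1)⁻¹)
    ((h.continuousOn_sqrt.mono hKM).inv₀ fun q hq => (h.lengthWeight_pos (hKM hq)).ne')
  obtain ⟨C, hC, δ₀, hδ₀, -, H⟩ := exists_cross_taylor_bound h.opn h.contDiffOn_timeDeriv hK hKM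
    (le_max_left 1 |B|)
  refine ⟨C, hC, δ₀, hδ₀, fun z t hz δ hδ hδ' v hv => ?_⟩
  have e := h.lengthWeight_pos (hKM hz)
  have hve : ‖v‖ = (lengthWeight u t z)⁻¹ := by field_simp; linarith
  have hvR : ‖v‖ ≤ max 1 |B| := by
    have e1 := hB _ hz
    rw [Real.norm_of_nonneg (inv_nonneg.2 e.le)] at e1
    rw [hve]
    exact e1.trans ((le_abs_self _).trans (le_max_right _ _))
  have k := (abs_le.1 (H z t hz δ hδ hδ' v hvR).2.2).1
  have hu : ‖v‖ ^ 2 * Real.exp (logFactor u (z, t)) = 1 := by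
    rw [h.exp_logFactor (hKM hz), ← Real.sq_sqrt (h.pos _ (hKM hz)).le]
    change ‖v‖ ^ 2 * lengthWeight u t z ^ 2 = 1
    rw [← mul_pow, mul_comm, hv, one_pow]
  have hlap := h.exp_mul_timeDeriv_timeDeriv (hKM hz)
  have e2 : ‖v‖ ^ 2 * spatialLap (timeDeriv (logFactor u)) (z, t)
      - timeDeriv (timeDeriv (logFactor u)) (z, t) = timeDeriv (logFactor u) (z, t) ^ 2 := by
    rw [← hlap]
    linear_combination (timeDeriv (timeDeriv (logFactor u)) (z, t)
      + timeDeriv (logFactor u) (z, t) ^ 2) * hu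
  rw [e2] at k
  linarith

set_option maxHeartbeats 1000000 in
/-- Interior estimate around a Lipschitz worldline. The constant `D` does not depend on `A`. -/
theorem exists_timeDeriv_lt_barrier (h : ConfRFS T M u) (hcomp : ConfRFSComplete T M u)
    {γ : ℝ → ℂ} {a b Λ : ℝ} (hγ : ContinuousOn γ (Icc a b)) (hγM : ∀ t ∈ Icc a b, (γ t, t) ∈ M)
    (hΛ0 : 0 ≤ Λ) (hΛ : ∀ t ∈ Icc a b, ∀ t' ∈ Icc a b, ‖γ t - γ t'‖ ≤ Λ * |t - t'|) :
    ∃ D : ℝ, 0 ≤ D ∧ ∀ A : ℝ, 0 < A → ∀ t ∈ Ioc a b, ∀ x ℓ,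
      Reach (lengthWeight u t) (timeSlice M t) (γ t) x ℓ → max (ℓ - 3) 0 < A →
      timeDeriv (logFactor u) (x, t) < 1 / (t - a)
        + (4 * A ^ 3 * D + 28 * A ^ 2 + 1) / (A ^ 2 - max (ℓ - 3) 0 ^ 2) ^ 2 := by
  obtain ⟨D, hD, H⟩ := h.exists_distance_step hcomp hγ hγM hΛ0 hΛ
  refine ⟨D, hD, fun A hA => ?_⟩
  obtain ⟨K, hK, hKM, hm⟩ := h.exists_compact_reach_worldline hcomp isCompact_Icc hγ hγM
    (A := A + 3) (by positivity)
  obtain ⟨C, hC, δ₁, hδ₁, hδ₁', H⟩ := H (A + 3) (by positivity)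
  obtain ⟨C₂, hC₂, δ₂, hδ₂, H₂⟩ := h.exists_timeDeriv_step hK hKM
  obtain ⟨Q', hQ'⟩ := hK.exists_bound_of_continuousOn (h.contDiffOn_timeDeriv.continuousOn.mono hKM)
  obtain ⟨Q, hQ0, hQ⟩ : ∃ Q : ℝ, 0 < Q ∧ ∀ q ∈ K, timeDeriv (logFactor u) q ≤ Q :=
    ⟨|Q'| + 1, by positivity, fun q hq => (Real.le_norm_self _).trans ((hQ' q hq).trans
      ((le_abs_self Q').trans (by linarith)))⟩
  set B := 4 * A ^ 3 * D + 28 * A ^ 2 + 1 with hB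
  have hB0 : 0 < B := by positivity
  set N := timeDeriv (logFactor u) with hN
  set d₀ := B / (Q * A ^ 2) with hd₀
  have hd₀0 : 0 < d₀ := by positivity
  set C₃ := B * (2 * C / d₀ ^ 3 + 3 * C / d₀ ^ 4 + 64 * C ^ 3 / d₀ ^ 5) + Q ^ 3 + C₂ with hC₃
  have hC₃0 : 0 ≤ C₃ := by positivity
  set κ := B / A ^ 8 with hκ
  have hκ0 : 0 < κ := by positivity
  obtain ⟨δ, hδ, l1, l2, l3, l4, l5⟩ : ∃ δ : ℝ, 0 < δ ∧ δ ≤ δ₁ ∧ δ ≤ δ₂ ∧ C * δ ≤ d₀ / 4 ∧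
      δ * Q ≤ 1 ∧ C₃ * δ ≤ κ / 2 := by
    refine ⟨min (min δ₁ δ₂) (min (d₀ / (4 * (C + 1))) (min (1 / Q) (κ / (2 * (C₃ + 1))))),
      by positivity, (min_le_left _ _).trans (min_le_left _ _),
      (min_le_left _ _).trans (min_le_right _ _), ?_, ?_, ?_⟩ <;>
    set δ := min (min δ₁ δ₂) (min (d₀ / (4 * (C + 1))) (min (1 / Q) (κ / (2 * (C₃ + 1))))) with hδ
    · have k : δ ≤ d₀ / (4 * (C + 1)) := (min_le_right _ _).trans (min_le_left _ _)
      have k0 : 0 < δ := by positivity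
      rw [le_div_iff₀ (by positivity)] at k
      linarith
    · have k : δ ≤ 1 / Q := (min_le_right _ _).trans ((min_le_right _ _).trans (min_le_left _ _))
      rwa [le_div_iff₀ hQ0] at k
    · have k : δ ≤ κ / (2 * (C₃ + 1)) :=
        (min_le_right _ _).trans ((min_le_right _ _).trans (min_le_right _ _))
      have k0 : 0 < δ := by positivity
      rw [le_div_iff₀ (by positivity)] at k
      linarith
  have hδ1 : δ ≤ 1 := l1.trans hδ₁'
  have hδδ : δ ^ 2 ≤ δ := by nlinarith
  have hδ4 : δ ^ 4 ≤ δ ^ 3 := by nlinarith [pow_pos hδ 3]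
  have hstep : ∀ t ∈ Ioc a b, ∀ x ℓ, Reach (lengthWeight u t) (timeSlice M t) (γ t) x ℓ →
      max (ℓ - 3) 0 < A → 0 ≤ N (x, t) - (1 / (t - a) + B / (A ^ 2 - max (ℓ - 3) 0 ^ 2) ^ 2) →
      ∃ t' ∈ Ioc a b, ∃ x' ℓ', Reach (lengthWeight u t') (timeSlice M t') (γ t') x' ℓ' ∧
        max (ℓ' - 3) 0 < A ∧
        N (x, t) - (1 / (t - a) + B / (A ^ 2 - max (ℓ - 3) 0 ^ 2) ^ 2) + κ * δ ^ 2 / 8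
          ≤ N (x', t') - (1 / (t' - a) + B / (A ^ 2 - max (ℓ' - 3) 0 ^ 2) ^ 2) := by
    intro t ht x ℓ hr hℓ hΦ
    have htI : t ∈ Icc a b := ⟨ht.1.le, ht.2⟩
    have hℓA : ℓ ≤ A + 3 := by linarith [le_max_left (ℓ - 3) 0]
    have hxK : (x, t) ∈ K := hm t htI x (hr.mono hℓA)
    set y := max (ℓ - 3) 0 with hy
    have hy0 : 0 ≤ y := le_max_right _ _
    set p := A ^ 2 - y ^ 2 with hp
    have hp0 : 0 < p := by
      have : y ^ 2 < A ^ 2 := pow_lt_pow_left₀ hℓ hy0 (by norm_num)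
      linarith
    have hpA : p ≤ A ^ 2 := sub_le_self _ (sq_nonneg y)
    have hτ : 0 < t - a := by linarith [ht.1]
    have hψ0 : 0 < B / p ^ 2 := by positivity
    have hτ0 : 0 < 1 / (t - a) := by positivity
    have hNQ := hQ _ hxK
    have hpd : d₀ ≤ p := by
      have k : B / p ^ 2 ≤ Q := by linarith
      rw [div_le_iff₀ (by positivity)] at k
      rw [hd₀, div_le_iff₀ (by positivity)]
      linarith [mul_le_mul_of_nonneg_left hpA (mul_nonneg hQ0.le hp0.le)]
    have hτQ : 1 ≤ Q * (t - a) := by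
      have k : 1 / (t - a) ≤ Q := by linarith
      rwa [div_le_iff₀ hτ] at k
    have hδτ : δ ≤ t - a := le_of_mul_le_mul_left (by linarith : Q * δ ≤ Q * (t - a)) hQ0
    have hδτ2 : δ ^ 2 / 4 ≤ (t - a) / 4 := by linarith
    obtain ⟨v, hv, ℓ', d, r1, r2, r3, r4, r5⟩ := H t htI x ℓ hr hℓA δ hδ.le l1 (by linarith)
    have kN := H₂ x t hxK δ hδ.le l2 v hv
    have kψ := sum_barrier_le hB0.le hC hd₀0 hpd hδ.le r4 (by linarith) r3 r5
    have kS := barrier_supersolution hA hD hB hp0 hpA hy0 hℓ.le hτ (N := N (x, t)) (by linarith)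
    rw [← hκ] at kS
    rw [← hy] at kψ
    have kτ := one_div_sub_le hτ (e := δ ^ 2 / 4) (by positivity) (by linarith)
    have hpi : ∀ i, 0 < p - d i := fun i => by
      have := (abs_le.1 ((r4 i).trans l3)).2
      linarith
    have hρ : ∀ i, p - d i ≤ A ^ 2 - max (ℓ' i - 3) 0 ^ 2 := fun i => by
      have := r2 i
      linarith
    have hψi : ∀ i, B / (A ^ 2 - max (ℓ' i - 3) 0 ^ 2) ^ 2 ≤ B / (p - d i) ^ 2 := fun i => by
      have := hpi i
      have := hρ i
      gcongr
    by_contra hcon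
    push Not at hcon
    have hlt : ∀ i, N (x + δ * crossDir i * v, t - δ ^ 2 / 4)
        - (1 / (t - δ ^ 2 / 4 - a) + B / (p - d i) ^ 2)
        < N (x, t) - (1 / (t - a) + B / p ^ 2) + κ * δ ^ 2 / 8 := fun i => by
      have := hcon (t - δ ^ 2 / 4) ⟨by linarith, by linarith [ht.2, sq_nonneg δ]⟩ _ (ℓ' i) (r1 i)
        (lt_of_pow_lt_pow_left₀ 2 hA.le (by linarith [hpi i, hρ i]))
      linarith [hψi i]
    have hsum := Finset.sum_lt_sum_of_nonempty (s := Finset.univ) ⟨(0 : Fin 4), by simp⟩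
      fun i _ => hlt i
    simp only [Finset.sum_sub_distrib, Finset.sum_add_distrib, Finset.sum_const, Finset.card_univ,
      Fintype.card_fin, nsmul_eq_mul] at hsum
    push_cast at hsum
    have eτ : t - δ ^ 2 / 4 - a = t - a - δ ^ 2 / 4 := by ring
    rw [eτ] at hsum
    have hτ3 : 2 * (δ ^ 2 / 4) ^ 2 / (t - a) ^ 3 ≤ Q ^ 3 * δ ^ 3 / 8 := by
      rw [div_le_iff₀ (by positivity)]
      have k1 : 1 ≤ (Q * (t - a)) ^ 3 := one_le_pow₀ hτQ
      linarith [mul_le_mul_of_nonneg_left k1 (pow_nonneg hδ.le 3)]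
    have hτ2 : δ ^ 2 / 4 / (t - a) ^ 2 = δ ^ 2 * (1 / (t - a) ^ 2) / 4 := by ring
    have k6 := mul_le_mul_of_nonneg_left kS (sq_nonneg δ)
    have k7 : C₃ * δ ^ 3 ≤ κ / 2 * δ ^ 2 := by linarith [mul_le_mul_of_nonneg_right l5 (sq_nonneg δ)]
    have k8 : 0 ≤ Q ^ 3 * δ ^ 3 := by positivity
    have k9 : C₃ * δ ^ 3 = B * (2 * C / d₀ ^ 3 + 3 * C / d₀ ^ 4 + 64 * C ^ 3 / d₀ ^ 5) * δ ^ 3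
      + Q ^ 3 * δ ^ 3 + C₂ * δ ^ 3 := by rw [hC₃]; ring
    have k10 : 0 < κ * δ ^ 2 := by positivity
    rw [hτ2] at kτ
    rw [mul_add, mul_add] at k6
    linarith
  intro t ht x ℓ hr hℓ
  by_contra hcon
  push Not at hcon
  have hiter : ∀ n : ℕ, ∃ t' ∈ Ioc a b, ∃ x' ℓ',
      Reach (lengthWeight u t') (timeSlice M t') (γ t') x' ℓ' ∧ max (ℓ' - 3) 0 < A ∧
        n * (κ * δ ^ 2 / 8)
          ≤ N (x', t') - (1 / (t' - a) + B / (A ^ 2 - max (ℓ' - 3) 0 ^ 2) ^ 2) := by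
    intro n
    induction n with
    | zero => exact ⟨t, ht, x, ℓ, hr, hℓ, by simpa using hcon⟩
    | succ n ih =>
      obtain ⟨t₁, ht₁, x₁, ℓ₁, hr₁, hℓ₁, hΦ₁⟩ := ih
      obtain ⟨t₂, ht₂, x₂, ℓ₂, hr₂, hℓ₂, hΦ₂⟩ := hstep t₁ ht₁ x₁ ℓ₁ hr₁ hℓ₁
        (le_trans (by positivity) hΦ₁)
      refine ⟨t₂, ht₂, x₂, ℓ₂, hr₂, hℓ₂, ?_⟩
      push_cast
      linarith
  obtain ⟨n, hn⟩ := exists_nat_gt (Q / (κ * δ ^ 2 / 8))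
  obtain ⟨t₁, ht₁, x₁, ℓ₁, hr₁, hℓ₁, hΦ₁⟩ := hiter n
  have hxK : (x₁, t₁) ∈ K := hm t₁ ⟨ht₁.1.le, ht₁.2⟩ x₁
    (hr₁.mono (by linarith [le_max_left (ℓ₁ - 3) 0]))
  rw [div_lt_iff₀ (by positivity)] at hn
  have h1 := hQ _ hxK
  have h2 : 0 < t₁ - a := by linarith [ht₁.1]
  have h3 : 0 ≤ 1 / (t₁ - a) := by positivity
  have h4 : 0 ≤ B / (A ^ 2 - max (ℓ₁ - 3) 0 ^ 2) ^ 2 := by positivity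
  linarith

end ConfRFS

theorem Polynomial.exists_abs_eval_sub_le (p : Polynomial ℝ) (a b : ℝ) :
    ∃ C, 0 ≤ C ∧ ∀ x ∈ Icc a b, ∀ y ∈ Icc a b, |p.eval x - p.eval y| ≤ C * |x - y| := by
  obtain ⟨C, hC⟩ := (isCompact_Icc (a := a) (b := b)).exists_bound_of_continuousOn
    (f := fun x => p.derivative.eval x) p.derivative.continuous.continuousOn
  refine ⟨|C|, abs_nonneg _, fun x hx y hy => ?_⟩
  exact (convex_Icc a b).norm_image_sub_le_of_norm_hasDerivWithin_le (𝕜 := ℝ)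
    (f := fun x => p.eval x) (fun z _ => (p.hasDerivAt z).hasDerivWithinAt)
    (fun z hz => (hC z hz).trans (le_abs_self C)) hy hx

/-- A time-preserving path in an open spacetime may be replaced by a Lipschitz one with the same
endpoint. -/
theorem exists_lipschitz_worldline {M : Set (ℂ × ℝ)} (hM : IsOpen M) {γ : ℝ → ℂ} {s t : ℝ}
    (hst : s ≤ t) (hγ : ContinuousOn γ (Icc s t)) (hγM : ∀ r ∈ Icc s t, (γ r, r) ∈ M) :
    ∃ η : ℝ → ℂ, ContinuousOn η (Icc s t) ∧ (∀ r ∈ Icc s t, (η r, r) ∈ M) ∧ η t = γ t ∧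
      ∃ Λ, 0 ≤ Λ ∧ ∀ r ∈ Icc s t, ∀ r' ∈ Icc s t, ‖η r - η r'‖ ≤ Λ * |r - r'| := by
  have hG : IsCompact ((fun t => (γ t, t)) '' Icc s t) :=
    isCompact_Icc.image_of_continuousOn (hγ.prodMk continuousOn_id)
  obtain ⟨δ, hδ, hδM⟩ := hG.exists_cthickening_subset_open hM (image_subset_iff.2 hγM)
  obtain ⟨p, hp⟩ := exists_polynomial_near_of_continuousOn s t (fun r => (γ r).re)
    (Complex.continuous_re.comp_continuousOn hγ) (δ / 4) (by positivity)
  obtain ⟨q, hq⟩ := exists_polynomial_near_of_continuousOn s t (fun r => (γ r).im)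
    (Complex.continuous_im.comp_continuousOn hγ) (δ / 4) (by positivity)
  obtain ⟨C, hC0, hC⟩ := p.exists_abs_eval_sub_le s t
  obtain ⟨D, hD0, hD⟩ := q.exists_abs_eval_sub_le s t
  have ht : t ∈ Icc s t := right_mem_Icc.2 hst
  let η : ℝ → ℂ := fun r =>
    ⟨(γ t).re + (p.eval r - p.eval t), (γ t).im + (q.eval r - q.eval t)⟩
  have hL : ∀ r ∈ Icc s t, ∀ r' ∈ Icc s t, ‖η r - η r'‖ ≤ (C + D) * |r - r'| := by
    intro r hr r' hr'
    refine (Complex.norm_le_abs_re_add_abs_im _).trans ?_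
    have e1 : (η r - η r').re = p.eval r - p.eval r' := by simp [η]
    have e2 : (η r - η r').im = q.eval r - q.eval r' := by simp [η]
    rw [e1, e2, add_mul]
    exact add_le_add (hC r hr r' hr') (hD r hr r' hr')
  refine ⟨η, ?_, fun r hr => hδM ?_, by simp [η], C + D, by positivity, hL⟩
  · refine LipschitzOnWith.continuousOn (K := (C + D).toNNReal)
      (LipschitzOnWith.of_dist_le_mul fun x hx y hy => ?_)
    rw [dist_eq_norm, Real.dist_eq, Real.coe_toNNReal _ (by positivity)]
    exact hL x hx y hy
  · refine mem_cthickening_of_dist_le _ (γ r, r) δ _ ⟨r, hr, rfl⟩ ?_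
    rw [Prod.dist_eq, dist_self, dist_eq_norm]
    refine max_le ((Complex.norm_le_abs_re_add_abs_im _).trans ?_) hδ.le
    have e1 : (η r - γ r).re = (p.eval r - (γ r).re) - (p.eval t - (γ t).re) := by
      simp [η]; ring
    have e2 : (η r - γ r).im = (q.eval r - (γ r).im) - (q.eval t - (γ t).im) := by
      simp [η]; ring
    rw [e1, e2]
    have := abs_sub (p.eval r - (γ r).re) (p.eval t - (γ t).re)
    have := abs_sub (q.eval r - (γ r).im) (q.eval t - (γ t).im)
    linarith [hp r hr, hp t ht, hq r hr, hq t ht]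

namespace ConfRFS

variable {T : ℝ} {M : Set (ℂ × ℝ)} {u : ℂ → ℝ → ℝ}

theorem timeDeriv_le_of_timePreservingFrom (h : ConfRFS T M u) (hcomp : ConfRFSComplete T M u)
    {s t : ℝ} {z : ℂ} (hst : s < t) (hs : TimePreservingFrom M s z t) :
    timeDeriv (logFactor u) (z, t) ≤ 1 / (t - s) := by
  obtain ⟨γ, hγ, hγM, rfl⟩ := hs
  obtain ⟨η, hη, hηM, hηt, Λ, hΛ0, hΛ⟩ := exists_lipschitz_worldline h.opn hst.le hγ hγM
  obtain ⟨D, hD, hbar⟩ := h.exists_timeDeriv_lt_barrier hcomp hη hηM hΛ0 hΛ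
  rw [← hηt]
  refine le_of_forall_pos_le_add fun ε hε => ?_
  set A := max 1 ((4 * D + 29) / ε)
  have hA1 : 1 ≤ A := le_max_left _ _
  have hA : (4 * D + 29) / ε ≤ A := le_max_right _ _
  have hA0 : 0 < A := by linarith
  have ht : (η t, t) ∈ M := hηM t (right_mem_Icc.2 hst.le)
  have := hbar A hA0 t (right_mem_Ioc.2 hst) (η t) 0 (Reach.refl ht)
    (by rw [max_eq_right (by norm_num)]; exact hA0)
  rw [max_eq_right (by norm_num : (0 : ℝ) - 3 ≤ 0)] at this
  refine this.le.trans (add_le_add_right ?_ _)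
  rw [div_le_iff₀ hε] at hA
  rw [zero_pow two_ne_zero, sub_zero, div_le_iff₀ (by positivity)]
  have hA3 : A ^ 2 ≤ A ^ 3 := pow_le_pow_right₀ hA1 (by norm_num)
  have h1 : 1 ≤ A ^ 3 := one_le_pow₀ hA1
  have h2 : (4 * D + 29) * A ^ 3 ≤ A * ε * A ^ 3 :=
    mul_le_mul_of_nonneg_right hA (by positivity)
  calc 4 * A ^ 3 * D + 28 * A ^ 2 + 1 ≤ (4 * D + 29) * A ^ 3 := by linarith
    _ ≤ A * ε * A ^ 3 := h2
    _ = ε * (A ^ 2) ^ 2 := by ring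

theorem lap_log_le (h : ConfRFS T M u) (hcomp : ConfRFSComplete T M u) {p : ℂ × ℝ} (hp : p ∈ M) :
    lap (fun z => Real.log (u z p.2)) p.1 ≤ u p.1 p.2 / (p.2 - hindsight M p.1 p.2) := by
  obtain ⟨z, t⟩ := p
  have ht0 : 0 < t := (h.sub hp).1
  set S := {s : ℝ | 0 < s ∧ s ≤ t ∧ TimePreservingFrom M s z t} with hS
  have hbdd : BddBelow S := ⟨0, fun s hs => hs.1.le⟩
  obtain ⟨s₀, hs₀, hs₀t⟩ : ∃ s ∈ S, s < t := by
    obtain ⟨ε, hε, hεM⟩ := Metric.isOpen_iff.1 h.opn _ hp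
    refine ⟨max (t / 2) (t - ε / 2), ⟨lt_max_of_lt_left (by linarith),
      max_le (by linarith) (by linarith), fun _ => z, continuousOn_const, fun r hr => hεM ?_, rfl⟩,
      max_lt (by linarith) (by linarith)⟩
    rw [mem_ball, Prod.dist_eq, dist_self, Real.dist_eq]
    refine max_lt hε (abs_lt.2 ⟨?_, ?_⟩)
    · linarith [(le_max_right (t / 2) (t - ε / 2)).trans hr.1]
    · linarith [hr.2]
  have hht : hindsight M z t < t := (csInf_le hbdd hs₀).trans_lt hs₀t
  have hN : timeDeriv (logFactor u) (z, t) * (t - hindsight M z t) ≤ 1 := by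
    rcases le_or_gt (timeDeriv (logFactor u) (z, t)) 0 with hn | hn
    · nlinarith
    · have : t - 1 / timeDeriv (logFactor u) (z, t) ≤ hindsight M z t := by
        refine le_csInf ⟨s₀, hs₀⟩ fun s hs => ?_
        rcases hs.2.1.eq_or_lt with rfl | hst
        · linarith [one_div_pos.2 hn]
        · have := h.timeDeriv_le_of_timePreservingFrom hcomp hst hs.2.2
          have := (le_one_div hn (sub_pos.2 hst)).1 this
          linarith
      rw [mul_comm, ← le_div_iff₀ hn]
      linarith
  have e := h.lap_log_eq hp
  rw [e, ← h.exp_mul_timeDeriv hp, h.exp_logFactor hp, le_div_iff₀ (sub_pos.2 hht), mul_assoc]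
  exact mul_le_of_le_one_right (h.pos _ hp).le hN

end ConfRFS

/-- Scalar curvature lower bound `R ≥ −1/(t−h)` in a complete conformal Ricci flow
spacetime, stated equivalently as `Δ log u ≤ u/(t−h)`; and `Δ log u ≤ u/t` in the initially
determined case. -/
theorem scalar_curvature_lower_bound_complete
    (T : ℝ) (hT : 0 < T) (M : Set (ℂ × ℝ)) (u : ℂ → ℝ → ℝ)
    (hRF : ConfRFS T M u) (hcomp : ConfRFSComplete T M u) :
    (∀ p ∈ M, lap (fun z => Real.log (u z p.2)) p.1
        ≤ u p.1 p.2 / (p.2 - hindsight M p.1 p.2)) ∧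
    (InitiallyDetermined M →
      ∀ p ∈ M, lap (fun z => Real.log (u z p.2)) p.1 ≤ u p.1 p.2 / p.2) := by
  refine ⟨fun p hp => hRF.lap_log_le hcomp hp, fun hI p hp => ?_⟩
  have := hRF.lap_log_le hcomp hp
  rwa [hI p hp, sub_zero] at this
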